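/- arXiv:2010.12336 — 3 statements merged into one kernel-verified Lean document; each statement's English description precedes it below -/
import Mathlib

section
/- Let F ⊆ ℂ be a finite set (possibly empty) and n ≥ 1. Then the ordered configuration space C_n(ℂ ∖ F) is aspherical: for every k ≥ 2 and every basepoint p ∈ C_n(ℂ ∖ F), the homotopy group π_k(C_n(ℂ ∖ F), p) is trivial. -/
/-- The ordered configuration space of `n` points of a topological space `X`. -/
abbrev ConfSpace (n : ℕ) (X : Type*) [TopologicalSpace X] : Type _ :=
  {f : Fin n → X // ∀ i j : Fin n, i ≠ j → f i ≠ f j}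

section AsphSection
open Set Topology unitInterval
namespace Asph


section words
variable {α : Type*} [DecidableEq α]

/-- Toggle the leading letter. -/
def tog (j : α) : List α → List α
  | [] => [j]
  | a :: t => if a = j then t else j :: a :: t

abbrev Wd (α : Type*) := {l : List α // l.IsChain (· ≠ ·)}

theorem tog_chain (j : α) (l : List α) (h : l.IsChain (· ≠ ·)) : (tog j l).IsChain (· ≠ ·) := by
  cases l with
  | nil => simp [tog]
  | cons a t =>
    by_cases haj : a = j
    · simp only [tog, haj, if_true]
      exact h.tail
    · simp only [tog, haj, if_false]
      exact List.IsChain.cons_cons (fun e => haj e.symm) h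

theorem tog_tog (j : α) (l : List α) (h : l.IsChain (· ≠ ·)) : tog j (tog j l) = l := by
  cases l with
  | nil => simp [tog]
  | cons a t =>
    by_cases haj : a = j
    · subst haj
      simp only [tog, if_true]
      cases t with
      | nil => simp
      | cons b t' =>
        have : a ≠ b := (List.isChain_cons_cons.1 h).1
        simp [this.symm]
    · simp [tog, haj]

theorem tog_cases (j : α) (l : List α) : tog j l = j :: l ∨ l = j :: tog j l := by
  cases l with
  | nil => simp [tog]
  | cons a t =>
    by_cases haj : a = j <;> simp [tog, haj]

theorem tog_even (j : α) (l : List α) : Even (tog j l).length ↔ ¬ Even l.length := by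
  rcases tog_cases j l with h | h
  · rw [h]; simp [Nat.even_add_one]
  · conv_rhs => rw [h]
    simp [Nat.even_add_one]

def tg (j : α) (l : Wd α) : Wd α := ⟨tog j l.1, tog_chain j _ l.2⟩

theorem tg_tg (j : α) (l : Wd α) : tg j (tg j l) = l := Subtype.ext (tog_tog j _ l.2)

end words

noncomputable def cnt (F : Finset ℝ) (x : ℝ) : ℕ := (F.filter (· < x)).card

def J (F : Finset ℝ) (j : ℕ) : Set ℝ := {x | x ∉ F ∧ cnt F x = j}

abbrev Lt (F : Finset ℝ) := {j : ℕ // (J F j).Nonempty}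

theorem J_ord (F : Finset ℝ) (j : ℕ) : (J F j).OrdConnected := by
  rw [ordConnected_iff]
  rintro x ⟨hx, hxj⟩ z ⟨hz, hzj⟩ - y ⟨hxy, hyz⟩
  have h1 : F.filter (· < x) ⊆ F.filter (· < z) := by
    intro a; simp only [Finset.mem_filter]; exact fun h => ⟨h.1, by linarith [h.2]⟩
  have h2 := Finset.eq_of_subset_of_card_le h1 (by rw [cnt] at hxj hzj; omega)
  have key : ∀ a ∈ F, a < z → a < x := by
    intro a ha haz
    have : a ∈ F.filter (· < z) := by simp [ha, haz]
    rw [← h2] at this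
    exact (Finset.mem_filter.1 this).2
  refine ⟨fun hy => ?_, ?_⟩
  · rcases hyz.eq_or_lt with h | h
    · exact hz (h ▸ hy)
    · exact absurd (key y hy h) (not_lt.2 hxy)
  · rw [← hxj, cnt, cnt]
    congr 1
    ext a
    simp only [Finset.mem_filter, and_congr_right_iff]
    exact fun ha => ⟨fun h => key a ha (by linarith), fun h => by linarith⟩

theorem cnt_ev (F : Finset ℝ) (x : ℝ) (hx : x ∉ F) : ∀ᶠ y in 𝓝 x, y ∉ F ∧ cnt F y = cnt F x := by
  have h : ∀ a ∈ F, ∀ᶠ y in 𝓝 x, y ≠ a ∧ (a < y ↔ a < x) := by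
    intro a ha
    rcases lt_trichotomy a x with h | h | h
    · filter_upwards [lt_mem_nhds h] with y hy
      exact ⟨hy.ne', iff_of_true hy h⟩
    · exact absurd (h ▸ ha) hx
    · filter_upwards [gt_mem_nhds h] with y hy
      exact ⟨hy.ne, iff_of_false (not_lt.2 hy.le) (not_lt.2 h.le)⟩
  replace h := (Filter.eventually_all_finset F).2 h
  filter_upwards [h] with y hy
  refine ⟨fun hyF => (hy y hyF).1 rfl, ?_⟩
  rw [cnt, cnt]; congr 1
  ext a
  simp only [Finset.mem_filter, and_congr_right_iff]
  exact fun ha => (hy a ha).2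

theorem J_open (F : Finset ℝ) (j : ℕ) : IsOpen (J F j) := by
  rw [isOpen_iff_mem_nhds]
  rintro x ⟨hx, rfl⟩
  exact cnt_ev F x hx

/-- The plane punctured at finitely many real points. -/
abbrev XX (F : Finset ℝ) := {z : ℂ // ∀ a ∈ F, z ≠ (a : ℂ)}

theorem re_notMem {F : Finset ℝ} (z : XX F) (h : z.1.im = 0) : z.1.re ∉ F :=
  fun hm => z.2 _ hm (Complex.ext (by simp) (by simp [h]))

instance (F : Finset ℝ) : Nonempty (Lt F) := by
  obtain ⟨x, hx⟩ := Infinite.exists_notMem_finset F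
  exact ⟨⟨cnt F x, x, hx, rfl⟩⟩

open Classical in
noncomputable def idx {F : Finset ℝ} (z : XX F) : Lt F :=
  if h : z.1.im = 0 then ⟨cnt F z.1.re, z.1.re, re_notMem z h, rfl⟩ else Classical.arbitrary _

theorem idx_spec {F : Finset ℝ} (z : XX F) (h : z.1.im = 0) : z.1.re ∈ J F (idx z).1 := by
  simp only [idx, h, dif_pos]
  exact ⟨re_notMem z h, rfl⟩

theorem J_unique {F : Finset ℝ} {i j : Lt F} {x : ℝ} (hi : x ∈ J F i.1) (hj : x ∈ J F j.1) : i = j :=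
  Subtype.ext (hi.2.symm.trans hj.2)

def Ub {F : Finset ℝ} (j : Lt F) : Set (XX F) := {z | z.1.im = 0 → z.1.re ∈ J F j.1}

theorem Ub_open {F : Finset ℝ} (j : Lt F) : IsOpen (Ub j) := by
  have : Ub j = {z : XX F | z.1.im ≠ 0} ∪ {z : XX F | z.1.re ∈ J F j.1} := by
    ext z; simp only [Ub, mem_ofPred_eq, mem_union]; tauto
  rw [this]
  refine IsOpen.union (isOpen_ne_fun (by fun_prop) (by fun_prop)) ?_
  exact (J_open F j.1).preimage (f := fun z : XX F => z.1.re) (by fun_prop)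

instance {α : Type*} : TopologicalSpace (Wd α) := ⊥
instance {α : Type*} : DiscreteTopology (Wd α) := ⟨rfl⟩

noncomputable def cc {F : Finset ℝ} (i j : Lt F) (z : XX F) (v : Wd (Lt F)) : Wd (Lt F) :=
  if z.1.im < 0 then tg j (tg i v) else v

theorem cc_self {F : Finset ℝ} (i : Lt F) (z : XX F) (v : Wd (Lt F)) : cc i i z v = v := by
  simp [cc, tg_tg]

noncomputable def core (F : Finset ℝ) : FiberBundleCore (Lt F) (XX F) (Wd (Lt F)) where
  baseSet := Ub
  isOpen_baseSet := Ub_open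
  indexAt := idx
  mem_baseSet_at := fun z h => idx_spec z h
  coordChange := cc
  coordChange_self := fun i x _ v => cc_self i x v
  continuousOn_coordChange := by
    intro i j
    rintro ⟨z, v⟩ ⟨⟨hi, hj⟩, -⟩
    apply ContinuousAt.continuousWithinAt
    have hv : ∀ᶠ q : XX F × Wd (Lt F) in 𝓝 (z, v), q.2 = v :=
      (continuous_snd.tendsto (z, v)).eventually (p := fun w => w = v)
        (by rw [nhds_discrete]; rfl)
    by_cases h0 : z.1.im = 0
    · have : i = j := J_unique (hi h0) (hj h0)
      subst this
      simp only [cc_self]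
      exact continuousAt_snd
    · have hc : Continuous fun q : XX F × Wd (Lt F) => q.1.1.im := by fun_prop
      apply (continuousAt_const (y := cc i j z v)).congr
      rcases lt_or_gt_of_ne h0 with h | h
      · filter_upwards [hv, (hc.tendsto (z, v)).eventually_lt_const h] with q h1 h2
        simp [cc, h1, h2, h]
      · filter_upwards [hv, (hc.tendsto (z, v)).eventually_const_lt h] with q h1 h2
        simp [cc, h1, not_lt.2 h2.le, not_lt.2 h.le]
  coordChange_comp := by
    intro i j k x _ v
    by_cases h : x.1.im < 0 <;> simp [cc, h, tg_tg]

theorem core_cov (F : Finset ℝ) : IsCoveringMap (core F).proj :=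
  IsCoveringMap.mk _ (fun _ => Wd (Lt F)) (fun x => (core F).localTrivAt x)
    (fun x => (core F).mem_localTrivAt_baseSet x)

theorem exists_lift {F : Finset ℝ} {k : ℕ} (f : C(Fin k → I, XX F))
    (v : Wd (Lt F)) : ∃ g : C(Fin k → I, (core F).TotalSpace),
      (∀ x, (g x).1 = f x) ∧ (g 0) = ⟨f 0, v⟩ := by
  let e : (core F).TotalSpace := ⟨f 0, v⟩
  let H : C(I × (Fin k → I), XX F) := f.comp ⟨fun q i => q.1 * q.2 i, by fun_prop⟩
  have H0 : ∀ a, H (0, a) = (core F).proj (ContinuousMap.const (Fin k → I) e a) := by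
    intro a
    change f _ = f 0
    congr 1
    ext i; simp
  let G := (core_cov F).liftHomotopy H (ContinuousMap.const _ e) H0
  refine ⟨G.comp ⟨fun x => (1, x), by fun_prop⟩, fun x => ?_, ?_⟩
  · have := congr_fun ((core_cov F).liftHomotopy_lifts H (ContinuousMap.const _ e) H0) (1, x)
    refine this.trans ?_
    change f _ = f x
    congr 1
    ext i; simp
  · change (core_cov F).liftHomotopy H (ContinuousMap.const _ e) H0 (1, 0) = e
    rw [IsCoveringMap.liftHomotopy_apply]
    have h : (ContinuousMap.const I e) = (core_cov F).liftPath
      (H.comp <| (ContinuousMap.id I).prodMk <| .const I 0) e (H0 0) := by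
      refine ((core_cov F).eq_liftPath_iff' _).2 ⟨?_, rfl⟩
      funext t
      change f 0 = f _
      congr 1
      ext i; simp
    exact (congr_arg (fun q : C(I, (core F).TotalSpace) => q 1) h).symm


def LFp {F : Finset ℝ} {K : Type*} [TopologicalSpace K] (f : K → XX F) (L : K → List (Lt F)) :
    Prop :=
  ∀ x, ∃ j s, ∀ᶠ y in 𝓝 x, ((f y).1.im = 0 → (f y).1.re ∈ J F j.1) ∧
    (0 < (-1 : ℝ) ^ s.length * (f y).1.im → L y = s) ∧
    ((-1 : ℝ) ^ s.length * (f y).1.im ≤ 0 → L y = j :: s)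

open Classical in
theorem exists_dev {F : Finset ℝ} {k : ℕ} (f : C(Fin k → I, XX F)) (h0 : 0 < (f 0).1.im) :
    ∃ L : (Fin k → I) → List (Lt F), LFp f L ∧ L 0 = [] := by
  obtain ⟨g, hg, hg0⟩ := exists_lift f ⟨[], by simp⟩
  let V : (Fin k → I) → Wd (Lt F) := fun y => (g y).2
  have hloc : ∀ x, ∀ᶠ y in 𝓝 x, f y ∈ Ub (idx (f x)) ∧
      cc (idx (f y)) (idx (f x)) (f y) (V y) = V x := by
    intro x
    have hxs : g x ∈ ((core F).localTriv (idx (f x))).source := by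
      rw [FiberBundleCore.mem_localTriv_source, hg]
      exact (core F).mem_baseSet_at (f x)
    have h1 := ((core F).localTriv (idx (f x))).open_source
    have hc : ContinuousAt (fun y => (((core F).localTriv (idx (f x))) (g y)).2) x :=
      ContinuousAt.snd (ContinuousAt.comp (f := g)
        (((core F).localTriv (idx (f x))).continuousOn_toFun.continuousAt
          (h1.mem_nhds hxs)) g.continuous.continuousAt)
    have hf : ∀ y, (((core F).localTriv (idx (f x))) (g y)).2
        = cc (idx (f y)) (idx (f x)) (f y) (V y) := by
      intro y
      rw [FiberBundleCore.localTriv_apply, ← hg y]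
      rfl
    have h2 : ∀ᶠ y in 𝓝 x, f y ∈ Ub (idx (f x)) :=
      f.continuous.continuousAt.eventually ((Ub_open _).mem_nhds (fun h => idx_spec _ h))
    have h3 := hc.eventually (p := fun w => w = V x) (by
      rw [nhds_discrete, Filter.eventually_pure]
      exact (hf x).trans (cc_self _ _ _))
    filter_upwards [h2, h3] with y h2 h3
    exact ⟨h2, by rw [← hf]; exact h3⟩
  have hpar : IsLocallyConstant (fun y => Even (V y).1.length) := by
    rw [IsLocallyConstant.iff_eventually_eq]
    intro x
    filter_upwards [hloc x] with y hy
    rw [← hy.2, cc]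
    split_ifs with h
    · simp [tg, tog_even]
    · rfl
  have hV0 : (V 0).1 = [] := by
    change ((g 0).2 : Wd (Lt F)).1 = []
    rw [hg0]
  have hev : ∀ y, Even (V y).1.length := by
    intro y
    have := hpar.apply_eq_of_preconnectedSpace y 0
    rw [this, hV0]; simp
  let L : (Fin k → I) → List (Lt F) := fun y =>
    if 0 < (f y).1.im then (V y).1 else if (f y).1.im < 0 then tog (idx (f y)) (V y).1
    else if (V y).1.length < (tog (idx (f y)) (V y).1).length then tog (idx (f y)) (V y).1
    else (V y).1
  refine ⟨L, ?_, ?_⟩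
  · intro x
    have key : ∀ᶠ y in 𝓝 x, f y ∈ Ub (idx (f x)) ∧ (0 < (f y).1.im → L y = (V x).1) ∧
        ((f y).1.im < 0 → L y = tog (idx (f x)) (V x).1) ∧
        ((f y).1.im = 0 → L y = if (V x).1.length < (tog (idx (f x)) (V x).1).length then
          tog (idx (f x)) (V x).1 else (V x).1) := by
      filter_upwards [hloc x] with y hy
      refine ⟨hy.1, fun h => ?_, fun h => ?_, fun h => ?_⟩
      · rw [← hy.2]
        simp [L, h, cc, not_lt.2 h.le]
      · rw [← hy.2]
        have := tog_tog (idx (f x)) _ (tg (idx (f y)) (V y)).2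
        simp only [L, h, cc, not_lt.2 h.le, if_true, if_false]
        exact this.symm
      · have h1 : idx (f y) = idx (f x) := J_unique (idx_spec _ h) (hy.1 h)
        have h2 := hy.2
        rw [h1, cc_self] at h2
        simp only [L, h, lt_irrefl, if_false, h2, h1]
    rcases tog_cases (idx (f x)) (V x).1 with h | h
    · refine ⟨idx (f x), (V x).1, ?_⟩
      rw [(hev x).neg_one_pow]
      filter_upwards [key] with y hy
      rw [h] at hy
      simp only [List.length_cons, lt_add_iff_pos_right, zero_lt_one, if_true] at hy
      refine ⟨hy.1, fun h => hy.2.1 (by simpa using h), fun h => ?_⟩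
      rcases (by simpa using h : (f y).1.im ≤ 0).lt_or_eq with h | h
      · exact hy.2.2.1 h
      · exact hy.2.2.2 h
    · refine ⟨idx (f x), tog (idx (f x)) (V x).1, ?_⟩
      have ho : Odd (tog (idx (f x)) (V x).1).length := by
        rw [← Nat.not_even_iff_odd, tog_even]; simpa using hev x
      rw [ho.neg_one_pow]
      filter_upwards [key] with y hy
      rw [← h]
      have hl : ¬ (V x).1.length < (tog (idx (f x)) (V x).1).length := by
        have := congrArg List.length h
        rw [List.length_cons] at this
        omega
      rw [if_neg hl] at hy
      refine ⟨hy.1, fun h => hy.2.2.1 (by linarith), fun h => ?_⟩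
      rcases (by linarith : 0 ≤ (f y).1.im).lt_or_eq with h | h
      · exact hy.2.1 h
      · exact hy.2.2.2 h.symm
  · simp [L, h0, hV0]


theorem hrel_mk {K Y : Type*} [TopologicalSpace K] [TopologicalSpace Y] {P : Y → Prop} {S : Set K}
    (g : C(K, {z : Y // P z})) (h : I × K → Y) (hc : Continuous h) (hP : ∀ q, P (h q))
    (h0 : ∀ x, h (0, x) = (g x).1) (hS : ∀ t, ∀ x ∈ S, h (t, x) = (g x).1) :
    ∃ g' : C(K, {z : Y // P z}), (∀ x, (g' x).1 = h (1, x)) ∧ g.HomotopicRel g' S := by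
  refine ⟨⟨fun x => ⟨h (1, x), hP _⟩, by fun_prop⟩, fun x => rfl, ⟨?_⟩⟩
  exact
    { toFun := fun q => ⟨h q, hP q⟩
      continuous_toFun := by fun_prop
      map_zero_left := fun x => Subtype.ext (h0 x)
      map_one_left := fun x => rfl
      prop' := fun t x hx => Subtype.ext (hS t x hx) }

noncomputable def lett {F : Finset ℝ} (d : ℕ) (l : List (Lt F)) : Lt F :=
  (l.reverse[d]?).getD (Classical.arbitrary _)

theorem lett_self {F : Finset ℝ} (j : Lt F) (s : List (Lt F)) : lett s.length (j :: s) = j := by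
  simp [lett]

theorem lett_lt {F : Finset ℝ} {d : ℕ} (j : Lt F) (s : List (Lt F)) (h : d < s.length) :
    lett d (j :: s) = lett d s := by
  simp only [lett, List.reverse_cons]
  rw [List.getElem?_append_left (by simpa using h)]

theorem exists_retr {F : Finset ℝ} (j : Lt F) : ∃ r : C(XX F, ℝ), (∀ z, r z ∈ J F j.1) ∧
    ∀ z : XX F, z.1.im = 0 → z.1.re ∈ J F j.1 → r z = z.1.re := by
  let s : Set (XX F) := {z | z.1.im = 0 ∧ z.1.re ∈ J F j.1}
  have hs : IsClosed s := by
    rw [← isOpen_compl_iff, isOpen_iff_mem_nhds]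
    intro z hz
    by_cases h0 : z.1.im = 0
    · have hj : z.1.re ∉ J F j.1 := fun h => hz ⟨h0, h⟩
      filter_upwards [(Ub_open (idx z)).mem_nhds (fun h => idx_spec z h)] with y hy
      rintro ⟨h1, h2⟩
      have := J_unique (hy h1) h2
      exact hj (this ▸ idx_spec z h0)
    · have : IsOpen {z : XX F | z.1.im ≠ 0} := isOpen_ne_fun (by fun_prop) (by fun_prop)
      filter_upwards [this.mem_nhds h0] with y hy
      exact fun h => hy h.1
  have := J_ord F j.1
  obtain ⟨r, hr, hrs⟩ := ContinuousMap.exists_restrict_eq_forall_mem_of_closed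
    (⟨fun z : s => z.1.1.re, by fun_prop⟩ : C(s, ℝ)) (t := J F j.1) (fun z => z.2.2) j.2 hs
  refine ⟨r, hr, fun z h1 h2 => ?_⟩
  exact congr_arg (fun q : C(s, ℝ) => q ⟨z, h1, h2⟩) hrs

noncomputable def rr {F : Finset ℝ} (j : Lt F) : C(XX F, ℝ) := (exists_retr j).choose
theorem rr_mem {F : Finset ℝ} (j : Lt F) (z : XX F) : rr j z ∈ J F j.1 :=
  (exists_retr j).choose_spec.1 z
theorem rr_eq {F : Finset ℝ} (j : Lt F) (z : XX F) (h : z.1.im = 0) (h' : z.1.re ∈ J F j.1) :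
    rr j z = z.1.re :=
  (exists_retr j).choose_spec.2 z h h'

noncomputable def Hm {F : Finset ℝ} (j : Lt F) (sg : ℝ) (t : ℝ) (z : XX F) : ℂ :=
  ⟨(1 - t) * z.1.re + t * rr j z, (1 - t) * z.1.im + sg * (t * (1 - t) * ‖z.1 - (rr j z : ℂ)‖)⟩

theorem Hm_cont {F : Finset ℝ} (j : Lt F) (sg : ℝ) :
    Continuous fun q : ℝ × XX F => Hm j sg q.1 q.2 := by
  have : (fun q : ℝ × XX F => Hm j sg q.1 q.2) = fun q =>
    (((1 - q.1) * q.2.1.re + q.1 * rr j q.2 : ℝ) : ℂ) +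
    (((1 - q.1) * q.2.1.im + sg * (q.1 * (1 - q.1) * ‖q.2.1 - (rr j q.2 : ℂ)‖) : ℝ) : ℂ) *
      Complex.I := by
    funext q
    apply Complex.ext <;> simp [Hm]
  rw [this]
  fun_prop

theorem Hm_zero {F : Finset ℝ} (j : Lt F) (sg : ℝ) (z : XX F) : Hm j sg 0 z = z.1 := by
  apply Complex.ext <;> simp [Hm]

theorem Hm_fix {F : Finset ℝ} (j : Lt F) (sg t : ℝ) (z : XX F) (h : z.1.im = 0)
    (h' : z.1.re ∈ J F j.1) : Hm j sg t z = z.1 := by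
  have hr := rr_eq j z h h'
  have hz : z.1 - (rr j z : ℂ) = 0 := by
    rw [hr]; apply Complex.ext <;> simp [h]
  apply Complex.ext
  · simp only [Hm, hr]; ring
  · simp [Hm, hz, h]

theorem Hm_im_one {F : Finset ℝ} (j : Lt F) (sg : ℝ) (z : XX F) : (Hm j sg 1 z).im = 0 := by
  simp [Hm]

theorem Hm_mem {F : Finset ℝ} (j : Lt F) (sg t : ℝ) (z : XX F) (hsg : sg * sg = 1)
    (h : 0 ≤ sg * z.1.im) (ht0 : 0 ≤ t) (ht1 : t ≤ 1) : ∀ a ∈ F, Hm j sg t z ≠ (a : ℂ) := by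
  intro a ha he
  have hre := congr_arg Complex.re he
  have him := congr_arg Complex.im he
  simp only [Hm, Complex.ofReal_re, Complex.ofReal_im] at hre him
  rcases ht1.eq_or_lt with rfl | ht1
  · apply (rr_mem j z).1
    have : rr j z = a := by linarith
    rwa [this]
  have h1 : (1 - t) * (sg * z.1.im) + (1 - t) * (t * ‖z.1 - (rr j z : ℂ)‖) = 0 := by
    linear_combination sg * him - (t * (1 - t) * ‖z.1 - (rr j z : ℂ)‖) * hsg
  have h1t : 0 < 1 - t := by linarith
  have n1 : 0 ≤ t * ‖z.1 - (rr j z : ℂ)‖ := by positivity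
  have h2 : sg * z.1.im = 0 := by nlinarith
  have h3 : t * ‖z.1 - (rr j z : ℂ)‖ = 0 := by nlinarith
  have h4 : z.1.im = 0 := by linear_combination sg * h2 - z.1.im * hsg
  rcases mul_eq_zero.1 h3 with h5 | h5
  · apply z.2 a ha
    rw [← he, h5, Hm_zero]
  · have h6 : z.1 = (rr j z : ℂ) := by rwa [norm_eq_zero, sub_eq_zero] at h5
    have h7 : z.1.re = rr j z := by
      have := congr_arg Complex.re h6; simpa using this
    apply z.2 a ha
    rw [h6]
    congr 1
    rw [h7] at hre; linarith

theorem LFp_sign {F : Finset ℝ} {K : Type*} [TopologicalSpace K] {f : K → XX F}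
    {L : K → List (Lt F)} (h : LFp f L) (x : K) : 0 ≤ (-1 : ℝ) ^ (L x).length * (f x).1.im := by
  obtain ⟨j, s, hs⟩ := h x
  have hs := hs.self_of_nhds
  rcases lt_or_ge 0 ((-1 : ℝ) ^ s.length * (f x).1.im) with h | h
  · rw [hs.2.1 h]; exact h.le
  · rw [hs.2.2 h, List.length_cons, pow_succ]; linarith

theorem push {F : Finset ℝ} {K : Type*} [TopologicalSpace K] (f : C(K, XX F))
    (L : K → List (Lt F)) (hL : LFp f L) (S : Set K) (hS : ∀ x ∈ S, L x = []) (d : ℕ)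
    (g : C(K, XX F)) (h1 : ∀ x, (L x).length ≤ d + 1 → g x = f x)
    (h2 : ∀ x, d + 1 < (L x).length → (g x).1.im = 0) :
    ∃ g' : C(K, XX F), g.HomotopicRel g' S ∧ (∀ x, (L x).length ≤ d → g' x = f x) ∧
      (∀ x, d < (L x).length → (g' x).1.im = 0) := by
  classical
  let sg : ℝ := (-1) ^ (d + 1)
  let h : I × K → ℂ := fun q =>
    if d < (L q.2).length then Hm (lett d (L q.2)) sg q.1 (g q.2) else (g q.2).1
  have hHc : ∀ j : Lt F, Continuous fun q : I × K => Hm j sg q.1 (g q.2) := fun j =>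
    (Hm_cont j sg).comp (by fun_prop : Continuous fun q : I × K => ((q.1 : ℝ), g q.2))
  have hgc : Continuous fun q : I × K => (g q.2).1 := by fun_prop
  have hc : Continuous h := by
    rw [continuous_iff_continuousAt]
    rintro ⟨t, x⟩
    obtain ⟨j, s, hs⟩ := hL x
    have hsx := hs.self_of_nhds
    have hs' := (continuous_snd.tendsto ((t, x) : I × K)).eventually hs
    have hfc : Continuous fun q : I × K => (-1 : ℝ) ^ s.length * (f q.2).1.im := by fun_prop
    rcases lt_trichotomy d s.length with hd | hd | hd
    · apply ((hHc (lett d s)).continuousAt).congr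
      filter_upwards [hs'] with q hq
      rcases lt_or_ge 0 ((-1 : ℝ) ^ s.length * (f q.2).1.im) with hh | hh
      · simp only [h, hq.2.1 hh, hd, if_true]
      · simp only [h, hq.2.2 hh, lett_lt j s hd, List.length_cons, hd.trans (Nat.lt_succ_self _),
          if_true]
    · have hev : ∀ᶠ q : I × K in 𝓝 (t, x), (if (-1 : ℝ) ^ s.length * (f q.2).1.im ≤ 0 then
          Hm j sg q.1 (g q.2) else (g q.2).1) = h q := by
        filter_upwards [hs'] with q hq
        rcases lt_or_ge 0 ((-1 : ℝ) ^ s.length * (f q.2).1.im) with hh | hh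
        · simp [h, hq.2.1 hh, hd, not_le.2 hh]
        · subst hd
          simp only [h, hq.2.2 hh, lett_self, List.length_cons, Nat.lt_succ_self, if_true, hh]
      refine ContinuousAt.congr ?_ hev
      rcases lt_trichotomy ((-1 : ℝ) ^ s.length * (f x).1.im) 0 with h0 | h0 | h0
      · apply ((hHc j).continuousAt).congr
        filter_upwards [(hfc.tendsto (t, x)).eventually_lt_const h0] with q hq
        rw [if_pos hq.le]
      · have hLx := hsx.2.2 h0.le
        have him : (f x).1.im = 0 := by
          rcases mul_eq_zero.1 h0 with h | h
          · exact absurd h (by simp)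
          · exact h
        have hgf := h1 x (by rw [hLx, List.length_cons, hd])
        have e : Hm j sg t (g x) = (g x).1 :=
          Hm_fix j sg t _ (by rw [hgf]; exact him) (by rw [hgf]; exact hsx.1 him)
        have a1 := (hHc j).tendsto (t, x)
        have a2 := hgc.tendsto (t, x)
        simp only [e] at a1 a2
        have := Filter.Tendsto.if' (p := fun q : I × K => (-1 : ℝ) ^ s.length * (f q.2).1.im ≤ 0)
          a1 a2
        rw [ContinuousAt]
        simp only [h0, le_refl, if_true, e]
        exact this
      · apply (hgc.continuousAt).congr
        filter_upwards [(hfc.tendsto (t, x)).eventually_const_lt h0] with q hq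
        rw [if_neg (not_le.2 hq)]
    · apply (hgc.continuousAt).congr
      filter_upwards [hs'] with q hq
      rcases lt_or_ge 0 ((-1 : ℝ) ^ s.length * (f q.2).1.im) with hh | hh
      · simp only [h, hq.2.1 hh, not_lt.2 hd.le, if_false]
      · have : ¬ d < s.length + 1 := by omega
        simp only [h, hq.2.2 hh, List.length_cons, this, if_false]
  have hsg : sg * sg = 1 := by
    simp only [sg, ← pow_add]
    exact Even.neg_one_pow ⟨_, rfl⟩
  have hP : ∀ q, ∀ a ∈ F, h q ≠ (a : ℂ) := by
    rintro ⟨t, x⟩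
    by_cases hd : d < (L x).length
    · simp only [h, hd, if_true]
      apply Hm_mem _ _ _ _ hsg _ t.2.1 t.2.2
      rcases (Nat.succ_le_of_lt hd).eq_or_lt with he | he
      · rw [h1 x he.ge]
        have := LFp_sign hL x
        rwa [← he] at this
      · rw [h2 x he]; simp
    · simp only [h, hd, if_false]
      exact (g x).2
  obtain ⟨g', hg', hr⟩ := hrel_mk (S := S) g h hc hP
    (fun x => by by_cases hd : d < (L x).length <;> simp [h, hd, Hm_zero])
    (fun t x hx => by simp [h, hS x hx])
  refine ⟨g', hr, fun x hx => ?_, fun x hx => ?_⟩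
  · rw [← h1 x (by omega)]
    apply Subtype.ext
    rw [hg']
    simp [h, not_lt.2 hx]
  · rw [hg']
    simp [h, hx, Hm_im_one]

theorem planar_real {F : Finset ℝ} {k : ℕ} (S : Set (Fin k → I)) (hS : IsPreconnected S)
    (hS0 : 0 ∈ S) (p : XX F) (hp : 0 < p.1.im) (f : C(Fin k → I, XX F)) (hf : ∀ x ∈ S, f x = p) :
    f.HomotopicRel (ContinuousMap.const _ p) S := by
  classical
  obtain ⟨L, hL, hL0⟩ := exists_dev f (by rw [hf 0 hS0]; exact hp)
  have hLS : ∀ x ∈ S, L x = [] := by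
    intro x hx
    have hc : ContinuousOn (fun y => decide (L y = [])) S := by
      intro y hy
      obtain ⟨j, s, hs⟩ := hL y
      rw [ContinuousWithinAt, nhds_discrete, Filter.tendsto_pure]
      have hsy := hs.self_of_nhds
      filter_upwards [mem_nhdsWithin_of_mem_nhds hs, self_mem_nhdsWithin] with z hz hzS
      simp only [hf z hzS] at hz
      simp only [hf y hy] at hsy
      rcases lt_or_ge 0 ((-1 : ℝ) ^ s.length * p.1.im) with h | h
      · rw [hz.2.1 h, hsy.2.1 h]
      · rw [hz.2.2 h, hsy.2.2 h]
    have := hS.constant hc hx hS0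
    simpa [hL0] using this
  have hb : ∃ N, ∀ x, (L x).length ≤ N := by
    have hloc : ∀ x, ∃ n, ∀ᶠ y in 𝓝 x, (L y).length ≤ n := by
      intro x
      obtain ⟨j, s, hs⟩ := hL x
      refine ⟨s.length + 1, ?_⟩
      filter_upwards [hs] with y hy
      rcases lt_or_ge 0 ((-1 : ℝ) ^ s.length * (f y).1.im) with h | h
      · rw [hy.2.1 h]; omega
      · rw [hy.2.2 h]; simp
    choose n hn using hloc
    obtain ⟨T, -, hT⟩ := isCompact_univ.elim_nhds_subcover (fun x => {y | (L y).length ≤ n x})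
      (fun x _ => hn x)
    refine ⟨T.sup n, fun x => ?_⟩
    obtain ⟨y, hy, hxy⟩ := mem_iUnion₂.1 (hT (mem_univ x))
    exact le_trans hxy (Finset.le_sup (f := n) hy)
  obtain ⟨N, hN⟩ := hb
  have key : ∀ m, m ≤ N → ∃ g : C(Fin k → I, XX F), f.HomotopicRel g S ∧
      (∀ x, (L x).length ≤ N - m → g x = f x) ∧ (∀ x, N - m < (L x).length → (g x).1.im = 0) := by
    intro m
    induction m with
    | zero =>
      exact fun _ => ⟨f, .refl f, fun _ _ => rfl, fun x hx => absurd (hN x) (by omega)⟩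
    | succ m ih =>
      intro hm
      obtain ⟨g, hg, h1, h2⟩ := ih (by omega)
      obtain ⟨g', hg', h1', h2'⟩ := push f L hL S hLS (N - (m + 1)) g
        (fun x hx => h1 x (by omega)) (fun x hx => h2 x (by omega))
      exact ⟨g', hg.trans hg', h1', h2'⟩
  obtain ⟨g, hg, h1, h2⟩ := key N le_rfl
  refine hg.trans ?_
  have him : ∀ x, 0 ≤ (g x).1.im := by
    intro x
    rcases Nat.eq_zero_or_pos (L x).length with h | h
    · rw [h1 x (by omega)]
      have := LFp_sign hL x
      rw [h] at this
      simpa using this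
    · rw [h2 x (by omega)]
  obtain ⟨g', hg', hr⟩ := hrel_mk (S := S) g
    (fun q => (((1 - (q.1 : ℝ) : ℝ)) : ℂ) * (g q.2).1 + ((q.1 : ℝ) : ℂ) * p.1) (by fun_prop)
    (by
      rintro ⟨t, x⟩ a ha he
      have hI := congr_arg Complex.im he
      simp only [Complex.add_im, Complex.im_ofReal_mul,
        Complex.ofReal_im] at hI
      have t0 := t.2.1
      have t1 := t.2.2
      have a1 : 0 ≤ (1 - (t : ℝ)) * (g x).1.im := mul_nonneg (by linarith) (him x)
      have a2 : 0 ≤ (t : ℝ) * p.1.im := by positivity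
      have a3 : (t : ℝ) * p.1.im = 0 := by linarith
      have a4 : (t : ℝ) = 0 := by
        rcases mul_eq_zero.1 a3 with h | h
        · exact h
        · exact absurd h hp.ne'
      apply (g x).2 a ha
      rw [← he]
      simp [a4])
    (fun x => by simp)
    (fun t x hx => by
      have : g x = p := by rw [h1 x (by simp [hLS x hx]), hf x hx]
      simp only [this]
      push_cast
      ring)
  have : g' = ContinuousMap.const _ p := by
    ext1 x
    apply Subtype.ext
    rw [hg']
    simp
  rw [← this]
  exact hr


theorem exists_slope (G : Finset ℂ) : ∃ t : ℝ, Set.InjOn (fun z : ℂ => z.re + t * z.im) G := by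
  classical
  obtain ⟨t, ht⟩ := Infinite.exists_notMem_finset
    ((G ×ˢ G).image fun q : ℂ × ℂ => -(q.1.re - q.2.re) / (q.1.im - q.2.im))
  refine ⟨t, fun z hz w hw h => ?_⟩
  simp only at h
  by_cases him : z.im = w.im
  · refine Complex.ext ?_ him
    rw [him] at h
    linarith
  · exfalso
    apply ht
    refine Finset.mem_image.2 ⟨(z, w), Finset.mem_product.2 ⟨hz, hw⟩, ?_⟩
    have : z.im - w.im ≠ 0 := sub_ne_zero.2 him
    field_simp
    linarith

theorem planar (F : Finset ℂ) {k : ℕ} (S : Set (Fin k → I)) (hS : IsPreconnected S) (hS0 : 0 ∈ S)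
    (p : {z : ℂ // z ∉ F}) (f : C(Fin k → I, {z : ℂ // z ∉ F})) (hf : ∀ x ∈ S, f x = p) :
    f.HomotopicRel (ContinuousMap.const _ p) S := by
  classical
  obtain ⟨t, ht⟩ := exists_slope (insert p.1 F)
  set v : ℂ → ℝ := fun z => z.re + t * z.im with hv
  let r : ℂ → ℝ := fun z => if z = p.1 then z.im - 1 else z.im
  let P := Lagrange.interpolate (insert p.1 F) v r
  have hP : ∀ z ∈ insert p.1 F, P.eval (v z) = r z := fun z hz =>
    Lagrange.eval_interpolate_at_node r ht hz
  have hPF : ∀ z ∈ F, P.eval (v z) = z.im := fun z hz => by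
    rw [hP z (Finset.mem_insert_of_mem hz)]
    exact if_neg (fun h : z = p.1 => p.2 (h ▸ hz))
  have hPp : P.eval (v p.1) = p.1.im - 1 := by
    rw [hP _ (Finset.mem_insert_self _ _)]
    exact if_pos rfl
  let F' : Finset ℝ := F.image v
  have hgc : Continuous fun x : ℝ => P.eval x := P.continuous
  let Φ : C({z : ℂ // z ∉ F}, XX F') := ⟨fun z => ⟨⟨v z.1, z.1.im - P.eval (v z.1)⟩, by
    intro a ha h
    obtain ⟨w, hw, rfl⟩ := Finset.mem_image.1 ha
    have h1 := congrArg Complex.re h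
    have h2 := congrArg Complex.im h
    simp only [Complex.ofReal_re, Complex.ofReal_im] at h1 h2
    rw [h1, hPF w hw] at h2
    have h3 : z.1.im = w.im := by linarith
    apply z.2
    have : z.1 = w := by
      refine Complex.ext ?_ h3
      simp only [hv, h3] at h1
      linarith
    rw [this]; exact hw⟩, by
      refine Continuous.subtype_mk ?_ _
      have h1 : Continuous fun z : {z : ℂ // z ∉ F} => v z.1 := by
        simp only [hv]; fun_prop
      have : Continuous fun z : {z : ℂ // z ∉ F} => Complex.equivRealProdCLM.symm
          (v z.1, z.1.im - P.eval (v z.1)) := by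
        refine Complex.equivRealProdCLM.symm.continuous.comp (h1.prodMk (Continuous.sub ?_ (hgc.comp h1)))
        fun_prop
      exact this⟩
  let ψ : ℂ → ℂ := fun w => ⟨w.re - t * (w.im + P.eval w.re), w.im + P.eval w.re⟩
  have hψv : ∀ w, v (ψ w) = w.re := fun w => by simp only [hv, ψ]; ring
  let Ψ : C(XX F', {z : ℂ // z ∉ F}) := ⟨fun w => ⟨ψ w.1, by
    intro h
    have h1 := hPF _ h
    rw [hψv] at h1
    have h2 : w.1.im = 0 := by simp only [ψ] at h1; linarith
    refine w.2 w.1.re (Finset.mem_image.2 ⟨_, h, hψv _⟩) ?_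
    exact Complex.ext (by simp) (by simp [h2])⟩, by
      refine Continuous.subtype_mk ?_ _
      have h1 : Continuous fun w : XX F' => w.1.im + P.eval w.1.re := by
        refine Continuous.add (by fun_prop) (hgc.comp (by fun_prop))
      have : Continuous fun w : XX F' => Complex.equivRealProdCLM.symm
          (w.1.re - t * (w.1.im + P.eval w.1.re), w.1.im + P.eval w.1.re) := by
        refine Complex.equivRealProdCLM.symm.continuous.comp (Continuous.prodMk ?_ h1)
        exact Continuous.sub (by fun_prop) (continuous_const.mul h1)
      exact this⟩
  have hinv : ∀ z, Ψ (Φ z) = z := fun z => by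
    apply Subtype.ext
    change ψ ⟨v z.1, z.1.im - P.eval (v z.1)⟩ = z.1
    apply Complex.ext <;> simp [ψ, hv]
  have hp : 0 < (Φ p).1.im := by
    change 0 < p.1.im - P.eval (v p.1)
    rw [hPp]; linarith
  have := planar_real S hS hS0 (Φ p) hp (Φ.comp f) (fun x hx => by
    simp [hf x hx])
  have h2 := ContinuousMap.HomotopicRel.comp_continuousMap this Ψ
  have e1 : Ψ.comp (Φ.comp f) = f := by ext1 x; exact hinv _
  have e2 : Ψ.comp (ContinuousMap.const _ (Φ p)) = (ContinuousMap.const (Fin k → I) p) := by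
    ext1 x; exact hinv _
  rw [e1, e2] at h2
  exact h2

/-- Configurations of `n` distinct points off `F`. -/
def Cf (n : ℕ) (F : Finset ℂ) (b : Fin n → ℂ) : Prop :=
  (∀ i j, i ≠ j → b i ≠ b j) ∧ ∀ i, b i ∉ F

/-- A configuration together with one more point. -/
def PP (n : ℕ) (F : Finset ℂ) (q : ℂ × (Fin n → ℂ)) : Prop :=
  Cf n F q.2 ∧ q.1 ∉ F ∧ ∀ i, q.1 ≠ q.2 i

def Sep (n : ℕ) (F : Finset ℂ) (d : ℝ) (b : Fin n → ℂ) : Prop :=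
  (∀ i j, i ≠ j → d ≤ ‖b i - b j‖) ∧ ∀ i, ∀ a ∈ F, d ≤ ‖a - b i‖

noncomputable def psi {n : ℕ} (d : ℝ) (b v : Fin n → ℂ) (z : ℂ) : ℂ :=
  z + ∑ i, ((max 0 (1 - ‖z - b i‖ / d) : ℝ) : ℂ) * v i

theorem psi_far {n : ℕ} {d : ℝ} (hd : 0 < d) (b v : Fin n → ℂ) (z : ℂ)
    (h : ∀ i, d ≤ ‖z - b i‖) : psi d b v z = z := by
  rw [psi, Finset.sum_eq_zero, add_zero]
  intro i _
  have : 1 ≤ ‖z - b i‖ / d := (one_le_div hd).2 (h i)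
  rw [max_eq_left (by linarith)]
  simp

theorem psi_self {n : ℕ} {F : Finset ℂ} {d : ℝ} (hd : 0 < d) (b v : Fin n → ℂ) (hb : Sep n F d b)
    (j : Fin n) : psi d b v (b j) = b j + v j := by
  rw [psi, Finset.sum_eq_single j]
  · simp
  · intro i _ hij
    have : 1 ≤ ‖b j - b i‖ / d := (one_le_div hd).2 (hb.1 j i hij.symm)
    rw [max_eq_left (by linarith)]
    simp
  · simp

theorem psi_zero {n : ℕ} (d : ℝ) (b : Fin n → ℂ) (z : ℂ) : psi d b 0 z = z := by
  simp [psi]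

theorem psi_inj {n : ℕ} {d e : ℝ} (hd : 0 < d) (b v : Fin n → ℂ) (hv : ∀ i, ‖v i‖ ≤ e)
    (he : n * e < d) : Function.Injective (psi d b v) := by
  intro z w h
  by_contra hzw
  have hpos : 0 < ‖z - w‖ := norm_pos_iff.2 (sub_ne_zero.2 hzw)
  have h1 : z - w = ∑ i, (((max 0 (1 - ‖w - b i‖ / d) - max 0 (1 - ‖z - b i‖ / d) : ℝ)) : ℂ) * v i := by
    simp only [psi] at h
    push_cast
    simp only [sub_mul, Finset.sum_sub_distrib]
    linear_combination h
  have h2 : ‖z - w‖ ≤ ∑ i : Fin n, ‖z - w‖ / d * e := by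
    conv_lhs => rw [h1]
    refine (norm_sum_le _ _).trans (Finset.sum_le_sum fun i _ => ?_)
    rw [norm_mul, Complex.norm_real]
    refine mul_le_mul ?_ (hv i) (norm_nonneg _) (by positivity)
    rw [Real.norm_eq_abs]
    refine (abs_max_sub_max_le_max 0 _ 0 _).trans ?_
    rw [sub_self, abs_zero, max_eq_right (abs_nonneg _)]
    have : 1 - ‖w - b i‖ / d - (1 - ‖z - b i‖ / d) = (‖z - b i‖ - ‖w - b i‖) / d := by ring
    rw [this, abs_div, abs_of_pos hd]
    gcongr
    refine (abs_norm_sub_norm_le _ _).trans ?_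
    simp
  rw [Finset.sum_const, Finset.card_univ, Fintype.card_fin, nsmul_eq_mul] at h2
  have h3 : (n : ℝ) * (‖z - w‖ / d * e) = ‖z - w‖ * (n * e) / d := by ring
  rw [h3, le_div_iff₀ hd] at h2
  nlinarith

theorem fn_step {n : ℕ} {F : Finset ℂ} {K : Type*} [TopologicalSpace K] {S : Set K}
    {d e : ℝ} (hd : 0 < d) (he : n * e < d)
    (g : C(K, {q : ℂ × (Fin n → ℂ) // PP n F q})) (b' : C(K, Fin n → ℂ))
    (hsep : ∀ x, Sep n F d (g x).1.2) (hcl : ∀ x i, ‖b' x i - (g x).1.2 i‖ ≤ e)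
    (hS : ∀ x ∈ S, b' x = (g x).1.2) :
    ∃ g' : C(K, {q : ℂ × (Fin n → ℂ) // PP n F q}), (∀ x, (g' x).1.2 = b' x) ∧
      g.HomotopicRel g' S := by
  let h : I × K → ℂ × (Fin n → ℂ) := fun q =>
    (psi d (g q.2).1.2 (fun i => ((q.1 : ℝ) : ℂ) * (b' q.2 i - (g q.2).1.2 i)) (g q.2).1.1,
      fun i => (g q.2).1.2 i + ((q.1 : ℝ) : ℂ) * (b' q.2 i - (g q.2).1.2 i))
  obtain ⟨g', h1, h2⟩ := hrel_mk (S := S) g h (by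
      simp only [h, psi]
      fun_prop) (by
      rintro ⟨t, x⟩
      have hinj := psi_inj (e := e) hd (g x).1.2
        (fun i => ((t : ℝ) : ℂ) * (b' x i - (g x).1.2 i)) (fun i => by
          rw [norm_mul, Complex.norm_real, Real.norm_eq_abs, abs_of_nonneg t.2.1]
          exact (mul_le_of_le_one_left (norm_nonneg _) t.2.2).trans (hcl x i)) he
      have hs := psi_self hd (g x).1.2
        (fun i => ((t : ℝ) : ℂ) * (b' x i - (g x).1.2 i)) (hsep x)
      have hfar : ∀ a ∈ F, psi d (g x).1.2 (fun i => ((t : ℝ) : ℂ) * (b' x i - (g x).1.2 i)) a = a :=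
        fun a ha => psi_far hd _ _ _ (fun i => (hsep x).2 i a ha)
      have hP := (g x).2
      refine ⟨⟨fun i j hij heq => ?_, fun i hi => ?_⟩, fun hz => ?_, fun i hi => ?_⟩
      · simp only [h] at heq
        rw [← hs i, ← hs j] at heq
        exact hP.1.1 i j hij (hinj heq)
      · have := hfar _ hi
        simp only [h] at this hi
        rw [← hs i] at this
        have h3 := hinj this
        rw [← hs i, h3] at hi
        exact hP.1.2 i hi
      · have := hfar _ hz
        have h3 := hinj this
        simp only [h] at hz h3
        rw [h3] at hz
        exact hP.2.1 hz
      · simp only [h] at hi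
        rw [← hs i] at hi
        exact hP.2.2 i (hinj hi)) (by
      intro x
      refine Prod.ext ?_ ?_
      · simp only [h, psi]; simp
      · ext i; simp [h]) (by
      intro t x hx
      refine Prod.ext ?_ ?_
      · simp only [h, psi, hS x hx]; simp
      · ext i; simp [h, hS x hx])
  refine ⟨g', fun x => ?_, h2⟩
  rw [h1]
  ext i
  simp [h]

theorem exists_sep {n : ℕ} {F : Finset ℂ} {X : Type*} [TopologicalSpace X] [CompactSpace X]
    (H : C(X, {b : Fin n → ℂ // Cf n F b})) : ∃ d > 0, ∀ x, Sep n F d (H x).1 := by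
  have key : ∀ f : X → ℝ, Continuous f → (∀ x, 0 < f x) → ∀ᶠ d in 𝓝[>] (0:ℝ), ∀ x, d ≤ f x := by
    intro f hf h0
    obtain ⟨a, ha, hle⟩ := isCompact_univ.exists_forall_le' hf.continuousOn (a := 0) (fun x _ => h0 x)
    filter_upwards [Ioo_mem_nhdsGT ha] with d hd x
    exact hd.2.le.trans (hle x trivial)
  have hev : ∀ i, Continuous fun x => (H x).1 i := fun i =>
    (continuous_apply i).comp (continuous_subtype_val.comp H.continuous)
  have h1 : ∀ᶠ d in 𝓝[>] (0:ℝ), ∀ q : {q : Fin n × Fin n // q.1 ≠ q.2}, ∀ x,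
      d ≤ ‖(H x).1 q.1.1 - (H x).1 q.1.2‖ := by
    refine Filter.eventually_all.2 fun q => key _ (by have := hev; fun_prop) fun x => ?_
    exact norm_pos_iff.2 (sub_ne_zero.2 ((H x).2.1 _ _ q.2))
  have h2 : ∀ᶠ d in 𝓝[>] (0:ℝ), ∀ q : Fin n × F, ∀ x, d ≤ ‖q.2.1 - (H x).1 q.1‖ := by
    refine Filter.eventually_all.2 fun q => key _ (by have := hev; fun_prop) fun x => ?_
    refine norm_pos_iff.2 (sub_ne_zero.2 fun h => (H x).2.2 q.1 ?_)
    rw [← h]; exact q.2.2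
  obtain ⟨d, hd1, hd2, hd0⟩ := (h1.and (h2.and self_mem_nhdsWithin)).exists
  exact ⟨d, hd0, fun x => ⟨fun i j hij => hd1 ⟨(i, j), hij⟩ x, fun i a ha => hd2 (i, ⟨a, ha⟩) x⟩⟩

theorem fn_chain {n : ℕ} {F : Finset ℂ} {k : ℕ} {S : Set (Fin k → I)}
    (g : C(Fin k → I, {q : ℂ × (Fin n → ℂ) // PP n F q}))
    (H : C(I × (Fin k → I), {b : Fin n → ℂ // Cf n F b}))
    (h0 : ∀ x, (H (0, x)).1 = (g x).1.2) (hS : ∀ t, ∀ x ∈ S, (H (t, x)).1 = (g x).1.2) :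
    ∃ g' : C(Fin k → I, {q : ℂ × (Fin n → ℂ) // PP n F q}), (∀ x, (g' x).1.2 = (H (1, x)).1) ∧
      g.HomotopicRel g' S := by
  obtain ⟨d, hd, hsep⟩ := exists_sep H
  set e : ℝ := d / (n + 1) with he
  have hn1 : (0:ℝ) < n + 1 := by positivity
  have he0 : 0 < e := by positivity
  have hed : n * e < d := by
    rw [he, mul_div_assoc', div_lt_iff₀ hn1]
    nlinarith
  have huc : UniformContinuous fun q => (H q).1 :=
    CompactSpace.uniformContinuous_of_continuous (by fun_prop)
  obtain ⟨c, hc, hcl⟩ := Metric.uniformContinuous_iff.1 huc e he0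
  obtain ⟨M, hM⟩ := exists_nat_one_div_lt hc
  have hM0 : (0:ℝ) < M + 1 := by positivity
  let τ : ℕ → I := fun m => projIcc 0 1 zero_le_one ((m : ℝ) / (M + 1))
  have hτ : ∀ m, dist (τ (m + 1)) (τ m) < c := by
    intro m
    refine lt_of_le_of_lt ?_ hM
    have := (LipschitzWith.projIcc (zero_le_one (α := ℝ))).dist_le_mul (((m + 1 : ℕ) : ℝ) / (M + 1)) ((m : ℝ) / (M + 1))
    refine this.trans (le_of_eq ?_)
    rw [Real.dist_eq, ← sub_div]
    push_cast
    rw [add_sub_cancel_left, abs_of_pos (by positivity)]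
    simp
  have hmain : ∀ m : ℕ, ∃ g' : C(Fin k → I, {q : ℂ × (Fin n → ℂ) // PP n F q}),
      (∀ x, (g' x).1.2 = (H (τ m, x)).1) ∧ g.HomotopicRel g' S := by
    intro m
    induction m with
    | zero =>
      refine ⟨g, fun x => ?_, ContinuousMap.HomotopicRel.refl _⟩
      have : τ 0 = 0 := by
        simp only [τ, Nat.cast_zero, zero_div]
        exact projIcc_left (zero_le_one (α := ℝ))
      rw [this, h0]
    | succ m ih =>
      obtain ⟨g1, hg1, hr⟩ := ih
      obtain ⟨g2, hg2, hr2⟩ := fn_step (S := S) hd hed g1 ⟨fun x => (H (τ (m + 1), x)).1, by fun_prop⟩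
        (fun x => by rw [hg1]; exact hsep _)
        (fun x i => by
          rw [hg1]
          have : dist (τ (m + 1), x) (τ m, x) < c := by
            rw [Prod.dist_eq]; simp [hτ m]
          have h3 := (hcl this).le
          rw [dist_eq_norm] at h3
          exact (norm_le_pi_norm ((H (τ (m + 1), x)).1 - (H (τ m, x)).1) i).trans h3)
        (fun x hx => by
          rw [hg1, hS _ x hx]
          exact hS _ x hx)
      exact ⟨g2, hg2, hr.trans hr2⟩
  obtain ⟨g', h1, h2⟩ := hmain (M + 1)
  refine ⟨g', fun x => ?_, h2⟩
  rw [h1]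
  have : τ (M + 1) = 1 := by
    have h5 : (((M + 1 : ℕ) : ℝ) / (M + 1)) = 1 := by push_cast; exact div_self hM0.ne'
    simp only [τ]
    rw [h5]
    exact projIcc_right (zero_le_one (α := ℝ))
  rw [this]

theorem conf_contr (F : Finset ℂ) {k : ℕ} (S : Set (Fin k → I)) (hS : IsPreconnected S)
    (hS0 : 0 ∈ S) (n : ℕ) : ∀ (p : {b : Fin n → ℂ // Cf n F b})
    (f : C(Fin k → I, {b : Fin n → ℂ // Cf n F b})), (∀ x ∈ S, f x = p) →
    f.HomotopicRel (ContinuousMap.const _ p) S := by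
  classical
  induction n with
  | zero =>
    intro p f _
    have : f = ContinuousMap.const _ p := by
      ext1 x
      exact Subtype.ext (Subsingleton.elim _ _)
    rw [this]
    exact ContinuousMap.HomotopicRel.refl _
  | succ n ih =>
    intro p f hf
    let sp : C({b : Fin (n + 1) → ℂ // Cf (n + 1) F b}, {q : ℂ × (Fin n → ℂ) // PP n F q}) :=
      ⟨fun b => ⟨(b.1 0, fun i => b.1 i.succ),
        ⟨⟨fun i j hij => b.2.1 _ _ (fun h => hij (Fin.succ_injective _ h)), fun i => b.2.2 _⟩,
          b.2.2 _, fun i => b.2.1 _ _ (Fin.succ_ne_zero i).symm⟩⟩, by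
        refine Continuous.subtype_mk (Continuous.prodMk ?_ (continuous_pi fun i => ?_)) _
        · exact (continuous_apply _).comp continuous_subtype_val
        · exact (continuous_apply _).comp continuous_subtype_val⟩
    let jn : C({q : ℂ × (Fin n → ℂ) // PP n F q}, {b : Fin (n + 1) → ℂ // Cf (n + 1) F b}) :=
      ⟨fun q => ⟨Fin.cons q.1.1 q.1.2, by
        refine ⟨fun i j => ?_, fun i => ?_⟩
        · refine Fin.cases ?_ (fun i => ?_) i <;> refine Fin.cases ?_ (fun j => ?_) j
          · simp
          · intro _; simpa using q.2.2.2 j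
          · intro _; simpa using (q.2.2.2 i).symm
          · intro h; simpa using q.2.1.1 i j (fun h' => h (by rw [h']))
        · refine Fin.cases ?_ (fun i => ?_) i
          · simpa using q.2.2.1
          · simpa using q.2.1.2 i⟩, by
        refine Continuous.subtype_mk (continuous_pi fun i => ?_) _
        refine Fin.cases ?_ (fun i => ?_) i
        · simp only [Fin.cons_zero]; fun_prop
        · simp only [Fin.cons_succ]; fun_prop⟩
    have hjs : ∀ b, jn (sp b) = b := fun b => by
      apply Subtype.ext
      funext i
      refine Fin.cases ?_ (fun i => ?_) i
      · rfl
      · rfl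
    let pb : {b : Fin n → ℂ // Cf n F b} := ⟨(sp p).1.2, (sp p).2.1⟩
    let fb : C(Fin k → I, {b : Fin n → ℂ // Cf n F b}) :=
      ⟨fun x => ⟨(sp (f x)).1.2, (sp (f x)).2.1⟩, by fun_prop⟩
    obtain ⟨H⟩ := ih pb fb (fun x hx => by
      simp only [fb, pb, ContinuousMap.coe_mk, hf x hx])
    obtain ⟨g', hg1, hg2⟩ := fn_chain (S := S) (sp.comp f) H.toContinuousMap (fun x => by
        exact congrArg Subtype.val (H.apply_zero x))
      (fun t x hx => by
        exact congrArg Subtype.val (H.eq_fst t hx))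
    have hg1' : ∀ x, (g' x).1.2 = pb.1 := fun x => by
      rw [hg1]
      exact congrArg Subtype.val (H.apply_one x)
    let F' : Finset ℂ := F ∪ Finset.univ.image pb.1
    have hF' : ∀ z, z ∉ F' ↔ z ∉ F ∧ ∀ i, z ≠ pb.1 i := fun z => by
      simp only [F', Finset.mem_union, Finset.mem_image, Finset.mem_univ, true_and, not_or,
        not_exists, eq_comm, ne_eq]
    let pz : {z : ℂ // z ∉ F'} := ⟨(sp p).1.1, (hF' _).2 (sp p).2.2⟩
    let fz : C(Fin k → I, {z : ℂ // z ∉ F'}) := ⟨fun x => ⟨(g' x).1.1, (hF' _).2 (by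
      have := (g' x).2.2
      rw [hg1' x] at this
      exact this)⟩, by fun_prop⟩
    have hpl := planar F' S hS hS0 pz fz (fun x hx => by
      apply Subtype.ext
      have h1 := hg2.fst_eq_snd hx
      have h2 : (g' x).1.1 = (sp (f x)).1.1 := by rw [← h1]; rfl
      simp only [fz, pz, ContinuousMap.coe_mk, h2, hf x hx])
    let inc : C({z : ℂ // z ∉ F'}, {q : ℂ × (Fin n → ℂ) // PP n F q}) :=
      ⟨fun z => ⟨(z.1, pb.1), ⟨pb.2, (hF' _).1 z.2⟩⟩, by fun_prop⟩
    have h3 := ContinuousMap.HomotopicRel.comp_continuousMap hpl inc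
    have e1 : inc.comp fz = g' := by
      ext1 x
      exact Subtype.ext (Prod.ext rfl (hg1' x).symm)
    rw [e1] at h3
    have h4 := ContinuousMap.HomotopicRel.comp_continuousMap (hg2.trans h3) jn
    have e2 : jn.comp (sp.comp f) = f := by ext1 x; exact hjs _
    have e3 : jn.comp (inc.comp (ContinuousMap.const _ pz)) = ContinuousMap.const (Fin k → I) p := by
      ext1 x; exact hjs _
    rw [e2, e3] at h4
    exact h4

theorem bdry_zero {k : ℕ} (hk : 2 ≤ k) : (0 : Fin k → I) ∈ Cube.boundary (Fin k) :=
  ⟨⟨0, by omega⟩, Or.inl rfl⟩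

theorem bdry_conn {k : ℕ} (hk : 2 ≤ k) : IsPreconnected (Cube.boundary (Fin k)) := by
  have hface : ∀ (i : Fin k) (c : I), IsPreconnected {y : Fin k → I | y i = c} := by
    intro i c
    have : {y : Fin k → I | y i = c} = range (fun y : Fin k → I => Function.update y i c) := by
      ext y
      constructor
      · intro h
        exact ⟨y, by rw [← (show y i = c from h)]; simp⟩
      · rintro ⟨z, rfl⟩
        simp
    rw [this]
    exact isPreconnected_range (by fun_prop)
  -- join every point to the origin
  refine isPreconnected_of_forall 0 ?_
  rintro y ⟨i, hi⟩
  obtain ⟨c, hc, hyc⟩ : ∃ c : I, (c = 0 ∨ c = 1) ∧ y i = c := ⟨y i, hi, rfl⟩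
  obtain ⟨j, hj⟩ : ∃ j : Fin k, j ≠ i := by
    have : Nontrivial (Fin k) := Fin.nontrivial_iff_two_le.2 hk
    exact exists_ne i
  refine ⟨{y | y i = c} ∪ {y | y j = 0}, ?_, Or.inr rfl, Or.inl hyc, ?_⟩
  · rintro z (hz | hz)
    · exact ⟨i, by rw [show z i = c from hz]; exact hc⟩
    · exact ⟨j, Or.inl hz⟩
  · refine IsPreconnected.union (Function.update (0 : Fin k → I) i c) ?_ ?_ (hface i c) (hface j 0)
    · simp
    · simp [hj]

end Asph
end AsphSection

/-- For a finite set `F ⊆ ℂ` and `n ≥ 1`, the configuration space `C_n(ℂ ∖ F)`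
is aspherical: all homotopy groups in degree `k ≥ 2` are trivial. -/
theorem stmt_5 (F : Set ℂ) (hF : F.Finite) (n : ℕ) (hn : 1 ≤ n)
    (k : ℕ) (hk : 2 ≤ k) (p : ConfSpace n ↥Fᶜ) :
    Subsingleton (HomotopyGroup (Fin k) (ConfSpace n ↥Fᶜ) p) := by
  let F' := hF.toFinset
  have hm : ∀ z, z ∈ F' ↔ z ∈ F := fun z => hF.mem_toFinset
  let u : C(ConfSpace n ↥Fᶜ, {b : Fin n → ℂ // Asph.Cf n F' b}) :=
    ⟨fun q => ⟨fun i => (q.1 i).1, ⟨fun i j hij h => q.2 i j hij (Subtype.ext h),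
      fun i h => (q.1 i).2 ((hm _).1 h)⟩⟩, by
      refine Continuous.subtype_mk (continuous_pi fun i => ?_) _
      exact continuous_subtype_val.comp ((continuous_apply i).comp continuous_subtype_val)⟩
  let w : C({b : Fin n → ℂ // Asph.Cf n F' b}, ConfSpace n ↥Fᶜ) :=
    ⟨fun b => ⟨fun i => ⟨b.1 i, fun h => b.2.2 i ((hm _).2 h)⟩,
      fun i j hij h => b.2.1 i j hij (congrArg Subtype.val h)⟩, by
      refine Continuous.subtype_mk (continuous_pi fun i => Continuous.subtype_mk ?_ _) _
      exact (continuous_apply i).comp continuous_subtype_val⟩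
  have key : ∀ f : GenLoop (Fin k) (ConfSpace n ↥Fᶜ) p, GenLoop.Homotopic f GenLoop.const := by
    intro f
    have h := Asph.conf_contr F' (Cube.boundary (Fin k)) (Asph.bdry_conn hk) (Asph.bdry_zero hk) n
      (u p) (u.comp f.1) (fun x hx => congrArg u (f.2 x hx))
    exact ContinuousMap.HomotopicRel.comp_continuousMap h w
  refine ⟨fun a b => ?_⟩
  induction a using Quotient.inductionOn with | _ a =>
  induction b using Quotient.inductionOn with | _ b =>
  exact Quotient.sound ((key a).trans (key b).symm)
end

section
/- Let G be a finite subgroup of the multiplicative group ℂˣ, acting on the punctured plane ℂ ∖ {0} by multiplication (this action is free), and let n ≥ 1. Then the orbit configuration space C_n^G(ℂ ∖ {0}) is aspherical: for every k ≥ 2 and every basepoint p ∈ C_n^G(ℂ ∖ {0}), the homotopy group π_k(C_n^G(ℂ ∖ {0}), p) is trivial. -/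
/-- The orbit configuration space of `n` points of `ℂ ∖ {0}` with respect to the
(free) action of a subgroup `G ≤ ℂˣ` by multiplication: tuples of points whose
coordinates lie in pairwise distinct `G`-orbits. -/
abbrev OrbConfPunctPlane (n : ℕ) (G : Subgroup ℂˣ) : Type :=
  {f : Fin n → {z : ℂ // z ≠ 0} //
    ∀ i j : Fin n, i ≠ j → ∀ g : G, (f i : ℂ) ≠ ((g : ℂˣ) : ℂ) * (f j : ℂ)}

section OCHelpers
open Topology unitInterval Set

def RW (J : Type) : Type := {l : List J // l.IsChain (· ≠ ·)}

namespace RW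
variable {J : Type}
instance : TopologicalSpace (RW J) := ⊥
instance : DiscreteTopology (RW J) := ⟨rfl⟩

open Classical in
noncomputable def act (j : J) (l : RW J) : RW J :=
  ⟨match l.1 with
    | [] => [j]
    | a :: t => if a = j then t else j :: a :: t, by
    obtain ⟨l, hl⟩ := l
    cases l with
    | nil => simp
    | cons a t =>
      dsimp only
      split_ifs with h
      · exact hl.tail
      · exact List.isChain_cons_cons.2 ⟨fun h' => h h'.symm, hl⟩⟩

def nil : RW J := ⟨[], by simp⟩
def len (l : RW J) : ℕ := l.1.length

theorem act_act (j : J) (l : RW J) : act j (act j l) = l := by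
  obtain ⟨l, hl⟩ := l
  apply Subtype.ext
  cases l with
  | nil => simp [act]
  | cons a t =>
    by_cases h : a = j
    · subst h
      cases t with
      | nil => simp [act]
      | cons b s =>
        have : b ≠ a := fun h => (List.isChain_cons_cons.1 hl).1 h.symm
        simp [act, this]
    · simp [act, h]

theorem exists_parent (l : RW J) (n : ℕ) (h : l.len = n + 1) :
    ∃ j, (act j l).len = n := by
  obtain ⟨l, hl⟩ := l
  cases l with
  | nil => simp [len] at h
  | cons a t => exact ⟨a, by simpa [act, len] using h⟩

theorem parent_unique (l : RW J) (n : ℕ) (h : l.len = n + 1) (j j' : J)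
    (hj : (act j l).len ≤ n) (hj' : (act j' l).len ≤ n) : j = j' := by
  obtain ⟨l, hl⟩ := l
  cases l with
  | nil => simp [len] at h
  | cons a t =>
    simp only [act, len] at *
    split_ifs at hj with h1
    · split_ifs at hj' with h2
      · rw [← h1, h2]
      · simp at hj' h; omega
    · simp at hj h; omega

theorem len_act (j : J) (l : RW J) : (act j l).len = l.len + 1 ∨ (act j l).len + 1 = l.len := by
  obtain ⟨l, hl⟩ := l
  cases l with
  | nil => simp [len, act]
  | cons a t =>
    simp only [act, len]
    split_ifs <;> simp
end RW

structure PushData (X J : Type) [TopologicalSpace X] where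
  U : Bool → Set X
  isOpen_U : ∀ ε, IsOpen (U ε)
  cover : ∀ x, ∃ ε, x ∈ U ε
  N : X → J
  N_loc : ∀ x, (∀ ε, x ∈ U ε) → ∀ᶠ x' in 𝓝 x, N x' = N x
  h : Bool → J → I → X → X
  h_cont : ∀ ε j, ContinuousOn (fun q : I × X => h ε j q.1 q.2) {q | q.2 ∈ U ε}
  h_mem : ∀ ε j t z, z ∈ U ε → h ε j t z ∈ U ε
  h_zero : ∀ ε j z, z ∈ U ε → h ε j 0 z = z
  h_one : ∀ ε j z, z ∈ U ε → h ε j 1 z ∈ U (!ε) ∧ N (h ε j 1 z) = j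
  h_strip : ∀ ε t z, z ∈ U ε → z ∈ U (!ε) →
    h ε (N z) t z ∈ U (!ε) ∧ N (h ε (N z) t z) = N z
  h_ext : ∀ ε (A : Set J), ∃ K : I × X → X, ContinuousOn K {q | q.2 ∈ U (!ε)} ∧
    ∀ q, q.2 ∈ U (!ε) → ((q.2 ∈ U ε → N q.2 ∈ A → K q = h ε (N q.2) q.1 q.2) ∧
      (¬ (q.2 ∈ U ε ∧ N q.2 ∈ A) → K q = q.2))
  
namespace PushData
variable {X J : Type} [TopologicalSpace X] (P : PushData X J)

open Classical in
noncomputable def core : FiberBundleCore Bool X (RW J) where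
  baseSet := P.U
  isOpen_baseSet := P.isOpen_U
  indexAt x := (P.cover x).choose
  mem_baseSet_at x := (P.cover x).choose_spec
  coordChange i j x w := if i = j then w else RW.act (P.N x) w
  coordChange_self := by simp
  continuousOn_coordChange := by
    intro i j
    by_cases h : i = j
    · simp only [h, if_true]; fun_prop
    · simp only [h, if_false]
      rintro ⟨x, w⟩ ⟨⟨hx1, hx2⟩, -⟩
      apply ContinuousAt.continuousWithinAt
      have : ∀ᶠ q : X × RW J in 𝓝 (x, w), RW.act (P.N q.1) q.2 = RW.act (P.N x) w := by
        have h1 : ∀ᶠ x' in 𝓝 x, P.N x' = P.N x := P.N_loc x (by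
          intro ε; dsimp only at hx1 hx2; cases ε <;> cases i <;> cases j <;> simp_all)
        have h2 : ∀ᶠ w' in 𝓝 w, w' = w := by simp [nhds_discrete]
        filter_upwards [h1.prod_nhds h2] with q hq
        rw [hq.1, hq.2]
      exact continuousAt_const.congr (by filter_upwards [this] with q hq; exact hq.symm)
  coordChange_comp := by
    intro i j k x hx v
    cases i <;> cases j <;> cases k <;> simp [RW.act_act]

abbrev E := P.core.TotalSpace

theorem isCov : IsCoveringMap (P.core.proj : P.E → X) := 
  FiberBundle.isCoveringMap (F := RW J) (E := P.core.Fiber)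

noncomputable def O (v : Bool × RW J) : Set P.E :=
  {e | P.core.proj e ∈ P.U v.1 ∧ (P.core.localTriv v.1 e).2 = v.2}
noncomputable def sec (v : Bool × RW J) (z : X) : P.E :=
  (P.core.localTriv v.1).toOpenPartialHomeomorph.symm (z, v.2)

theorem cont_proj : Continuous (P.core.proj : P.E → X) := P.isCov.continuous

theorem isOpen_O (v) : IsOpen (P.O v) := by
  have h := (P.core.localTriv v.1).toOpenPartialHomeomorph.continuousOn.isOpen_inter_preimage
    (P.core.localTriv v.1).open_source (isOpen_univ.prod (isOpen_discrete {v.2}))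
  convert h using 1
  ext e
  simp only [O, mem_ofPred_eq, mem_inter_iff, mem_preimage, mem_prod, mem_univ, true_and,
    mem_singleton_iff]
  rfl
theorem proj_sec (v) (z) (hz : z ∈ P.U v.1) : P.core.proj (P.sec v z) = z := by
  exact (P.core.localTriv v.1).proj_symm_apply' hz
theorem sec_mem (v) (z) (hz : z ∈ P.U v.1) : P.sec v z ∈ P.O v := by
  refine ⟨by rwa [P.proj_sec v z hz], ?_⟩
  have := (P.core.localTriv v.1).apply_symm_apply' (b := z) (x := v.2) hz
  exact congrArg Prod.snd this
theorem sec_proj (v) (e) (he : e ∈ P.O v) : P.sec v (P.core.proj e) = e := by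
  have h := (P.core.localTriv v.1).symm_apply_mk_proj (x := e) he.1
  rw [he.2] at h
  exact h
theorem sec_cont (v) : ContinuousOn (P.sec v) (P.U v.1) := by
  refine (P.core.localTriv v.1).toOpenPartialHomeomorph.continuousOn_symm.comp (by fun_prop) ?_
  intro z hz
  exact ⟨hz, mem_univ _⟩
theorem mem_O_iff (v : Bool × RW J) (e : P.E) (he : e ∈ P.O v) (h2 : P.core.proj e ∈ P.U (!v.1)) :
    e ∈ P.O (!v.1, RW.act (P.N (P.core.proj e)) v.2) := by
  refine ⟨h2, ?_⟩
  obtain ⟨h1, h3⟩ := he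
  rw [← h3]
  classical
  have key : ∀ ε : Bool, (P.core.localTriv ε e).2 =
      if (P.cover e.proj).choose = ε then e.2 else RW.act (P.N e.proj) e.2 := by
    intro ε
    change (if _ then _ else _) = _
    congr!
  rw [key, key]
  change _ = RW.act (P.N e.proj) _
  generalize (P.cover e.proj).choose = i
  obtain ⟨ε, l⟩ := v
  cases i <;> cases ε <;> simp <;> exact (RW.act_act _ _).symm
theorem O_inj (ε) (l l') (e) (h : e ∈ P.O (ε, l)) (h' : e ∈ P.O (ε, l')) : l = l' := h.2.symm.trans h'.2
theorem exists_O (e) (ε) (h : P.core.proj e ∈ P.U ε) : ∃ l, e ∈ P.O (ε, l) := ⟨(P.core.localTriv ε e).2, h, rfl⟩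

theorem sec_eq (v : Bool × RW J) (z : X) (h1 : z ∈ P.U v.1) (h2 : z ∈ P.U (!v.1)) :
    P.sec (!v.1, RW.act (P.N z) v.2) z = P.sec v z := by
  have h := P.mem_O_iff v _ (P.sec_mem v z h1) (by rwa [P.proj_sec v z h1])
  have h' := P.sec_proj _ _ h
  rwa [P.proj_sec v z h1] at h'

def EN (n : ℕ) : Set P.E := {e | ∃ v : Bool × RW J, v.2.len ≤ n ∧ e ∈ P.O v}

theorem O_unique (n : ℕ) (v v' : Bool × RW J) (hv : v.2.len = n) (hv' : v'.2.len = n)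
    (e : P.E) (h : e ∈ P.O v) (h' : e ∈ P.O v') : v = v' := by
  obtain ⟨ε, l⟩ := v
  obtain ⟨ε', l'⟩ := v'
  by_cases hε : ε = ε'
  · subst hε
    rw [P.O_inj _ _ _ _ h h']
  · exfalso
    have hε' : ε' = !ε := by cases ε <;> cases ε' <;> simp_all
    subst hε'
    have := P.mem_O_iff _ e h h'.1
    have h2 := P.O_inj _ _ _ _ this h'
    dsimp only at h2 hv hv'
    rcases RW.len_act (P.N (P.core.proj e)) l with h3 | h3 <;> rw [h2] at h3 <;> omega

open Classical in
noncomputable def par (n : ℕ) (v : Bool × RW J) (hv : v.2.len = n + 1) : J :=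
  (RW.exists_parent v.2 n hv).choose
theorem par_spec (n : ℕ) (v : Bool × RW J) (hv : v.2.len = n + 1) :
  (RW.act (par n v hv) v.2).len = n := (RW.exists_parent v.2 n hv).choose_spec

open Classical in
noncomputable def D (n : ℕ) (t : I) (e : P.E) : P.E :=
  if H : ∃ v : Bool × RW J, v.2.len = n + 1 ∧ e ∈ P.O v then
    P.sec H.choose (P.h H.choose.1 (par n H.choose H.choose_spec.1) t (P.core.proj e))
  else e

theorem D_eq (n : ℕ) (t : I) (e : P.E) (v) (hv : v.2.len = n + 1) (he : e ∈ P.O v) :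
    P.D n t e = P.sec v (P.h v.1 (par n v hv) t (P.core.proj e)) := by
  have H : ∃ v : Bool × RW J, v.2.len = n + 1 ∧ e ∈ P.O v := ⟨v, hv, he⟩
  have : H.choose = v := P.O_unique (n+1) _ _ H.choose_spec.1 hv e H.choose_spec.2 he
  rw [D, dif_pos H]
  have aux : ∀ v' (hv' : v'.2.len = n + 1), v' = v →
      P.sec v' (P.h v'.1 (par n v' hv') t (P.core.proj e)) =
      P.sec v (P.h v.1 (par n v hv) t (P.core.proj e)) := by
    rintro v' hv' rfl; rfl
  exact aux _ _ this

theorem D_neg (n : ℕ) (t : I) (e : P.E)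
    (H : ¬ ∃ v : Bool × RW J, v.2.len = n + 1 ∧ e ∈ P.O v) : P.D n t e = e := by
  rw [D, dif_neg H]

theorem D_zero (n : ℕ) (e : P.E) : P.D n 0 e = e := by
  by_cases H : ∃ v : Bool × RW J, v.2.len = n + 1 ∧ e ∈ P.O v
  · obtain ⟨v, hv, he⟩ := H
    rw [P.D_eq n 0 e v hv he, P.h_zero _ _ _ he.1, P.sec_proj v e he]
  · exact P.D_neg _ _ _ H

theorem D_one (n : ℕ) (e : P.E) (he : e ∈ P.EN (n + 1)) : P.D n 1 e ∈ P.EN n := by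
  by_cases H : ∃ v : Bool × RW J, v.2.len = n + 1 ∧ e ∈ P.O v
  · obtain ⟨v, hv, he⟩ := H
    rw [P.D_eq n 1 e v hv he]
    have h1 := P.h_one v.1 (par n v hv) _ he.1
    have h0 := P.h_mem v.1 (par n v hv) 1 _ he.1
    have h2 := P.mem_O_iff v _ (P.sec_mem v _ h0) (by rw [P.proj_sec v _ h0]; exact h1.1)
    rw [P.proj_sec v _ h0, h1.2] at h2
    exact ⟨_, (par_spec n v hv).le, h2⟩
  · rw [P.D_neg _ _ _ H]
    obtain ⟨v, hv, he⟩ := he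
    refine ⟨v, ?_, he⟩
    by_contra h
    exact H ⟨v, by omega, he⟩

theorem D_cont (n : ℕ) : ContinuousOn (fun q : I × P.E => P.D n q.1 q.2) {q | q.2 ∈ P.EN (n + 1)} := by
  rintro ⟨t₀, e₀⟩ he₀
  apply ContinuousAt.continuousWithinAt
  by_cases H : ∃ v : Bool × RW J, v.2.len = n + 1 ∧ e₀ ∈ P.O v
  · obtain ⟨v, hv, he⟩ := H
    have hopen : IsOpen {q : I × P.E | q.2 ∈ P.O v} := (P.isOpen_O v).preimage continuous_snd
    have hc : ContinuousOn (fun q : I × P.E => P.sec v (P.h v.1 (par n v hv) q.1 (P.core.proj q.2)))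
        {q : I × P.E | q.2 ∈ P.O v} := by
      refine (P.sec_cont v).comp ((P.h_cont v.1 (par n v hv)).comp
        (f := fun q : I × P.E => (q.1, P.core.proj q.2)) ?_ ?_) ?_
      · exact (continuous_fst.prodMk (P.cont_proj.comp continuous_snd)).continuousOn
      · intro q hq; exact hq.1
      · intro q hq; exact P.h_mem _ _ _ _ hq.1
    refine (hc.continuousAt (hopen.mem_nhds he)).congr ?_
    filter_upwards [hopen.mem_nhds he] with q hq
    exact (P.D_eq n q.1 q.2 v hv hq).symm
  · obtain ⟨u, hu, he⟩ := he₀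
    have hu' : u.2.len ≤ n := by
      by_contra h
      exact H ⟨u, by omega, he⟩
    have hopen : IsOpen {q : I × P.E | q.2 ∈ P.O u} := (P.isOpen_O u).preimage continuous_snd
    obtain ⟨K, hK, hK2⟩ := P.h_ext (!u.1) {j | (RW.act j u.2).len = n + 1}
    rw [Bool.not_not] at hK hK2
    have key : ∀ q : I × P.E, q.2 ∈ P.O u → K (q.1, P.core.proj q.2) ∈ P.U u.1 ∧
        P.D n q.1 q.2 = P.sec u (K (q.1, P.core.proj q.2)) := by
      rintro ⟨t, e⟩ heu
      dsimp only at heu ⊢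
      obtain ⟨hK3, hK4⟩ := hK2 (t, P.core.proj e) heu.1
      dsimp only at hK3 hK4
      by_cases hc : P.core.proj e ∈ P.U (!u.1) ∧ (RW.act (P.N (P.core.proj e)) u.2).len = n + 1
      · have hv := P.mem_O_iff u e heu hc.1
        have hp : par n (!u.1, RW.act (P.N (P.core.proj e)) u.2) hc.2 = P.N (P.core.proj e) := by
          apply RW.parent_unique _ n hc.2
          · exact (par_spec n _ hc.2).le
          · rw [RW.act_act]; exact hu'
        rw [hK3 hc.1 hc.2, P.D_eq n t e _ hc.2 hv, hp]
        have hs := P.h_strip (!u.1) t _ hc.1 (by simpa using heu.1)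
        have hm := P.h_mem (!u.1) (P.N (P.core.proj e)) t _ hc.1
        rw [Bool.not_not] at hs
        refine ⟨hs.1, ?_⟩
        have := P.sec_eq u _ hs.1 hm
        rw [hs.2] at this
        exact this
      · rw [hK4 hc]
        refine ⟨heu.1, ?_⟩
        rw [P.sec_proj u e heu, P.D_neg]
        rintro ⟨⟨ε, l⟩, hv, hev⟩
        by_cases hε : ε = u.1
        · subst hε
          have := P.O_inj _ _ _ _ hev heu
          subst this
          dsimp only at hv
          omega
        · have hε' : ε = !u.1 := by
            revert hε; cases ε <;> cases u.1 <;> simp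
          subst hε'
          have := P.mem_O_iff u e heu hev.1
          have := P.O_inj _ _ _ _ this hev
          exact hc ⟨hev.1, by rw [this]; exact hv⟩
    have hc : ContinuousOn (fun q : I × P.E => P.sec u (K (q.1, P.core.proj q.2)))
        {q : I × P.E | q.2 ∈ P.O u} := by
      refine (P.sec_cont u).comp (hK.comp
        (f := fun q : I × P.E => (q.1, P.core.proj q.2)) ?_ ?_) ?_
      · exact (continuous_fst.prodMk (P.cont_proj.comp continuous_snd)).continuousOn
      · intro q hq; exact hq.1
      · intro q hq; exact (key q hq).1
    refine (hc.continuousAt (hopen.mem_nhds he)).congr ?_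
    filter_upwards [hopen.mem_nhds he] with q hq
    exact (key q hq).2.symm

theorem D_fix (n : ℕ) (t : I) (ε : Bool) (e : P.E) (he : e ∈ P.O (ε, RW.nil))
    (hfix : P.core.proj e ∈ P.U (!ε) → P.h (!ε) (P.N (P.core.proj e)) t (P.core.proj e) = P.core.proj e) :
    P.D n t e = e := by
  by_cases H : ∃ v : Bool × RW J, v.2.len = n + 1 ∧ e ∈ P.O v
  · obtain ⟨⟨ε', l⟩, hv, hev⟩ := H
    by_cases hε : ε' = ε
    · subst hε
      have := P.O_inj _ _ _ _ hev he
      subst this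
      simp [RW.nil, RW.len] at hv
    · have hε' : ε' = !ε := by revert hε; cases ε <;> cases ε' <;> simp
      subst hε'
      have h1 := P.mem_O_iff _ e he hev.1
      have h2 := P.O_inj _ _ _ _ hev h1
      subst h2
      have hp : par n _ hv = P.N (P.core.proj e) := by
        apply RW.parent_unique _ n hv
        · exact (par_spec n _ hv).le
        · dsimp only; rw [RW.act_act]; simp [RW.nil, RW.len]
      rw [P.D_eq n t e _ hv hev, hp]
      dsimp only
      rw [hfix hev.1, P.sec_proj _ _ hev]
  · exact P.D_neg _ _ _ H

section loops
variable {Y : Type} [TopologicalSpace Y] (B : Set Y)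

theorem step (n : ℕ) (ε : Bool) (e : P.E) (he : e ∈ P.O (ε, RW.nil))
    (hfix : ∀ t, P.core.proj e ∈ P.U (!ε) →
      P.h (!ε) (P.N (P.core.proj e)) t (P.core.proj e) = P.core.proj e)
    (f : C(Y, P.E)) (hf : ∀ y ∈ B, f y = e) (hn : ∀ y, f y ∈ P.EN (n + 1)) :
    ∃ g : C(Y, P.E), f.HomotopicRel g B ∧ ∀ y, g y ∈ P.EN n := by
  have hc : Continuous (fun q : I × Y => P.D n q.1 (f q.2)) := by
    rw [← continuousOn_univ]
    exact (P.D_cont n).comp (f := fun q : I × Y => (q.1, f q.2))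
      (continuous_fst.prodMk (f.continuous.comp continuous_snd)).continuousOn
      (fun q _ => hn q.2)
  refine ⟨⟨fun y => P.D n 1 (f y), hc.comp (by fun_prop : Continuous fun y : Y => ((1 : I), y))⟩, ⟨⟨⟨⟨_, hc⟩, ?_, ?_⟩, ?_⟩⟩, ?_⟩
  · intro y; exact P.D_zero n _
  · intro y; rfl
  · intro t y hy
    change P.D n t (f y) = f y
    rw [hf y hy]
    exact P.D_fix n t ε e he (hfix t)
  · intro y; exact P.D_one n _ (hn y)

theorem steps (n : ℕ) (ε : Bool) (e : P.E) (he : e ∈ P.O (ε, RW.nil))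
    (hfix : ∀ t, P.core.proj e ∈ P.U (!ε) →
      P.h (!ε) (P.N (P.core.proj e)) t (P.core.proj e) = P.core.proj e)
    (f : C(Y, P.E)) (hf : ∀ y ∈ B, f y = e) (hn : ∀ y, f y ∈ P.EN n) :
    ∃ g : C(Y, P.E), f.HomotopicRel g B ∧ ∀ y, g y ∈ P.EN 0 := by
  induction n generalizing f with
  | zero => exact ⟨f, .refl _, hn⟩
  | succ n ih =>
    obtain ⟨g, hg, hg2⟩ := P.step B n ε e he hfix f hf hn
    obtain ⟨g', hg', hg2'⟩ := ih g (fun y hy => by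
      obtain ⟨H⟩ := hg
      rw [← hf y hy]; exact (H.fst_eq_snd hy).symm) hg2
    exact ⟨g', hg.trans hg', hg2'⟩

theorem EN_mono {n m : ℕ} (h : n ≤ m) : P.EN n ⊆ P.EN m := fun _ ⟨v, hv, he⟩ => ⟨v, hv.trans h, he⟩
theorem isOpen_EN (n : ℕ) : IsOpen (P.EN n) := by
  have : P.EN n = ⋃ v : {v : Bool × RW J // v.2.len ≤ n}, P.O v := by
    ext e; simp [EN]
  rw [this]
  exact isOpen_iUnion fun v => P.isOpen_O _

theorem exists_bound [CompactSpace Y] (f : C(Y, P.E)) : ∃ n, ∀ y, f y ∈ P.EN n := by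
  obtain ⟨n, hn⟩ := isCompact_univ.elim_directed_cover (fun n => f ⁻¹' P.EN n)
    (fun n => (P.isOpen_EN n).preimage f.continuous) (fun y _ => by
      obtain ⟨ε, hε⟩ := P.cover (P.core.proj (f y))
      obtain ⟨l, hl⟩ := P.exists_O (f y) ε hε
      exact mem_iUnion.2 ⟨l.len, _, le_rfl, hl⟩)
    (directed_of_isDirected_le fun n m h => preimage_mono (P.EN_mono h))
  exact ⟨n, fun y => hn (mem_univ y)⟩

/-- main output: any lifted map is homotopic rel `B` to a map into the chart `U ε`. -/
theorem main_E [CompactSpace Y] [PreconnectedSpace Y] (hB : B.Nonempty) (ε : Bool) (e : P.E)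
    (he : e ∈ P.O (ε, RW.nil))
    (hfix : ∀ t, P.core.proj e ∈ P.U (!ε) →
      P.h (!ε) (P.N (P.core.proj e)) t (P.core.proj e) = P.core.proj e)
    (f : C(Y, P.E)) (hf : ∀ y ∈ B, f y = e) :
    ∃ g : C(Y, P.E), f.HomotopicRel g B ∧ ∀ y, P.core.proj (g y) ∈ P.U ε := by
  obtain ⟨n, hn⟩ := P.exists_bound f
  obtain ⟨g, hg, hg2⟩ := P.steps B n ε e he hfix f hf hn
  refine ⟨g, hg, ?_⟩
  have hcl : IsClopen (g ⁻¹' P.O (ε, RW.nil)) := by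
    refine ⟨?_, (P.isOpen_O _).preimage g.continuous⟩
    rw [← isOpen_compl_iff]
    have : (g ⁻¹' P.O (ε, RW.nil))ᶜ = g ⁻¹' P.O (!ε, RW.nil) := by
      ext y
      simp only [mem_compl_iff, mem_preimage]
      constructor
      · intro h
        obtain ⟨⟨ε', l⟩, hl, hv⟩ := hg2 y
        have hl' : l = RW.nil := by
          apply Subtype.ext
          simpa [RW.len, RW.nil] using hl
        subst hl'
        have : ε' = !ε := by
          by_contra h'
          have : ε' = ε := by revert h'; cases ε <;> cases ε' <;> simp
          exact h (this ▸ hv)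
        exact this ▸ hv
      · intro h h'
        have := P.O_unique 0 _ _ rfl rfl _ h h'
        simp at this
    rw [this]
    exact (P.isOpen_O _).preimage g.continuous
  obtain ⟨y0, hy0⟩ := hB
  have : g ⁻¹' P.O (ε, RW.nil) = univ := hcl.eq_univ ⟨y0, by
    obtain ⟨H⟩ := hg
    have := H.fst_eq_snd hy0
    rw [hf y0 hy0] at this
    rw [mem_preimage]
    exact this ▸ he⟩
  intro y
  exact (this.symm ▸ mem_univ y : y ∈ g ⁻¹' P.O (ε, RW.nil)).1
end loops
end PushData

namespace Planar
def sg (ε : Bool) : ℝ := if ε then 1 else -1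
theorem sg_not (ε : Bool) : sg (!ε) = - sg ε := by cases ε <;> simp [sg]
theorem sg_mul_self (ε : Bool) : sg ε * sg ε = 1 := by cases ε <;> simp [sg]

variable (S : Finset ℝ)

abbrev X : Type := {q : ℝ × ℝ // q.2 ≠ 0 ∨ q.1 ∉ S}
noncomputable def filt (x : ℝ) : Finset ℝ := S.filter (· < x)
abbrev J : Type := {T : Finset ℝ // ∃ x, x ∉ S ∧ filt S x = T}

def st (j : J S) (x : ℝ) : Prop := x ∉ S ∧ filt S x = j.1
noncomputable def cc (j : J S) : ℝ := j.2.choose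
theorem cc_st (j : J S) : st S j (cc S j) := j.2.choose_spec

theorem lt_iff {x x' : ℝ} (h : filt S x = filt S x') {s : ℝ} (hs : s ∈ S) : s < x ↔ s < x' := by
  have := Finset.ext_iff.1 h s
  simpa [filt, hs] using this

theorem st_of_mem {j : J S} {x y z : ℝ} (hx : st S j x) (hz : st S j z) (h1 : x ≤ y) (h2 : y ≤ z) :
    st S j y := by
  have hl : ∀ s ∈ S, (s < x ↔ s < z) := fun s hs => lt_iff S (hx.2.trans hz.2.symm) hs
  refine ⟨fun hy => ?_, ?_⟩
  · have : y < z := lt_of_le_of_ne h2 (fun h => hz.1 (h ▸ hy))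
    exact absurd ((hl y hy).2 this) (not_lt.2 h1)
  · rw [← hx.2]
    ext s
    simp only [filt, Finset.mem_filter, and_congr_right_iff]
    intro hs
    exact ⟨fun h => (hl s hs).2 (h.trans_le h2), fun h => h.trans_le h1⟩

theorem st_conv {j : J S} {x c u : ℝ} (hx : st S j x) (hc : st S j c) (h0 : 0 ≤ u) (h1 : u ≤ 1) :
    st S j (x + u * (c - x)) := by
  rcases le_total x c with h | h
  · exact st_of_mem S hx hc (by nlinarith) (by nlinarith)
  · exact st_of_mem S hc hx (by nlinarith) (by nlinarith)

theorem ev_filt {x : ℝ} (hx : x ∉ S) : ∀ᶠ x' in 𝓝 x, x' ∉ S ∧ filt S x' = filt S x := by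
  have : ∀ᶠ x' in 𝓝 x, ∀ s ∈ S, x' ≠ s ∧ (s < x' ↔ s < x) := by
    rw [Filter.eventually_all_finset]
    intro s hs
    have hne : x ≠ s := fun h => hx (h ▸ hs)
    rcases lt_or_gt_of_ne hne with h | h
    · filter_upwards [eventually_lt_nhds h] with x' hx'
      exact ⟨hx'.ne, iff_of_false (not_lt.2 hx'.le) (not_lt.2 h.le)⟩
    · filter_upwards [eventually_gt_nhds h] with x' hx'
      exact ⟨hx'.ne', iff_of_true hx' h⟩
  filter_upwards [this] with x' h
  refine ⟨fun hs => (h x' hs).1 rfl, ?_⟩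
  ext s
  simp only [filt, Finset.mem_filter, and_congr_right_iff]
  exact fun hs => (h s hs).2

theorem ev_st {x : ℝ} (hx : x ∉ S) (j : J S) : ∀ᶠ x' in 𝓝 x, (st S j x' ↔ st S j x) := by
  filter_upwards [ev_filt S hx] with x' h
  simp [st, h.1, h.2, hx]

theorem isOpen_st (j : J S) : IsOpen {x | st S j x} := by
  rw [isOpen_iff_mem_nhds]
  intro x hx
  filter_upwards [ev_st S hx.1 j] with x' h
  exact h.2 hx

noncomputable def dd (j : J S) (x : ℝ) : ℝ := Metric.infDist x {x | st S j x}ᶜ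
theorem dd_cont (j : J S) : Continuous (dd S j) := Metric.continuous_infDist_pt _
theorem dd_nonneg (j : J S) (x : ℝ) : 0 ≤ dd S j x := Metric.infDist_nonneg
theorem dd_off (j : J S) (x : ℝ) (h : ¬ st S j x) : dd S j x = 0 :=
  Metric.infDist_zero_of_mem h
theorem dd_pos (hS : S.Nonempty) (j : J S) (x : ℝ) (h : st S j x) : 0 < dd S j x := by
  refine ((isOpen_st S j).isClosed_compl.notMem_iff_infDist_pos ?_).1 (by simpa using h)
  obtain ⟨s, hs⟩ := hS
  exact ⟨s, fun h => h.1 hs⟩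

open Classical in
noncomputable def lam (ε : Bool) (j : J S) (q : ℝ × ℝ) : ℝ :=
  if st S j q.1 then max (sg ε * q.2) 0 / (|q.2| + dd S j q.1) else 1

theorem abs_sg (ε : Bool) (y : ℝ) : max (sg ε * y) 0 ≤ |y| := by
  cases ε <;> simp [sg, le_abs_self, neg_le_abs]

theorem lam_nonneg (ε j q) : 0 ≤ lam S ε j q := by
  unfold lam
  split_ifs
  · exact div_nonneg (le_max_right _ _) (add_nonneg (abs_nonneg _) (dd_nonneg _ _ _))
  · exact zero_le_one
theorem lam_le_one (ε j q) : lam S ε j q ≤ 1 := by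
  unfold lam
  split_ifs
  · apply div_le_one_of_le₀ _ (add_nonneg (abs_nonneg _) (dd_nonneg _ _ _))
    linarith [abs_sg ε q.2, dd_nonneg S j q.1]
  · exact le_rfl
theorem lam_off (ε j q) (h : ¬ st S j q.1) : lam S ε j q = 1 := if_neg h
theorem lam_zero (ε j) (q : ℝ × ℝ) (h : st S j q.1) (hy : sg ε * q.2 ≤ 0) : lam S ε j q = 0 := by
  rw [lam, if_pos h, max_eq_right hy, zero_div]

theorem lam_cont (hS : S.Nonempty) (ε j) (q : ℝ × ℝ) (hq : q.1 ∉ S ∨ 0 < sg ε * q.2) :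
    ContinuousAt (lam S ε j) q := by
  have hnum : Continuous fun q : ℝ × ℝ => max (sg ε * q.2) 0 := by fun_prop
  have hden : Continuous fun q : ℝ × ℝ => |q.2| + dd S j q.1 :=
    (continuous_snd.abs).add ((dd_cont S j).comp continuous_fst)
  by_cases hx : q.1 ∈ S
  · have hy : 0 < sg ε * q.2 := by tauto
    have h1 : ∀ᶠ q' : ℝ × ℝ in 𝓝 q, 0 < sg ε * q'.2 :=
      (by fun_prop : Continuous fun q : ℝ × ℝ => sg ε * q.2).continuousAt.eventually (eventually_gt_nhds hy)
    have habs : ∀ y : ℝ, 0 < sg ε * y → |y| = sg ε * y := by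
      intro y hy
      cases ε
      · simp only [sg] at hy ⊢
        simp at hy ⊢; exact hy.le
      · simp only [sg] at hy ⊢
        simp at hy ⊢; exact hy.le
    refine ((hnum.continuousAt (x := q)).div (hden.continuousAt (x := q)) ?_).congr ?_
    · have := habs _ hy; have := dd_nonneg S j q.1; linarith
    · filter_upwards [h1] with q' hq'
      dsimp
      unfold lam
      split_ifs with h
      · rfl
      · rw [dd_off S j _ h, max_eq_left hq'.le, habs _ hq', add_zero, div_self hq'.ne']
  · have h1 : ∀ᶠ q' : ℝ × ℝ in 𝓝 q, (st S j q'.1 ↔ st S j q.1) :=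
      continuous_fst.continuousAt.eventually (ev_st S hx j)
    by_cases h : st S j q.1
    · refine ((hnum.continuousAt (x := q)).div (hden.continuousAt (x := q)) ?_).congr ?_
      · have := dd_pos S hS j q.1 h; have := abs_nonneg q.2; linarith
      · filter_upwards [h1] with q' hq'
        rw [lam, if_pos (hq'.2 h)]; rfl
    · refine (continuousAt_const (y := (1:ℝ))).congr ?_
      filter_upwards [h1] with q' hq'
      rw [lam, if_neg (fun h' => h (hq'.1 h'))]

noncomputable def raw (ε : Bool) (j : J S) (t : ℝ) (q : ℝ × ℝ) : ℝ × ℝ :=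
  (q.1 + (max (2 * t - 1) 0 * lam S ε j q) * (cc S j - q.1),
   q.2 + (min (2 * t) 1 * lam S ε j q) * (sg ε * max (sg ε * q.2) 1 - q.2))

theorem raw_zero (ε j q) : raw S ε j 0 q = q := by
  ext <;> simp [raw]

theorem raw_fix (ε j t) (q : ℝ × ℝ) (h : st S j q.1) (hy : sg ε * q.2 ≤ 0) : raw S ε j t q = q := by
  ext <;> simp [raw, lam_zero S ε j q h hy]

theorem raw_strip (ε j t) (ht : t ∈ Icc (0:ℝ) 1) (q : ℝ × ℝ) (h : st S j q.1) :
    st S j (raw S ε j t q).1 := by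
  apply st_conv S h (cc_st S j)
  · exact mul_nonneg (le_max_right _ _) (lam_nonneg _ _ _ _)
  · exact mul_le_one₀ (max_le (by linarith [ht.2]) zero_le_one) (lam_nonneg _ _ _ _) (lam_le_one _ _ _ _)

theorem raw_one (ε j) (q : ℝ × ℝ) : st S j (raw S ε j 1 q).1 := by
  by_cases h : st S j q.1
  · exact raw_strip S ε j 1 ⟨zero_le_one, le_rfl⟩ q h
  · have : (raw S ε j 1 q).1 = cc S j := by
      simp only [raw, lam_off S ε j q h]; norm_num
    rw [this]; exact cc_st S j

theorem raw_mem (ε j t) (ht : t ∈ Icc (0:ℝ) 1) (q : ℝ × ℝ) (hq : q.1 ∉ S ∨ 0 < sg ε * q.2) :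
    (raw S ε j t q).1 ∉ S ∨ 0 < sg ε * (raw S ε j t q).2 := by
  by_cases h : st S j q.1
  · exact Or.inl (raw_strip S ε j t ht q h).1
  · have hy : sg ε * (raw S ε j t q).2 =
      (1 - min (2 * t) 1) * (sg ε * q.2) + min (2 * t) 1 * max (sg ε * q.2) 1 := by
      simp only [raw, lam_off S ε j q h]
      linear_combination (min (2 * t) 1 * max (sg ε * q.2) 1) * sg_mul_self ε
    rcases le_total (2 * t) 1 with h2 | h2
    · have hx : (raw S ε j t q).1 = q.1 := by
        simp only [raw]; rw [max_eq_right (by linarith)]; ring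
      rw [hx, hy, min_eq_left h2]
      refine hq.imp id fun hq => ?_
      have h3 : sg ε * q.2 ≤ max (sg ε * q.2) 1 := le_max_left _ _
      nlinarith [ht.1]
    · right
      rw [hy, min_eq_right h2]
      have := le_max_right (sg ε * q.2) 1
      linarith

theorem raw_cont (hS : S.Nonempty) (ε j) (t : ℝ) (q : ℝ × ℝ) (hq : q.1 ∉ S ∨ 0 < sg ε * q.2) :
    ContinuousAt (fun p : ℝ × (ℝ × ℝ) => raw S ε j p.1 p.2) (t, q) := by
  have hl : ContinuousAt (fun p : ℝ × (ℝ × ℝ) => lam S ε j p.2) (t, q) :=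
    ContinuousAt.comp (g := lam S ε j) (f := fun p : ℝ × (ℝ × ℝ) => p.2) (x := (t, q))
      (lam_cont S hS ε j q hq) continuousAt_snd
  unfold raw
  fun_prop

def U (ε : Bool) : Set (X S) := {q | q.1.1 ∉ S ∨ 0 < sg ε * q.1.2}

theorem isOpen_U (ε) : IsOpen (U S ε) := by
  have h1 : IsOpen {q : X S | q.1.1 ∉ S} :=
    (S.finite_toSet.isClosed.isOpen_compl).preimage (continuous_fst.comp continuous_subtype_val)
  have h2 : IsOpen {q : X S | 0 < sg ε * q.1.2} := isOpen_lt (by fun_prop) (by fun_prop)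
  exact h1.union h2

theorem both {q : X S} (ε : Bool) (h1 : q ∈ U S ε) (h2 : q ∈ U S (!ε)) : q.1.1 ∉ S := by
  intro h
  rcases h1 with h1 | h1
  · exact h1 h
  rcases h2 with h2 | h2
  · exact h2 h
  rw [sg_not] at h2
  linarith

theorem exists_notMem : ∃ x, x ∉ S := Infinite.exists_notMem_finset S

open Classical in
noncomputable def N (q : X S) : J S :=
  if h : q.1.1 ∉ S then ⟨filt S q.1.1, q.1.1, h, rfl⟩ else
    ⟨filt S (exists_notMem S).choose, _, (exists_notMem S).choose_spec, rfl⟩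

theorem st_N (q : X S) (h : q.1.1 ∉ S) : st S (N S q) q.1.1 := by
  refine ⟨h, ?_⟩
  rw [N, dif_pos h]
theorem N_eq (q : X S) (j : J S) (h : st S j q.1.1) : N S q = j := by
  rw [N, dif_pos h.1]; exact Subtype.ext h.2

open Classical in
noncomputable def h (ε : Bool) (j : J S) (t : I) (q : X S) : X S :=
  if H : (raw S ε j t q.1).2 ≠ 0 ∨ (raw S ε j t q.1).1 ∉ S then ⟨_, H⟩ else q

theorem h_val (ε : Bool) (j : J S) (t : I) (q : X S) (hq : q ∈ U S ε) :
    (h S ε j t q).1 = raw S ε j t q.1 := by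
  have : (raw S ε j t q.1).2 ≠ 0 ∨ (raw S ε j t q.1).1 ∉ S := by
    rcases raw_mem S ε j t t.2 q.1 hq with h | h
    · exact Or.inr h
    · left; intro h'; rw [h'] at h; simp at h
  rw [h, dif_pos this]

theorem h_cont (hS : S.Nonempty) (ε j) (p : I × X S) (hp : p.2 ∈ U S ε) :
    ContinuousAt (fun q : I × X S => h S ε j q.1 q.2) p := by
  refine (Topology.IsInducing.mk rfl : IsInducing (Subtype.val : X S → ℝ × ℝ)).continuousAt_iff.2 ?_
  have : ContinuousAt (fun q : I × X S => raw S ε j q.1 q.2.1) p :=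
    ContinuousAt.comp (g := fun p : ℝ × (ℝ × ℝ) => raw S ε j p.1 p.2)
      (f := fun q : I × X S => ((q.1 : ℝ), q.2.1)) (x := p) (raw_cont S hS ε j p.1 p.2.1 hp)
      (by fun_prop)
  refine this.congr ?_
  filter_upwards [((isOpen_U S ε).preimage continuous_snd).mem_nhds hp] with q hq
  exact (h_val S ε j q.1 q.2 hq).symm

theorem ev_N {q : X S} (hq : q.1.1 ∉ S) : ∀ᶠ q' in 𝓝 q, q'.1.1 ∉ S ∧ N S q' = N S q := by
  have hc : Continuous fun q : X S => q.1.1 := by fun_prop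
  filter_upwards [hc.continuousAt.eventually (ev_filt S hq)] with q' h'
  refine ⟨h'.1, N_eq S q' _ ⟨h'.1, ?_⟩⟩
  rw [h'.2]; exact (st_N S q hq).2

noncomputable def push (hS : S.Nonempty) : PushData (X S) (J S) where
  U := U S
  isOpen_U := isOpen_U S
  cover q := by
    rcases q.2 with h | h
    · rcases lt_or_gt_of_ne h with h | h
      · exact ⟨false, Or.inr (by simpa [sg] using h)⟩
      · exact ⟨true, Or.inr (by simpa [sg] using h)⟩
    · exact ⟨true, Or.inl h⟩
  N := N S
  N_loc q hq := (ev_N S (both S true (hq _) (hq _))).mono fun _ h => h.2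
  h := h S
  h_cont ε j p hp := (h_cont S hS ε j p hp).continuousWithinAt
  h_mem ε j t z hz := by
    change (h S ε j t z).1.1 ∉ S ∨ 0 < sg ε * (h S ε j t z).1.2
    rw [h_val S ε j t z hz]
    exact raw_mem S ε j t t.2 z.1 hz
  h_zero ε j z hz := by
    apply Subtype.ext
    rw [h_val S ε j 0 z hz]
    exact raw_zero S ε j z.1
  h_one ε j z hz := by
    have : st S j (h S ε j 1 z).1.1 := by
      rw [h_val S ε j 1 z hz]; exact raw_one S ε j z.1
    exact ⟨Or.inl this.1, N_eq S _ _ this⟩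
  h_strip ε t z hz hz' := by
    have : st S (N S z) (h S ε (N S z) t z).1.1 := by
      rw [h_val S ε _ t z hz]
      exact raw_strip S ε _ t t.2 z.1 (st_N S z (both S ε hz hz'))
    exact ⟨Or.inl this.1, N_eq S _ _ this⟩
  h_ext ε A := by
    classical
    refine ⟨fun q => if q.2 ∈ U S ε ∧ N S q.2 ∈ A then h S ε (N S q.2) q.1 q.2 else q.2, ?_, ?_⟩
    · rintro ⟨t, q⟩ hq
      apply ContinuousAt.continuousWithinAt
      by_cases hx : q.1.1 ∈ S
      · have hy : sg ε * q.1.2 < 0 := by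
          rcases hq with h | h
          · exact absurd hx h
          · rw [sg_not] at h; dsimp at h; linarith
        refine continuousAt_snd.congr ?_
        have hc : Continuous fun q : I × X S => sg ε * q.2.1.2 := by fun_prop
        filter_upwards [(hc.continuousAt (x := (t, q))).eventually (eventually_lt_nhds hy)] with q' hq'
        split_ifs with h'
        · apply Subtype.ext
          have : q'.2.1.1 ∉ S := by
            rcases h'.1 with h | h
            · exact h
            · linarith
          rw [h_val S ε _ _ _ h'.1, raw_fix S ε _ _ _ (st_N S _ this) hq'.le]
        · rfl
      · have he := (continuousAt_snd : ContinuousAt (Prod.snd : I × X S → X S) (t, q)).eventually (ev_N S hx)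
        by_cases hA : N S q ∈ A
        · refine (h_cont S hS ε (N S q) (t, q) (Or.inl hx)).congr ?_
          filter_upwards [he] with q' hq'
          rw [if_pos ⟨Or.inl hq'.1, by rw [hq'.2]; exact hA⟩, hq'.2]
        · refine continuousAt_snd.congr ?_
          filter_upwards [he] with q' hq'
          rw [if_neg]
          rintro ⟨-, h'⟩
          rw [hq'.2] at h'; exact hA h'
    · intro q hq
      exact ⟨fun h1 h2 => if_pos ⟨h1, h2⟩, fun h1 => if_neg h1⟩

end Planar

namespace OC
theorem mkRel {Y X : Type} [TopologicalSpace Y] [TopologicalSpace X] {B : Set Y} {f g : C(Y, X)}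
    (H : I × Y → X) (hc : Continuous H) (h0 : ∀ y, H (0, y) = f y) (h1 : ∀ y, H (1, y) = g y)
    (hB : ∀ t, ∀ y ∈ B, H (t, y) = f y) : f.HomotopicRel g B :=
  ⟨⟨⟨⟨H, hc⟩, h0, h1⟩, hB⟩⟩

theorem face_conn {k : ℕ} (i : Fin k) (c : I) : IsPreconnected {y : Fin k → I | y i = c} := by
  classical
  have : {y : Fin k → I | y i = c} = Set.pi univ (fun j => if j = i then {c} else univ) := by
    ext y
    simp only [Set.mem_ofPred_eq, Set.mem_pi, mem_univ, true_implies]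
    constructor
    · intro h j
      by_cases hj : j = i
      · subst hj; simp [h]
      · simp [hj]
    · intro h; simpa using h i
  rw [this]
  refine isPreconnected_univ_pi fun j => ?_
  split_ifs
  · exact isPreconnected_singleton
  · exact isPreconnected_univ

theorem bd_conn {k : ℕ} (hk : 2 ≤ k) : IsPreconnected (Cube.boundary (Fin k)) := by
  classical
  have hsub : ∀ (i : Fin k) (c : I), (c = 0 ∨ c = 1) →
      {y : Fin k → I | y i = c} ⊆ Cube.boundary (Fin k) := by
    intro i c hc y hy
    exact ⟨i, by rcases hc with rfl | rfl <;> simp_all⟩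
  have h0 : ∀ i : Fin k, (0 : Fin k → I) ∈ {y : Fin k → I | y i = 0} := fun i => rfl
  apply isPreconnected_of_forall (0 : Fin k → I)
  rintro y ⟨i, hi | hi⟩
  · exact ⟨_, hsub i 0 (Or.inl rfl), h0 i, hi, face_conn i 0⟩
  · obtain ⟨j, hj⟩ : ∃ j : Fin k, j ≠ i := by
      have : Nontrivial (Fin k) := Fin.nontrivial_iff_two_le.2 hk
      exact exists_ne i
    refine ⟨{y : Fin k → I | y i = 1} ∪ {y : Fin k → I | y j = 0},
      union_subset (hsub i 1 (Or.inr rfl)) (hsub j 0 (Or.inl rfl)), Or.inr (h0 j), Or.inl hi, ?_⟩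
    refine IsPreconnected.union (Function.update (0 : Fin k → I) i 1) ?_ ?_ (face_conn i 1) (face_conn j 0)
    · simp
    · simp [hj]

theorem lift_cube {k : ℕ} (hk : 2 ≤ k) {E X : Type} [TopologicalSpace E] [TopologicalSpace X]
    {π : E → X} (cov : IsCoveringMap π) (e : E) (f : C(Fin k → I, X))
    (hf : ∀ y ∈ Cube.boundary (Fin k), f y = π e) :
    ∃ g : C(Fin k → I, E), (∀ y, π (g y) = f y) ∧ ∀ y ∈ Cube.boundary (Fin k), g y = e := by
  have h0 : (0 : Fin k → I) ∈ Cube.boundary (Fin k) := ⟨⟨0, by omega⟩, Or.inl rfl⟩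
  let H : C(I × (Fin k → I), X) := ⟨fun q => f (fun i => q.1 * q.2 i), by fun_prop⟩
  have H0 : ∀ a, H (0, a) = π (ContinuousMap.const (Fin k → I) e a) := by
    intro a
    change f _ = π e
    rw [← hf _ h0]
    congr 1; ext i; simp
  have hl : ∀ q, π (cov.liftHomotopy H (.const _ e) H0 q) = H q :=
    congr_fun (cov.liftHomotopy_lifts H (.const _ e) H0)
  let L := cov.liftHomotopy H (.const _ e) H0
  have hz : ∀ a, L (0, a) = e := cov.liftHomotopy_zero H (.const _ e) H0
  let g : C(Fin k → I, E) := ⟨fun y => L (1, y), by fun_prop⟩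
  have hg : ∀ y, π (g y) = f y := by
    intro y
    refine (hl (1, y)).trans ?_
    change f _ = f _
    congr 1; ext i; simp
  refine ⟨g, hg, ?_⟩
  have hg0 : g 0 = e := by
    have := cov.const_of_comp (g := fun t : I => L (t, 0)) (by fun_prop) (fun a a' => by
      change π (L _) = π (L _)
      rw [hl, hl]
      change f _ = f _
      congr 1; ext i; simp) 1 0
    exact this.trans (hz 0)
  intro y hy
  rw [← hg0]
  exact cov.constOn_of_comp (bd_conn hk) g.continuous.continuousOn
    (fun a ha a' ha' => by rw [hg, hg, hf a ha, hf a' ha']) hy h0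
end OC

namespace Planar
theorem null {k : ℕ} (hk : 2 ≤ k) (S : Finset ℝ) (hS : S.Nonempty) (p : X S) (hp : p.1.2 = 0)
    (f : C(Fin k → I, X S)) (hf : ∀ y ∈ Cube.boundary (Fin k), f y = p) :
    f.HomotopicRel (.const _ p) (Cube.boundary (Fin k)) := by
  have hpS : p.1.1 ∉ S := by
    rcases p.2 with h | h
    · exact absurd hp h
    · exact h
  let P := push S hS
  have hU : ∀ ε, p ∈ U S ε := fun ε => Or.inl hpS
  let e : P.E := P.sec (true, RW.nil) p
  have he : e ∈ P.O (true, RW.nil) := P.sec_mem _ _ (hU _)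
  have hpe : P.core.proj e = p := P.proj_sec _ _ (hU _)
  have hfix : ∀ ε t, h S ε (N S p) t p = p := by
    intro ε t
    apply Subtype.ext
    rw [h_val S ε _ t p (hU ε), raw_fix S ε _ _ _ (st_N S p hpS) (by rw [hp]; simp)]
  have h0 : (Cube.boundary (Fin k)).Nonempty := ⟨0, ⟨0, by omega⟩, Or.inl rfl⟩
  obtain ⟨f', hf', hfb⟩ := OC.lift_cube hk P.isCov e f (fun y hy => by rw [hf y hy]; exact hpe.symm)
  obtain ⟨g, hg, hgU⟩ := P.main_E (Cube.boundary (Fin k)) h0 true e he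
    (fun t _ => by rw [hpe]; exact hfix _ t) f' hfb
  have hgU : ∀ y, P.core.proj (g y) ∈ U S true := hgU
  have hgb : ∀ y ∈ Cube.boundary (Fin k), P.core.proj (g y) = p := by
    intro y hy
    obtain ⟨H⟩ := hg
    have := H.fst_eq_snd hy
    rw [← this, hfb y hy, hpe]
  let pr : C(P.E, X S) := ⟨P.core.proj, P.cont_proj⟩
  let g1 : C(Fin k → I, X S) := pr.comp g
  have hg1 : ∀ y, g1 y ∈ U S true := hgU
  have hg1b : ∀ y ∈ Cube.boundary (Fin k), g1 y = p := hgb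
  have s1 : f.HomotopicRel g1 (Cube.boundary (Fin k)) := by
    have : f = pr.comp f' := by ext1 y; exact (hf' y).symm
    rw [this]
    exact hg.map fun H => H.compContinuousMap pr
  have hc : Continuous fun q : I × (Fin k → I) => h S true (N S p) q.1 (g1 q.2) := by
    rw [continuous_iff_continuousAt]
    intro q
    exact ContinuousAt.comp (g := fun q : I × X S => h S true (N S p) q.1 q.2)
      (f := fun q : I × (Fin k → I) => (q.1, g1 q.2)) (x := q)
      (h_cont S hS true (N S p) _ (hg1 _)) (by fun_prop)
  let g2 : C(Fin k → I, X S) := ⟨fun y => h S true (N S p) 1 (g1 y),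
    hc.comp (by fun_prop : Continuous fun y : Fin k → I => ((1 : I), y))⟩
  have s2 : g1.HomotopicRel g2 (Cube.boundary (Fin k)) := by
    refine OC.mkRel _ hc (fun y => ?_) (fun y => rfl) (fun t y hy => ?_)
    · exact P.h_zero _ _ _ (hg1 y)
    · dsimp only; rw [hg1b y hy]; exact hfix _ t
  have hg2 : ∀ y, st S (N S p) (g2 y).1.1 := by
    intro y
    change st S (N S p) (h S true (N S p) 1 (g1 y)).1.1
    rw [h_val S _ _ _ _ (hg1 y)]
    exact raw_one S _ _ _
  have hg2b : ∀ y ∈ Cube.boundary (Fin k), g2 y = p := by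
    intro y hy
    change h S true (N S p) 1 (g1 y) = p
    rw [hg1b y hy, hfix]
  have s3 : g2.HomotopicRel (.const _ p) (Cube.boundary (Fin k)) := by
    refine OC.mkRel (fun q => (⟨((g2 q.2).1.1 + q.1 * (p.1.1 - (g2 q.2).1.1),
      (g2 q.2).1.2 + q.1 * (p.1.2 - (g2 q.2).1.2)),
      Or.inr (st_conv S (hg2 q.2) (st_N S p hpS) q.1.2.1 q.1.2.2).1⟩ : X S)) ?_ ?_ ?_ ?_
    · apply Continuous.subtype_mk
      fun_prop
    · intro y; apply Subtype.ext; ext <;> simp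
    · intro y; apply Subtype.ext; ext <;> simp
    · intro t y hy; apply Subtype.ext; ext <;> simp [hg2b y hy]
  exact (s1.trans s2).trans s3
end Planar

namespace OC
open Polynomial in
theorem exists_poly (Q : Finset ℂ) : ∃ (t : ℝ) (q : ℝ[X]), ∀ s ∈ Q, q.eval (s.re - t * s.im) = s.im := by
  classical
  obtain ⟨t, ht⟩ := Infinite.exists_notMem_finset
    ((Q ×ˢ Q).image fun p : ℂ × ℂ => (p.1.re - p.2.re) / (p.1.im - p.2.im))
  let L : ℂ → ℝ := fun z => z.re - t * z.im
  have hinj : Set.InjOn L Q := by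
    intro a ha b hb hab
    simp only [L] at hab
    by_cases him : a.im = b.im
    · apply Complex.ext _ him
      rw [him] at hab; linarith
    · exfalso
      apply ht
      refine Finset.mem_image.2 ⟨(a, b), Finset.mem_product.2 ⟨ha, hb⟩, ?_⟩
      have : a.im - b.im ≠ 0 := sub_ne_zero.2 him
      field_simp
      linarith
  exact ⟨t, Lagrange.interpolate Q L Complex.im, fun s hs =>
    Lagrange.eval_interpolate_at_node _ hinj hs⟩

theorem null_plane {k : ℕ} (hk : 2 ≤ k) (Q : Finset ℂ) (hQ : Q.Nonempty)
    (p : {z : ℂ // z ∉ Q})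
    (f : C(Fin k → I, {z : ℂ // z ∉ Q})) (hf : ∀ y ∈ Cube.boundary (Fin k), f y = p) :
    f.HomotopicRel (.const _ p) (Cube.boundary (Fin k)) := by
  classical
  obtain ⟨t, q, hq⟩ := exists_poly (insert p.1 Q)
  let L : ℂ → ℝ := fun z => z.re - t * z.im
  let S : Finset ℝ := Q.image L
  have inv : ∀ z z' : ℂ, L z = L z' → z.im - q.eval (L z) = z'.im - q.eval (L z') → z = z' := by
    intro z z' h1 h2
    rw [h1] at h2
    have him : z.im = z'.im := by linarith
    refine Complex.ext ?_ him
    simp only [L, him] at h1; linarith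
  let φ : C({z : ℂ // z ∉ Q}, Planar.X S) := ⟨fun z => ⟨(L z.1, z.1.im - q.eval (L z.1)), by
    by_contra hcon
    push Not at hcon
    obtain ⟨h1, h2⟩ := hcon
    obtain ⟨s, hs, hsL⟩ := Finset.mem_image.1 h2
    dsimp only at h1 hsL
    have := hq s (Finset.mem_insert_of_mem hs)
    have h3 : s = z.1 := inv _ _ hsL (by
      rw [h1]; change s.im - q.eval (s.re - t * s.im) = 0; rw [this, sub_self])
    exact z.2 (h3 ▸ hs)⟩, by
      apply Continuous.subtype_mk
      have hL : Continuous L := by fun_prop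
      have := q.continuous
      fun_prop⟩
  let b : Planar.X S → ℂ := fun w => ⟨w.1.1 + t * (w.1.2 + q.eval w.1.1), w.1.2 + q.eval w.1.1⟩
  have hbL : ∀ w, L (b w) = w.1.1 := by intro w; simp [L, b]
  have hbQ : ∀ w, b w ∉ Q := by
    intro w hw
    have h1 := hq _ (Finset.mem_insert_of_mem hw)
    change q.eval (L (b w)) = _ at h1
    rw [hbL] at h1
    have h2 : w.1.2 = 0 := by simp only [b] at h1; linarith
    rcases w.2 with h | h
    · exact h h2
    · exact h (Finset.mem_image.2 ⟨_, hw, hbL w⟩)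
  let ψ : C(Planar.X S, {z : ℂ // z ∉ Q}) := ⟨fun w => ⟨b w, hbQ w⟩, by
      apply Continuous.subtype_mk
      have := q.continuous
      have h1 : Continuous fun w : Planar.X S => (w.1.2 + q.eval w.1.1 : ℝ) := by fun_prop
      have h2 : Continuous fun w : Planar.X S => (w.1.1 + t * (w.1.2 + q.eval w.1.1) : ℝ) := by fun_prop
      exact Complex.equivRealProdCLM.symm.continuous.comp (h2.prodMk h1)⟩
  have hψφ : ∀ z, ψ (φ z) = z := by
    intro z
    apply Subtype.ext
    apply Complex.ext <;> simp [ψ, φ, b, L]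
  have hn := Planar.null hk S (hQ.image L) (φ p) (by
    change p.1.im - q.eval (p.1.re - t * p.1.im) = 0
    rw [hq _ (Finset.mem_insert_self _ _), sub_self]) (φ.comp f) (fun y hy => by
      rw [ContinuousMap.comp_apply, hf y hy])
  have h3 : (ψ.comp (φ.comp f)).HomotopicRel (ψ.comp (.const _ (φ p))) (Cube.boundary (Fin k)) :=
    hn.map fun H => H.compContinuousMap ψ
  have e1 : ψ.comp (φ.comp f) = f := by ext1 y; exact hψφ _
  have e2 : ψ.comp (.const (Fin k → I) (φ p)) = .const _ p := by ext1 y; exact hψφ _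
  rwa [e1, e2] at h3
end OC

namespace OC
section hlp
variable {ι : Type} [Fintype ι]
noncomputable def Phi (δ : ℝ) (Q Q' : ι → ℂ) (z : ℂ) : ℂ :=
  z + ∑ i, ((max 0 (1 - ‖z - Q i‖ / δ) : ℝ) : ℂ) * (Q' i - Q i)

theorem Phi_self (δ : ℝ) (Q : ι → ℂ) (z : ℂ) : Phi δ Q Q z = z := by simp [Phi]

theorem Phi_avoid {δ : ℝ} (hδ : 0 < δ) (Q Q' : ι → ℂ) (z : ℂ)
    (hsep : ∀ i j, i ≠ j → 3 * δ ≤ ‖Q i - Q j‖) (hQ : ∀ i, ‖Q' i - Q i‖ < δ)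
    (hz : ∀ i, z ≠ Q i) (j : ι) : Phi δ Q Q' z ≠ Q' j := by
  have hw0 : ∀ i, δ ≤ ‖z - Q i‖ → (max 0 (1 - ‖z - Q i‖ / δ) : ℝ) = 0 := by
    intro i hi
    apply max_eq_left
    rw [sub_nonpos, le_div_iff₀ hδ]; linarith
  by_cases H : ∃ i, ‖z - Q i‖ < δ
  · obtain ⟨i, hi⟩ := H
    have hother : ∀ m, m ≠ i → δ ≤ ‖z - Q m‖ := by
      intro m hm
      have h1 := hsep m i hm
      have h2 : ‖Q m - Q i‖ ≤ ‖z - Q i‖ + ‖z - Q m‖ := by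
        rw [show Q m - Q i = (z - Q i) - (z - Q m) by ring]; exact norm_sub_le _ _
      linarith
    have hr : 0 < ‖z - Q i‖ := norm_pos_iff.2 (sub_ne_zero.2 (hz i))
    have hlt : ‖z - Q i‖ / δ < 1 := by rw [div_lt_one hδ]; exact hi
    have hPhi : Phi δ Q Q' z = z + ((1 - ‖z - Q i‖ / δ : ℝ) : ℂ) * (Q' i - Q i) := by
      rw [Phi, Finset.sum_eq_single i]
      · rw [max_eq_right (by linarith)]
      · intro m _ hm
        rw [hw0 m (hother m hm)]; simp
      · simp
    rw [hPhi]
    intro heq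
    have hv := hQ i
    by_cases hj : j = i
    · subst hj
      have h1 : z - Q j = ((‖z - Q j‖ / δ : ℝ) : ℂ) * (Q' j - Q j) := by
        push_cast at heq ⊢
        linear_combination heq
      have h2 := congrArg norm h1
      rw [norm_mul, Complex.norm_real, Real.norm_of_nonneg (by positivity)] at h2
      have h3 : ‖z - Q j‖ / δ * ‖Q' j - Q j‖ < ‖z - Q j‖ / δ * δ :=
        mul_lt_mul_of_pos_left hv (by positivity)
      rw [div_mul_cancel₀ _ hδ.ne'] at h3
      linarith
    · have h1 := hsep j i hj
      have h2 : Q j - Q i = (z - Q i) + ((1 - ‖z - Q i‖ / δ : ℝ) : ℂ) * (Q' i - Q i) - (Q' j - Q j) := by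
        linear_combination -heq
      have h3 : ‖Q j - Q i‖ ≤ ‖z - Q i‖ + ‖((1 - ‖z - Q i‖ / δ : ℝ) : ℂ) * (Q' i - Q i)‖
          + ‖Q' j - Q j‖ := by
        rw [h2]; exact (norm_sub_le _ _).trans (by gcongr; exact norm_add_le _ _)
      rw [norm_mul, Complex.norm_real, Real.norm_of_nonneg (by linarith)] at h3
      have h4 : (1 - ‖z - Q i‖ / δ) * ‖Q' i - Q i‖ ≤ 1 * ‖Q' i - Q i‖ := by
        gcongr
        have : 0 ≤ ‖z - Q i‖ / δ := by positivity
        linarith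
      have := hQ j
      linarith
  · push Not at H
    have hPhi : Phi δ Q Q' z = z := by
      rw [Phi, Finset.sum_eq_zero, add_zero]
      intro m _
      rw [hw0 m (H m)]; simp
    rw [hPhi]
    rintro rfl
    exact absurd (hQ j) (not_lt.2 (H j))

theorem hlp {Y : Type} [PseudoMetricSpace Y] [CompactSpace Y] (Q : I × Y → ι → ℂ)
    (hQ : Continuous Q) (hd : ∀ x i j, i ≠ j → Q x i ≠ Q x j) (f : C(Y, ℂ))
    (hf : ∀ y i, f y ≠ Q (0, y) i) :
    ∃ F : I × Y → ℂ, Continuous F ∧ (∀ x i, F x ≠ Q x i) ∧ (∀ y, F (0, y) = f y) ∧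
      ∀ y, (∀ t, Q (t, y) = Q (0, y)) → ∀ t, F (t, y) = f y := by
  obtain ⟨δ, hδ, hsep⟩ : ∃ δ : ℝ, 0 < δ ∧ ∀ x i j, i ≠ j → 3 * δ ≤ ‖Q x i - Q x j‖ := by
    have h1 : ∀ p : ι × ι, ∃ d : ℝ, 0 < d ∧ ∀ x, p.1 ≠ p.2 → d ≤ ‖Q x p.1 - Q x p.2‖ := by
      rintro ⟨i, j⟩
      by_cases h : i = j
      · exact ⟨1, one_pos, fun x h' => absurd h h'⟩
      · obtain ⟨d, hd, hd'⟩ := isCompact_univ.exists_forall_le'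
          (f := fun x => ‖Q x i - Q x j‖) (a := 0) (by fun_prop)
          (fun x _ => norm_pos_iff.2 (sub_ne_zero.2 (hd x i j h)))
        exact ⟨d, hd, fun x _ => hd' x (mem_univ x)⟩
    choose d hd0 hd1 using h1
    have h2 : ∀ᶠ δ : ℝ in 𝓝[>] 0, ∀ p, δ ≤ d p / 3 := by
      rw [Filter.eventually_all]
      intro p
      exact Filter.Eventually.filter_mono nhdsWithin_le_nhds
        (eventually_le_nhds (by have := hd0 p; positivity))
    obtain ⟨δ, h3, h4⟩ := (h2.and self_mem_nhdsWithin).exists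
    refine ⟨δ, h4, fun x i j hij => ?_⟩
    have := h3 (i, j)
    have := hd1 (i, j) x hij
    dsimp only at this
    linarith
  obtain ⟨η, hη, hu⟩ := Metric.uniformContinuous_iff.1
    (CompactSpace.uniformContinuous_of_continuous hQ) δ hδ
  obtain ⟨M, hM⟩ := exists_nat_one_div_lt hη
  let c : ℕ → I := fun j => ⟨min ((j : ℝ) / (M + 1)) 1, le_min (by positivity) zero_le_one, min_le_right _ _⟩
  have hc0 : c 0 = 0 := by ext; simp [c]
  have hc1 : c (M + 1) = 1 := by
    ext; simp only [c]; push_cast; rw [div_self (by positivity)]; simp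
  have hcc : ∀ (j : ℕ) (t : I), dist (min t (c (j+1))) (min t (c j)) < η := by
    intro j t
    refine lt_of_le_of_lt ?_ hM
    have hval : ∀ a b : I, ((min a b : I) : ℝ) = min (a : ℝ) b := fun a b =>
      (Subtype.mono_coe _).map_min
    rw [Subtype.dist_eq, Real.dist_eq, hval, hval]
    refine (abs_min_sub_min_le_max _ _ _ _).trans ?_
    rw [sub_self, abs_zero, max_eq_right (abs_nonneg _)]
    simp only [c]
    refine (abs_min_sub_min_le_max _ _ _ _).trans ?_
    rw [sub_self, abs_zero, max_eq_left (abs_nonneg _), ← sub_div]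
    push_cast
    rw [add_sub_cancel_left, abs_of_nonneg (by positivity)]
  have key : ∀ j : ℕ, ∃ F : I × Y → ℂ, Continuous F ∧
      (∀ x i, F x ≠ Q (min x.1 (c j), x.2) i) ∧ (∀ y, F (0, y) = f y) ∧
      ∀ y, (∀ t, Q (t, y) = Q (0, y)) → ∀ t, F (t, y) = f y := by
    intro j
    induction j with
    | zero =>
      refine ⟨fun x => f x.2, by fun_prop, fun x i => ?_, fun y => rfl, fun y _ t => rfl⟩
      rw [hc0, min_eq_right unitInterval.nonneg']
      exact hf x.2 i
    | succ j ih =>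
      obtain ⟨F, hF, h1, h2, h3⟩ := ih
      refine ⟨fun x => Phi δ (Q (min x.1 (c j), x.2)) (Q (min x.1 (c (j+1)), x.2)) (F x),
        ?_, ?_, ?_, ?_⟩
      · unfold Phi
        fun_prop
      · intro x i
        refine Phi_avoid hδ _ _ _ (hsep _) (fun i => ?_) (h1 x) i
        have : dist (Q (min x.1 (c (j+1)), x.2)) (Q (min x.1 (c j), x.2)) < δ := by
          apply hu
          rw [Prod.dist_eq, dist_self, max_eq_left dist_nonneg]
          exact hcc j x.1
        rw [← dist_eq_norm]
        exact (dist_pi_lt_iff hδ).1 this i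
      · intro y
        dsimp only
        rw [min_eq_left unitInterval.nonneg', min_eq_left unitInterval.nonneg', Phi_self, h2]
      · intro y hy t
        dsimp only
        rw [hy (min t (c j)), hy (min t (c (j+1))), Phi_self, h3 y hy]
  obtain ⟨F, hF, h1, h2, h3⟩ := key (M + 1)
  refine ⟨F, hF, fun x i => ?_, h2, h3⟩
  have := h1 x i
  rwa [hc1, min_eq_left unitInterval.le_one'] at this
end hlp
end OC

namespace OC
variable {G : Subgroup ℂˣ} {n : ℕ}

def pts (q : OrbConfPunctPlane n G) : Option (Fin n × G) → ℂ
  | none => 0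
  | some (i, g) => ((g : ℂˣ) : ℂ) * (q.1 i : ℂ)

theorem pts_inj (q : OrbConfPunctPlane n G) (a b : Option (Fin n × G)) (hab : a ≠ b) :
    pts q a ≠ pts q b := by
  have h0 : ∀ (i : Fin n) (g : G), ((g : ℂˣ) : ℂ) * (q.1 i : ℂ) ≠ 0 := fun i g =>
    mul_ne_zero (Units.ne_zero _) (q.1 i).2
  rcases a with _ | ⟨i, g⟩ <;> rcases b with _ | ⟨j, g'⟩
  · exact absurd rfl hab
  · exact (h0 j g').symm
  · exact h0 i g
  · intro h
    change ((g : ℂˣ) : ℂ) * (q.1 i : ℂ) = ((g' : ℂˣ) : ℂ) * (q.1 j : ℂ) at h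
    by_cases hij : i = j
    · subst hij
      have h1 : ((g : ℂˣ) : ℂ) = ((g' : ℂˣ) : ℂ) := mul_right_cancel₀ (q.1 i).2 h
      apply hab
      rw [Subtype.ext (Units.ext h1)]
    · apply q.2 i j hij (g⁻¹ * g')
      have hg : ((g : ℂˣ) : ℂ) ≠ 0 := Units.ne_zero _
      push_cast
      rw [mul_assoc, ← h, inv_mul_cancel_left₀ hg]

theorem coord_cont (i : Fin n) : Continuous fun q : OrbConfPunctPlane n G => q.1 i :=
  (continuous_apply i).comp continuous_subtype_val

theorem pts_cont (a : Option (Fin n × G)) : Continuous fun q : OrbConfPunctPlane n G => pts q a := by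
  rcases a with _ | ⟨i, g⟩
  · exact continuous_const
  · change Continuous fun q : OrbConfPunctPlane n G => ((g : ℂˣ) : ℂ) * (q.1 i : ℂ)
    exact continuous_const.mul (continuous_subtype_val.comp (coord_cont i))

def res (p : OrbConfPunctPlane (n + 1) G) : OrbConfPunctPlane n G :=
  ⟨fun i => p.1 i.castSucc, fun i j hij g => p.2 _ _ (by simpa using hij) g⟩

theorem res_cont : Continuous (res : OrbConfPunctPlane (n + 1) G → OrbConfPunctPlane n G) := by
  apply Continuous.subtype_mk
  exact continuous_pi fun i => coord_cont i.castSucc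

theorem last_ne (p : OrbConfPunctPlane (n + 1) G) (a : Option (Fin n × G)) :
    (p.1 (Fin.last n) : ℂ) ≠ pts (res p) a := by
  rcases a with _ | ⟨i, g⟩
  · exact (p.1 (Fin.last n)).2
  · exact p.2 _ _ (Fin.castSucc_lt_last i).ne' g

def join (q : OrbConfPunctPlane n G) (z : ℂ) (hz : ∀ a, z ≠ pts q a) :
    OrbConfPunctPlane (n + 1) G :=
  ⟨Fin.snoc (α := fun _ => {z : ℂ // z ≠ 0}) q.1 ⟨z, hz none⟩, by
    intro i j
    refine Fin.lastCases ?_ (fun i => ?_) i <;> refine Fin.lastCases ?_ (fun j => ?_) j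
    · intro h; exact absurd rfl h
    · intro _ g
      simp only [Fin.snoc_last, Fin.snoc_castSucc]
      exact hz (some (j, g))
    · intro _ g
      simp only [Fin.snoc_last, Fin.snoc_castSucc]
      intro h
      apply hz (some (i, g⁻¹))
      change z = ((g⁻¹ : G) : ℂˣ) * (q.1 i : ℂ)
      rw [h]
      have hg : ((g : ℂˣ) : ℂ) ≠ 0 := Units.ne_zero _
      push_cast
      rw [inv_mul_cancel_left₀ hg]
    · intro hij g
      simp only [Fin.snoc_castSucc]
      exact q.2 i j (fun h => hij (by rw [h])) g⟩

theorem join_res (p : OrbConfPunctPlane (n + 1) G) (q : OrbConfPunctPlane n G) (z : ℂ) (hz)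
    (hq : q = res p) (h : z = p.1 (Fin.last n)) : join q z hz = p := by
  subst hq
  subst h
  apply Subtype.ext
  funext i
  refine Fin.lastCases ?_ (fun i => ?_) i
  · simp [join]
  · simp [join, res]

theorem join_cont {A : Type} [TopologicalSpace A] (q : A → OrbConfPunctPlane n G) (z : A → ℂ)
    (hz : ∀ x a, z x ≠ pts (q x) a) (hq : Continuous q) (hzc : Continuous z) :
    Continuous fun x => join (q x) (z x) (hz x) := by
  apply Continuous.subtype_mk
  refine continuous_pi fun i => ?_
  refine Fin.lastCases ?_ (fun i => ?_) i
  · simp only [Fin.snoc_last]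
    exact hzc.subtype_mk _
  · simp only [Fin.snoc_castSucc]
    exact (coord_cont i).comp hq

theorem null_conf (hG : Finite G) {k : ℕ} (hk : 2 ≤ k) (n : ℕ) (p : OrbConfPunctPlane n G)
    (f : C(Fin k → I, OrbConfPunctPlane n G)) (hf : ∀ y ∈ Cube.boundary (Fin k), f y = p) :
    f.HomotopicRel (.const _ p) (Cube.boundary (Fin k)) := by
  classical
  induction n with
  | zero =>
    have : f = .const _ p := by
      ext1 y
      apply Subtype.ext
      funext i
      exact i.elim0
    rw [this]
    exact .refl _
  | succ n ih =>
    have : Fintype G := Fintype.ofFinite G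
    obtain ⟨Hn⟩ := ih (res p) ⟨fun y => res (f y), res_cont.comp f.continuous⟩
      (fun y hy => by
        change res (f y) = _
        rw [hf y hy])
    have hH0 : ∀ y, Hn (0, y) = res (f y) := fun y => Hn.apply_zero y
    have hH1 : ∀ y, Hn (1, y) = res p := fun y => Hn.apply_one y
    have hHB : ∀ t, ∀ y ∈ Cube.boundary (Fin k), Hn (t, y) = res (f y) := fun t y hy =>
      Hn.eq_fst t hy
    have hHc : Continuous fun x => Hn x := Hn.continuous
    obtain ⟨F, hFc, hF, hF0, hFB⟩ := hlp (fun x : I × (Fin k → I) => pts (Hn x))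
      (continuous_pi fun a => (pts_cont a).comp hHc) (fun x => pts_inj (Hn x))
      ⟨fun y => ((f y).1 (Fin.last n) : ℂ),
        continuous_subtype_val.comp ((coord_cont (Fin.last n)).comp f.continuous)⟩
      (fun y a => by
        change ((f y).1 (Fin.last n) : ℂ) ≠ pts (Hn (0, y)) a
        rw [hH0]; exact last_ne (f y) a)
    have hFB : ∀ t, ∀ y ∈ Cube.boundary (Fin k), F (t, y) = (f y).1 (Fin.last n) := by
      intro t y hy
      refine hFB y (fun t => ?_) t
      rw [hHB t y hy, hHB 0 y hy]
    have hKc := join_cont _ F hF hHc hFc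
    let f1 : C(Fin k → I, OrbConfPunctPlane (n + 1) G) :=
      ⟨fun y => join (Hn (1, y)) (F (1, y)) (hF (1, y)),
        hKc.comp (by fun_prop : Continuous fun y : Fin k → I => ((1 : I), y))⟩
    have s1 : f.HomotopicRel f1 (Cube.boundary (Fin k)) := by
      refine mkRel _ hKc (fun y => ?_) (fun y => rfl) (fun t y hy => ?_)
      · exact join_res _ _ _ _ (hH0 y) (hF0 y)
      · exact join_res _ _ _ _ (hHB t y hy) (hFB t y hy)
    let Q : Finset ℂ := Finset.univ.image (pts (res p))
    have hQ : ∀ z : ℂ, z ∉ Q ↔ ∀ a, z ≠ pts (res p) a := by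
      intro z
      simp only [Q, Finset.mem_image, Finset.mem_univ, true_and, not_exists]
      exact forall_congr' fun a => ne_comm
    let p' : {z : ℂ // z ∉ Q} := ⟨p.1 (Fin.last n), (hQ _).2 (last_ne p)⟩
    let F1 : C(Fin k → I, {z : ℂ // z ∉ Q}) := ⟨fun y => ⟨F (1, y), (hQ _).2 fun a => by
      rw [← hH1 y]; exact hF (1, y) a⟩, by
        apply Continuous.subtype_mk
        fun_prop⟩
    obtain ⟨H2⟩ := null_plane hk Q ⟨_, Finset.mem_image_of_mem _ (Finset.mem_univ none)⟩ p' F1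
      (fun y hy => by
        apply Subtype.ext
        change F (1, y) = p.1 (Fin.last n)
        rw [hFB 1 y hy, hf y hy])
    have h20 : ∀ y, H2 (0, y) = F1 y := fun y => H2.apply_zero y
    have h21 : ∀ y, H2 (1, y) = p' := fun y => H2.apply_one y
    have h2B : ∀ t, ∀ y ∈ Cube.boundary (Fin k), H2 (t, y) = F1 y := fun t y hy =>
      H2.eq_fst t hy
    have h2c : Continuous fun x => H2 x := H2.continuous
    have hend : ∀ y (x : {z : ℂ // z ∉ Q}) (hx), x = F1 y → join (res p) x.1 hx = f1 y := by
      rintro y x hx rfl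
      change join (res p) (F (1, y)) hx = join (Hn (1, y)) (F (1, y)) (hF (1, y))
      congr 1
      exact (hH1 y).symm
    have s2 : f1.HomotopicRel (.const _ p) (Cube.boundary (Fin k)) := by
      refine mkRel (fun x => join (res p) (H2 x).1 ((hQ _).1 (H2 x).2))
        (join_cont _ _ _ continuous_const (by fun_prop)) (fun y => ?_) (fun y => ?_)
        (fun t y hy => ?_)
      · exact hend y _ _ (h20 y)
      · exact join_res _ _ _ _ rfl (congrArg Subtype.val (h21 y))
      · exact hend y _ _ (h2B t y hy)
    exact s1.trans s2
end OC

end OCHelpers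

/-- For `G` a finite subgroup of `ℂˣ` acting on `ℂ ∖ {0}` by multiplication and
`n ≥ 1`, the orbit configuration space `C_n^G(ℂ ∖ {0})` is aspherical: all
homotopy groups in degree `k ≥ 2` are trivial. -/
theorem stmt_6 (G : Subgroup ℂˣ) (hG : Finite G) (n : ℕ) (hn : 1 ≤ n)
    (k : ℕ) (hk : 2 ≤ k) (p : OrbConfPunctPlane n G) :
    Subsingleton (HomotopyGroup (Fin k) (OrbConfPunctPlane n G) p) := by
  refine ⟨fun a b => ?_⟩
  induction a using Quotient.inductionOn with | _ a => ?_
  induction b using Quotient.inductionOn with | _ b => ?_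
  exact Quotient.sound ((OC.null_conf hG hk n p a.1 a.2).trans (OC.null_conf hG hk n p b.1 b.2).symm)
end

section
/- Let T = (ℝ/ℤ) × (ℝ/ℤ) be the 2-torus, let G be a finite subgroup of T acting on T by translation (this action is free), and let n ≥ 1. Then the orbit configuration space C_n^G(T) is aspherical: for every k ≥ 2 and every basepoint p ∈ C_n^G(T), the homotopy group π_k(C_n^G(T), p) is trivial. -/
/-- The 2-torus `(ℝ/ℤ) × (ℝ/ℤ)`. -/
abbrev Torus2 : Type := AddCircle (1 : ℝ) × AddCircle (1 : ℝ)

/-- The orbit configuration space of `n` points of the torus with respect to the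
(free) translation action of a subgroup `G`: tuples of points lying in pairwise
distinct `G`-orbits. -/
abbrev OrbConfTorus (n : ℕ) (G : AddSubgroup Torus2) : Type :=
  {f : Fin n → Torus2 // ∀ i j : Fin n, i ≠ j → ∀ g : G, f i ≠ (g : Torus2) + f j}

section
open Set Filter Topology unitInterval


namespace OrbAsph

/-- The cube. -/
abbrev Cub (k : ℕ) : Type := Fin k → I

/-- Maps of the cube into `S` which are constant on the boundary. -/
def Adm {k : ℕ} {Z : Type*} [TopologicalSpace Z] (S : Set Z) (φ : C(Cub k, Z)) : Prop :=
  (∀ y, φ y ∈ S) ∧ ∀ y ∈ Cube.boundary (Fin k), ∀ y' ∈ Cube.boundary (Fin k), φ y = φ y'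

/-- All admissible maps are null-homotopic through admissible maps. -/
def Null (k : ℕ) {Z : Type*} [TopologicalSpace Z] (S : Set Z) : Prop :=
  ∀ φ : C(Cub k, Z), Adm S φ → ∃ c, φ.HomotopicWith (ContinuousMap.const _ c) (Adm S)

theorem hw_mk {k : ℕ} {Z : Type*} [TopologicalSpace Z] {S : Set Z} (φ ψ : C(Cub k, Z))
    (H : I × Cub k → Z) (hc : Continuous H) (h0 : ∀ y, H (0, y) = φ y)
    (h1 : ∀ y, H (1, y) = ψ y) (hS : ∀ t y, H (t, y) ∈ S)
    (hb : ∀ t, ∀ y ∈ Cube.boundary (Fin k), ∀ y' ∈ Cube.boundary (Fin k), H (t, y) = H (t, y')) :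
    φ.HomotopicWith ψ (Adm S) :=
  ⟨{ toFun := H, continuous_toFun := hc, map_zero_left := h0, map_one_left := h1,
     prop' := fun t => ⟨fun y => hS t y, fun y hy y' hy' => hb t y hy y' hy'⟩ }⟩

theorem hw_elim {k : ℕ} {Z : Type*} [TopologicalSpace Z] {S : Set Z} {φ ψ : C(Cub k, Z)}
    (h : φ.HomotopicWith ψ (Adm S)) :
    ∃ H : I × Cub k → Z, Continuous H ∧ (∀ y, H (0, y) = φ y) ∧
    (∀ y, H (1, y) = ψ y) ∧ (∀ t y, H (t, y) ∈ S) ∧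
    (∀ t, ∀ y ∈ Cube.boundary (Fin k), ∀ y' ∈ Cube.boundary (Fin k), H (t, y) = H (t, y')) := by
  obtain ⟨H⟩ := h
  exact ⟨H, H.continuous, H.apply_zero, H.apply_one, fun t y => (H.prop' t).1 y,
    fun t y hy y' hy' => (H.prop' t).2 y hy y' hy'⟩

theorem hw_map {k : ℕ} {Z Z' : Type*} [TopologicalSpace Z] [TopologicalSpace Z'] {S : Set Z}
    {S' : Set Z'} (Φ : C(Z, Z')) (hΦ : ∀ z ∈ S, Φ z ∈ S') {φ ψ : C(Cub k, Z)}
    (h : φ.HomotopicWith ψ (Adm S)) : (Φ.comp φ).HomotopicWith (Φ.comp ψ) (Adm S') := by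
  obtain ⟨H, hc, h0, h1, hS, hb⟩ := hw_elim h
  exact hw_mk _ _ (fun p => Φ (H p)) (Φ.continuous.comp hc) (fun y => by simp [h0])
    (fun y => by simp [h1]) (fun t y => hΦ _ (hS t y))
    (fun t y hy y' hy' => by rw [hb t y hy y' hy'])

/-- Transport of `Null` along a map `Φ` through which each admissible map factors. -/
theorem Null.transfer {k : ℕ} {Z Z' : Type*} [TopologicalSpace Z] [TopologicalSpace Z'] {S : Set Z}
    {S' : Set Z'} (hN : Null k S) (Φ : C(Z, Z')) (hΦ : ∀ z ∈ S, Φ z ∈ S')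
    {φ : C(Cub k, Z')} (hl : ∃ ψ : C(Cub k, Z), Adm S ψ ∧ Φ.comp ψ = φ) :
    ∃ c, φ.HomotopicWith (ContinuousMap.const _ c) (Adm S') := by
  obtain ⟨ψ, hψ, rfl⟩ := hl
  obtain ⟨c, hc⟩ := hN ψ hψ
  exact ⟨Φ c, hw_map Φ hΦ hc⟩

theorem boundary_preconnected {k : ℕ} (hk : 2 ≤ k) :
    IsPreconnected (Cube.boundary (Fin k)) := by
  -- faces
  have key : ∀ (i : Fin k) (c : I), c = 0 ∨ c = 1 → ∀ y z : Cub k, y i = c → z i = c →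
      ∃ t ⊆ Cube.boundary (Fin k), y ∈ t ∧ z ∈ t ∧ IsPreconnected t := by
    intro i c hc y z hy hz
    refine ⟨Set.range (fun w : Cub k => Function.update w i c), ?_, ⟨y, ?_⟩, ⟨z, ?_⟩, ?_⟩
    · rintro _ ⟨w, rfl⟩
      exact ⟨i, by simpa using hc⟩
    · simp [← hy]
    · simp [← hz]
    · exact isPreconnected_range (continuous_id.update i continuous_const)
  -- two different indices
  have key2 : ∀ (i j : Fin k), i ≠ j → ∀ y z : Cub k, (y i = 0 ∨ y i = 1) → (z j = 0 ∨ z j = 1) →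
      ∃ t ⊆ Cube.boundary (Fin k), y ∈ t ∧ z ∈ t ∧ IsPreconnected t := by
    intro i j hij y z hy hz
    obtain ⟨t, ht, h1, h2, h3⟩ := key i (y i) hy y (Function.update y j (z j)) rfl (by simp [hij])
    obtain ⟨t', ht', h1', h2', h3'⟩ := key j (z j) hz (Function.update y j (z j)) z (by simp) rfl
    exact ⟨t ∪ t', union_subset ht ht', Or.inl h1, Or.inr h2', IsPreconnected.union _ h2 h1' h3 h3'⟩
  apply isPreconnected_of_forall_pair
  rintro y ⟨i, hi⟩ z ⟨j, hj⟩
  by_cases hij : i = j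
  · subst hij
    have : Nontrivial (Fin k) := Fin.nontrivial_iff_two_le.mpr hk
    obtain ⟨m, hm⟩ := exists_ne i
    obtain ⟨t, ht, h1, h2, h3⟩ := key2 i m hm.symm y (fun _ => 0) hi (Or.inl rfl)
    obtain ⟨t', ht', h1', h2', h3'⟩ := key2 m i hm (fun _ => 0) z (Or.inl rfl) hj
    exact ⟨t ∪ t', union_subset ht ht', Or.inl h1, Or.inr h2', IsPreconnected.union _ h2 h1' h3 h3'⟩
  · exact key2 i j hij y z hi hj

theorem cube_lift {k : ℕ} {E X : Type*} [TopologicalSpace E] [TopologicalSpace X] {p : E → X}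
    (cov : IsCoveringMap p) (f : C(Cub k, X)) (e : E) (he : p e = f 0) :
    ∃ g : C(Cub k, E), (∀ y, p (g y) = f y) ∧ g 0 = e := by
  let H : C(I × Cub k, X) := ⟨fun q => f (fun i => q.1 * q.2 i), by fun_prop⟩
  have H0 : ∀ a, H (0, a) = p (ContinuousMap.const (Cub k) e a) := by
    intro a
    simp only [H, ContinuousMap.coe_mk, zero_mul, ContinuousMap.const_apply, he]
    rfl
  let L := cov.liftHomotopy H (ContinuousMap.const _ e) H0
  have hL := cov.liftHomotopy_lifts H (ContinuousMap.const _ e) H0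
  have hL0 := cov.liftHomotopy_zero H (ContinuousMap.const _ e) H0
  refine ⟨⟨fun y => L (1, y), by fun_prop⟩, fun y => ?_, ?_⟩
  · have := congrFun hL (1, y)
    simpa [H, L] using this
  · have : (L (1, 0)) = L (0, 0) := by
      refine cov.const_of_comp (g := fun t : I => L (t, (0 : Cub k))) (by fun_prop) ?_ 1 0
      intro a a'
      have h1 := congrFun hL (a, 0)
      have h2 := congrFun hL (a', 0)
      simp only [Function.comp_apply] at h1 h2
      simp only [L, h1, h2]
      simp [H]
    simp only [ContinuousMap.coe_mk]
    rw [this]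
    exact hL0 0

/-- Lifts of boundary-constant maps are boundary-constant. -/
theorem lift_bdry {k : ℕ} (hk : 2 ≤ k) {E X : Type*} [TopologicalSpace E] [TopologicalSpace X]
    {p : E → X} (cov : IsCoveringMap p) (f : C(Cub k, X)) (g : C(Cub k, E))
    (hg : ∀ y, p (g y) = f y)
    (hb : ∀ y ∈ Cube.boundary (Fin k), ∀ y' ∈ Cube.boundary (Fin k), f y = f y') :
    ∀ y ∈ Cube.boundary (Fin k), ∀ y' ∈ Cube.boundary (Fin k), g y = g y' := by
  intro y hy y' hy'
  refine cov.constOn_of_comp (boundary_preconnected hk) g.continuous.continuousOn ?_ hy hy'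
  intro a ha a' ha'
  rw [hg, hg, hb a ha a' ha']

/-- Expansion of the unit interval about its centre. -/
noncomputable def ex (s t : I) : I := projIcc 0 1 zero_le_one (1/2 + (1 + (s:ℝ)) * ((t:ℝ) - 1/2))

theorem ex_cont : Continuous (fun q : I × I => ex q.1 q.2) := by
  unfold ex
  exact continuous_projIcc.comp (by fun_prop)

theorem ex_zero (t : I) : ex 0 t = t := by
  unfold ex
  have : (1/2 + (1 + ((0:I):ℝ)) * ((t:ℝ) - 1/2)) = t := by simp
  rw [this]; exact projIcc_val _ _

theorem ex_of_zero (s : I) : ex s 0 = 0 := by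
  unfold ex
  apply projIcc_of_le_left
  have := s.2.1
  simp only [Set.Icc.coe_zero]; linarith

theorem ex_of_one (s : I) : ex s 1 = 1 := by
  unfold ex
  apply projIcc_of_right_le
  have := s.2.1
  simp only [Set.Icc.coe_one]; linarith

/-- Bump function. -/
noncomputable def bu (t : I) : I := projIcc 0 1 zero_le_one (4 * min (t:ℝ) (1 - t))

theorem bu_cont : Continuous bu := continuous_projIcc.comp (by fun_prop)
theorem bu_zero : bu 0 = 0 := projIcc_of_le_left _ (by simp)
theorem bu_one : bu 1 = 0 := projIcc_of_le_left _ (by simp)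
theorem bu_or (t : I) : bu t = 1 ∨ (ex 1 t = 0 ∨ ex 1 t = 1) := by
  by_cases h1 : (t:ℝ) ≤ 1/4
  · right; left; apply projIcc_of_le_left; simp only [Set.Icc.coe_one]; linarith
  by_cases h2 : (t:ℝ) ≤ 3/4
  · left; apply projIcc_of_right_le
    have : 1/4 ≤ min (t:ℝ) (1 - t) := le_min (by linarith) (by linarith)
    linarith
  · right; right; apply projIcc_of_right_le; simp only [Set.Icc.coe_one]; linarith

theorem rel_null {k : ℕ} (hk : 1 ≤ k) {X : Type*} [TopologicalSpace X] {p : X}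
    (f : GenLoop (Fin k) X p) (H : C(I × Cub k, X)) (h0 : ∀ y, H (0, y) = f y) (c : X)
    (h1 : ∀ y, H (1, y) = c)
    (hb : ∀ t, ∀ y ∈ Cube.boundary (Fin k), ∀ y' ∈ Cube.boundary (Fin k), H (t, y) = H (t, y')) :
    GenLoop.Homotopic f GenLoop.const := by
  have hz : (0 : Cub k) ∈ Cube.boundary (Fin k) := ⟨⟨0, hk⟩, Or.inl rfl⟩
  let e (s : I) (y : Cub k) : Cub k := fun i => ex s (y i)
  have e_cont : Continuous (fun q : I × Cub k => e q.1 q.2) :=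
    continuous_pi fun i => ex_cont.comp (by fun_prop : Continuous fun q : I × Cub k => (q.1, q.2 i))
  have e_bd : ∀ s, ∀ y ∈ Cube.boundary (Fin k), e s y ∈ Cube.boundary (Fin k) := by
    rintro s y ⟨i, hi⟩
    refine ⟨i, ?_⟩
    rcases hi with hi | hi
    · left; simp [e, hi, ex_of_zero]
    · right; simp [e, hi, ex_of_one]
  let r (y : Cub k) : I := ∏ i, bu (y i)
  have r_cont : Continuous r :=
    continuous_finsetProd _ fun i _ => bu_cont.comp (continuous_apply i)
  have r_bd : ∀ y ∈ Cube.boundary (Fin k), r y = 0 := by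
    rintro y ⟨i, hi⟩
    refine Finset.prod_eq_zero (Finset.mem_univ i) ?_
    rcases hi with hi | hi <;> simp [hi, bu_zero, bu_one]
  have r_or : ∀ y, r y = 1 ∨ e 1 y ∈ Cube.boundary (Fin k) := by
    intro y
    by_cases h : ∀ i, bu (y i) = 1
    · left; simp [r, h]
    · push Not at h
      obtain ⟨i, hi⟩ := h
      exact Or.inr ⟨i, (bu_or (y i)).resolve_left hi⟩
  have fb : ∀ y ∈ Cube.boundary (Fin k), f y = p := fun y hy => f.2 y hy
  let f1 : GenLoop (Fin k) X p :=
    ⟨⟨fun y => f (e 1 y), f.1.continuous.comp (e_cont.comp (by fun_prop :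
      Continuous fun y : Cub k => ((1 : I), y)))⟩, fun y hy => fb _ (e_bd 1 y hy)⟩
  let f2 : GenLoop (Fin k) X p :=
    ⟨⟨fun y => H (r y, 0), by fun_prop⟩, fun y hy => by
      simp only [ContinuousMap.coe_mk, r_bd y hy]; rw [h0]; exact fb _ hz⟩
  have A1 : GenLoop.Homotopic f f1 := by
    refine ⟨{ toFun := fun q => f (e q.1 q.2), continuous_toFun := f.1.continuous.comp e_cont,
              map_zero_left := ?_, map_one_left := ?_, prop' := ?_ }⟩
    · intro y
      have : e 0 y = y := funext fun i => ex_zero _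
      change f (e 0 y) = f y
      rw [this]
    · intro y; rfl
    · intro t y hy
      exact (fb _ (e_bd t y hy)).trans (fb y hy).symm
  have A2 : GenLoop.Homotopic f1 f2 := by
    refine ⟨{ toFun := fun q => H (min q.1 (r q.2), e 1 q.2), continuous_toFun := ?_,
              map_zero_left := ?_, map_one_left := ?_, prop' := ?_ }⟩
    · refine H.continuous.comp ((continuous_fst.min (r_cont.comp continuous_snd)).prodMk ?_)
      exact e_cont.comp (by fun_prop : Continuous fun q : I × Cub k => ((1 : I), q.2))
    · intro y
      change H (min 0 (r y), e 1 y) = f (e 1 y)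
      rw [min_eq_left (show (0 : I) ≤ r y from (r y).2.1), h0]
    · intro y
      change H (min 1 (r y), e 1 y) = H (r y, 0)
      rw [min_eq_right (show r y ≤ (1 : I) from (r y).2.2)]
      rcases r_or y with h | h
      · rw [h, h1, h1]
      · exact hb _ _ h _ hz
    · intro t y hy
      change H (min t (r y), e 1 y) = f (e 1 y)
      rw [r_bd y hy, min_eq_right (show (0 : I) ≤ t from t.2.1), h0]
  have A3 : GenLoop.Homotopic f2 GenLoop.const := by
    refine ⟨{ toFun := fun q => H (σ q.1 * r q.2, 0), continuous_toFun := by fun_prop,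
              map_zero_left := ?_, map_one_left := ?_, prop' := ?_ }⟩
    · intro y
      change H (σ 0 * r y, 0) = H (r y, 0)
      simp
    · intro y
      change H (σ 1 * r y, 0) = p
      simp only [symm_one, zero_mul]
      rw [h0]; exact fb _ hz
    · intro t y hy
      change H (σ t * r y, 0) = H (r y, 0)
      rw [r_bd y hy]; simp
  exact (A1.trans A2).trans A3

theorem subsingleton_of_null {k : ℕ} (hk : 1 ≤ k) {Z : Type*} [TopologicalSpace Z] {q : Z → Prop}
    (hN : Null k {z | q z}) (p : {z // q z}) :
    Subsingleton (HomotopyGroup (Fin k) {z // q z} p) := by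
  have key : ∀ f : GenLoop (Fin k) {z // q z} p, GenLoop.Homotopic f GenLoop.const := by
    intro f
    let φ : C(Cub k, Z) := ⟨fun y => (f y : Z), continuous_subtype_val.comp f.1.continuous⟩
    have hφ : Adm {z | q z} φ := ⟨fun y => (f y).2, fun y hy y' hy' => by
      change (f y : Z) = f y'
      rw [show f y = p from f.2 y hy, show f y' = p from f.2 y' hy']⟩
    obtain ⟨c, hc⟩ := hN φ hφ
    obtain ⟨H, hcont, h0, h1, hS, hb⟩ := hw_elim hc
    refine rel_null hk f ⟨fun x => ⟨H x, hS x.1 x.2⟩, by fun_prop⟩ (fun y => Subtype.ext (h0 y))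
      ⟨c, by simpa [h1] using hS 1 0⟩ (fun y => Subtype.ext (h1 y))
      (fun t y hy y' hy' => Subtype.ext (hb t y hy y' hy'))
  refine ⟨fun a b => ?_⟩
  induction a using Quotient.inductionOn with | _ a => ?_
  induction b using Quotient.inductionOn with | _ b => ?_
  exact Quotient.sound ((key a).trans (key b).symm)

end OrbAsph

namespace OrbAsph

/-- The plane with the points of `F × {0}` removed. -/
def Pl (F : Finset ℝ) : Set (ℝ × ℝ) := {z | ¬ (z.1 ∈ F ∧ z.2 = 0)}

/-- Letters. -/
abbrev Lt (F : Finset ℝ) (M : ℝ) : Type := {a : ℝ // a ∉ F ∧ |a| ≤ M}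

theorem exists_label (F : Finset ℝ) : ∃ M : ℝ, ∃ n : ℝ → Lt F M,
    (∀ t ∉ F, ∀ᶠ t' in 𝓝 t, n t' = n t) ∧
    (∀ t ∉ F, ∀ s ∈ uIcc t (n t : ℝ), s ∉ F) := by
  obtain ⟨M, hM0, hM⟩ : ∃ M : ℝ, 0 ≤ M ∧ ∀ a ∈ F, |a| < M := by
    refine ⟨∑ a ∈ F, |a| + 1, by positivity, fun a ha => ?_⟩
    have := Finset.single_le_sum (f := fun a : ℝ => |a|) (fun i _ => abs_nonneg i) ha
    linarith
  have hMF : M ∉ F := fun h => by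
    have := hM M h
    rw [abs_of_nonneg hM0] at this
    exact lt_irrefl _ this
  let lab : ℝ → Finset ℝ := fun t => F.filter (· < t)
  let dflt : Lt F M := ⟨M, hMF, by rw [abs_of_nonneg hM0]⟩
  classical
  let A : Finset ℝ → Lt F M := fun L =>
    if h : ∃ t' : Lt F M, lab t' = L then h.choose else dflt
  refine ⟨M, fun t => A (lab t), ?_, ?_⟩
  · intro t ht
    have : ∀ᶠ t' in 𝓝 t, ∀ a ∈ F, (a < t' ↔ a < t) := by
      rw [Filter.eventually_all_finset]
      intro a ha
      rcases lt_or_gt_of_ne (fun h => ht (h ▸ ha) : a ≠ t) with h | h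
      · filter_upwards [lt_mem_nhds h] with t' h'
        exact ⟨fun _ => h, fun _ => h'⟩
      · filter_upwards [gt_mem_nhds h] with t' h'
        exact ⟨fun h2 => absurd h' (not_lt.mpr h2.le), fun h2 => absurd h (not_lt.mpr h2.le)⟩
    filter_upwards [this] with t' h'
    have : lab t' = lab t := Finset.filter_congr h'
    rw [this]
  · intro t ht
    have hex : ∃ t' : Lt F M, lab t' = lab t := by
      by_cases h1 : |t| ≤ M
      · exact ⟨⟨t, ht, h1⟩, rfl⟩
      · push Not at h1
        rcases le_total 0 t with h2 | h2
        · rw [abs_of_nonneg h2] at h1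
          refine ⟨dflt, Finset.filter_congr fun a ha => ?_⟩
          have h3 : a < M := (le_abs_self a).trans_lt (hM a ha)
          exact ⟨fun _ => h3.trans h1, fun _ => h3⟩
        · rw [abs_of_nonpos h2] at h1
          refine ⟨⟨-M, fun h => ?_, by rw [abs_neg, abs_of_nonneg hM0]⟩,
            Finset.filter_congr fun a ha => ?_⟩
          · have := hM _ h
            rw [abs_neg, abs_of_nonneg hM0] at this
            exact lt_irrefl _ this
          · have h3 : -M < a := neg_lt_of_abs_lt (hM a ha)
            change a < -M ↔ a < t
            constructor <;> intro h <;> linarith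
    have hA : lab (A (lab t)) = lab t := by
      simp only [A, dif_pos hex]
      exact hex.choose_spec
    have hAF := (A (lab t)).2.1
    intro s hs hsF
    have hiff : ((s < ((A (lab t) : Lt F M) : ℝ)) ↔ s < t) := by
      have := congrArg (s ∈ ·) hA
      simpa [lab, hsF] using this
    have hst : s ≠ t := fun h => ht (h ▸ hsF)
    have hsA : s ≠ (A (lab t) : ℝ) := fun h => hAF (h ▸ hsF)
    rcases mem_uIcc.mp hs with ⟨h1, h2⟩ | ⟨h1, h2⟩
    · exact absurd (hiff.mp (lt_of_le_of_ne h2 hsA)) (not_lt.mpr h1)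
    · exact absurd (hiff.mpr (lt_of_le_of_ne h2 hst)) (not_lt.mpr h1)

/-- Reduced words. -/
def Wd (A : Type*) : Type _ := {l : List A // l.IsChain (· ≠ ·)}

instance (A : Type*) : TopologicalSpace (Wd A) := ⊥
instance (A : Type*) : DiscreteTopology (Wd A) := ⟨rfl⟩

open Classical in
/-- Multiplication of a reduced word by the involution `a`. -/
noncomputable def flp {A : Type*} (a : A) : Wd A → Wd A
  | ⟨[], _⟩ => ⟨[a], by simp⟩
  | ⟨b :: l, h⟩ => if hab : a = b then ⟨l, h.tail⟩ else ⟨a :: b :: l, by simp [hab, h]⟩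

theorem flp_flp {A : Type*} (a : A) (w : Wd A) : flp a (flp a w) = w := by
  rcases w with ⟨_ | ⟨b, l⟩, h⟩
  · simp [flp]; rfl
  · by_cases hab : a = b
    · subst hab
      rcases l with _ | ⟨c, l⟩
      · simp [flp]; rfl
      · have : a ≠ c := by simp at h; exact h.1
        simp [flp, this]; rfl
    · simp [flp, hab]; rfl

theorem flp_adj {A : Type*} (a : A) (w : Wd A) :
    (flp a w).1 = a :: w.1 ∨ w.1 = a :: (flp a w).1 := by
  rcases w with ⟨_ | ⟨b, l⟩, h⟩
  · simp [flp]
  · by_cases hab : a = b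
    · subst hab; simp [flp]
    · simp [flp, hab]

/-- The two charts. -/
def Ch (F : Finset ℝ) (i : Bool) : Set (ℝ × ℝ) := {z | z.1 ∉ F ∨ 0 < (if i then z.2 else -z.2)}

theorem Ch_open (F : Finset ℝ) (i : Bool) : IsOpen (Ch F i) := by
  have h1 : IsOpen {z : ℝ × ℝ | z.1 ∉ F} :=
    (F.finite_toSet.isClosed.isOpen_compl).preimage continuous_fst
  have h2 : IsOpen {z : ℝ × ℝ | 0 < (if i then z.2 else -z.2)} := by
    cases i
    · simpa using isOpen_lt (continuous_snd : Continuous fun z : ℝ × ℝ => z.2) continuous_const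
    · simpa using isOpen_lt continuous_const (continuous_snd : Continuous fun z : ℝ × ℝ => z.2)
  exact h1.union h2

theorem Ch_both {F : Finset ℝ} {i j : Bool} (hij : i ≠ j) {z : ℝ × ℝ} (h1 : z ∈ Ch F i)
    (h2 : z ∈ Ch F j) : z.1 ∉ F := by
  intro hz
  rcases h1 with h1 | h1
  · exact h1 hz
  rcases h2 with h2 | h2
  · exact h2 hz
  cases i <;> cases j <;> simp at * <;> linarith

theorem Ch_cover {F : Finset ℝ} {z : ℝ × ℝ} (hz : z ∈ Pl F) (h : z ∉ Ch F true) :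
    z ∈ Ch F false := by
  by_contra h'
  simp only [Ch, mem_ofPred_eq, not_or, not_not, not_lt] at h h'
  simp at h h'
  exact hz ⟨h.1, by linarith⟩

open Classical in
/-- The bundle. -/
noncomputable def core (F : Finset ℝ) {M : ℝ} (n : ℝ → Lt F M)
    (hn : ∀ t ∉ F, ∀ᶠ t' in 𝓝 t, n t' = n t) :
    FiberBundleCore Bool (Pl F) (Wd (Lt F M)) where
  baseSet i := {z | (z : ℝ × ℝ) ∈ Ch F i}
  isOpen_baseSet i := (Ch_open F i).preimage continuous_subtype_val
  indexAt z := decide ((z : ℝ × ℝ) ∈ Ch F true)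
  mem_baseSet_at z := by
    by_cases h : (z : ℝ × ℝ) ∈ Ch F true
    · simp [h]
    · simp [h, Ch_cover z.2 h]
  coordChange i j z w := if i = j then w else flp (n z.1.1) w
  coordChange_self i z hz w := by simp
  continuousOn_coordChange i j := by
    by_cases hij : i = j
    · simp only [hij, if_true]; exact continuousOn_snd
    · simp only [hij, if_false]
      rintro ⟨z, w⟩ ⟨⟨h1, h2⟩, -⟩
      apply ContinuousAt.continuousWithinAt
      have hz := Ch_both hij h1 h2
      have h3 : ∀ᶠ q : Pl F × Wd (Lt F M) in 𝓝 (z, w), n q.1.1.1 = n z.1.1 :=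
        (continuous_fst.comp (continuous_subtype_val.comp continuous_fst)).continuousAt.eventually
          (hn _ hz)
      have h4 : ∀ᶠ q : Pl F × Wd (Lt F M) in 𝓝 (z, w), q.2 = w := by
        have : ∀ᶠ v in 𝓝 w, v = w := by simp [nhds_discrete]
        exact (continuous_snd.continuousAt (x := (z, w))).eventually this
      refine (continuousAt_const (y := flp (n z.1.1) w)).congr ?_
      filter_upwards [h3, h4] with q h3 h4
      rw [h3, h4]
  coordChange_comp i j k z hz w := by
    cases i <;> cases j <;> cases k <;> simp [flp_flp]

theorem exists_words {k : ℕ} (hk : 2 ≤ k) (F : Finset ℝ) {M : ℝ} (n : ℝ → Lt F M)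
    (hn : ∀ t ∉ F, ∀ᶠ t' in 𝓝 t, n t' = n t) (φ : C(Cub k, ℝ × ℝ)) (hφ : Adm (Pl F) φ) :
    ∃ w : Bool → Cub k → List (Lt F M),
      (∀ i y, φ y ∈ Ch F i → ∀ᶠ y' in 𝓝 y, w i y' = w i y) ∧
      (∀ y, (φ y).1 ∉ F → w false y = n (φ y).1 :: w true y ∨ w true y = n (φ y).1 :: w false y) ∧
      (∀ y, φ y ∈ Ch F true → Even (w true y).length) ∧
      (∀ y, φ y ∈ Ch F false → ¬ Even (w false y).length) ∧
      (∀ i, ∀ y ∈ Cube.boundary (Fin k), ∀ y' ∈ Cube.boundary (Fin k), w i y = w i y') := by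
  let Z := core F n hn
  let f : C(Cub k, Pl F) := ⟨fun y => ⟨φ y, hφ.1 y⟩, by fun_prop⟩
  have cov : IsCoveringMap (Bundle.TotalSpace.proj : Z.TotalSpace → Pl F) :=
    FiberBundle.isCoveringMap (F := Wd (Lt F M)) (E := Z.Fiber)
  classical
  let w0 : Wd (Lt F M) := if φ 0 ∈ Ch F true then ⟨[], by simp⟩ else ⟨[n 0], by simp⟩
  obtain ⟨g, hg, hg0⟩ := cube_lift cov f (⟨f 0, w0⟩ : Z.TotalSpace) rfl
  have hgb := lift_bdry hk cov f g hg (fun y hy y' hy' => Subtype.ext (hφ.2 y hy y' hy'))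
  let w : Bool → Cub k → Wd (Lt F M) := fun i y => (Z.localTriv i (g y)).2
  have wloc : ∀ i y, φ y ∈ Ch F i → ∀ᶠ y' in 𝓝 y, w i y' = w i y := by
    intro i y hy
    have h1 : ContinuousAt (Z.localTriv i) (g y) := by
      apply (Z.localTriv i).continuousAt
      rw [Z.mem_localTriv_source, ← Z.baseSet_at]
      change ((g y).1).1 ∈ Ch F i
      rw [show (g y).1 = f y from hg y]; exact hy
    have h2 : ContinuousAt (w i) y :=
      continuous_snd.continuousAt.comp (h1.comp g.continuous.continuousAt)
    have : {w i y} ∈ 𝓝 (w i y) := by simp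
    exact h2.eventually this
  have wadj : ∀ y, (φ y).1 ∉ F → w false y = flp (n (φ y).1) (w true y) := by
    intro y hy
    have hb : (g y).1 = f y := hg y
    have h1 : ∀ i, (g y).1 ∈ Z.baseSet i := by
      intro i; rw [hb]; exact Or.inl hy
    have := Z.coordChange_comp (Z.indexAt (g y).1) true false (g y).1
      ⟨⟨Z.mem_baseSet_at _, h1 _⟩, h1 _⟩ (g y).2
    simp only [w, Z.localTriv_apply]
    rw [← this]
    have hcc : ∀ z v, Z.coordChange true false z v = flp (n z.1.1) v :=
      fun z v => by simp [Z, core]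
    rw [hcc]
    congr 2
    rw [hb]; rfl
  have wadj' : ∀ y, (φ y).1 ∉ F → (w false y).1 = n (φ y).1 :: (w true y).1 ∨
      (w true y).1 = n (φ y).1 :: (w false y).1 := by
    intro y hy; rw [wadj y hy]; exact flp_adj _ _
  -- parity
  let Q : Cub k → Prop := fun y => if φ y ∈ Ch F true then Even (w true y).1.length else
    ¬ Even (w false y).1.length
  have hpar : ∀ y, (φ y).1 ∉ F → (Even (w true y).1.length ↔ ¬ Even (w false y).1.length) := by
    intro y hy
    rcases wadj' y hy with h | h
    · rw [h, List.length_cons, Nat.even_add_one, not_not]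
    · rw [h, List.length_cons, Nat.even_add_one]
  have Qt : ∀ y, φ y ∈ Ch F true → (Q y ↔ Even (w true y).1.length) := by
    intro y hy; simp [Q, hy]
  have Qf : ∀ y, φ y ∈ Ch F false → (Q y ↔ ¬ Even (w false y).1.length) := by
    intro y hy
    by_cases h : φ y ∈ Ch F true
    · rw [Qt y h]; exact hpar y (Ch_both (by simp) h hy)
    · simp [Q, h]
  have Qloc : IsLocallyConstant Q := by
    rw [IsLocallyConstant.iff_eventually_eq]
    intro y
    by_cases h : φ y ∈ Ch F true
    · filter_upwards [wloc _ _ h, φ.continuous.continuousAt.eventually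
        ((Ch_open F true).mem_nhds h)] with y' h1 h2
      rw [eq_iff_iff, Qt y' h2, Qt y h, h1]
    · have h := Ch_cover (hφ.1 y) h
      filter_upwards [wloc _ _ h, φ.continuous.continuousAt.eventually
        ((Ch_open F false).mem_nhds h)] with y' h1 h2
      rw [eq_iff_iff, Qf y' h2, Qf y h, h1]
  have Q0 : Q 0 := by
    by_cases h : φ 0 ∈ Ch F true
    · rw [Qt 0 h]
      have : w true 0 = w0 := by
        change (Z.localTriv true (g 0)).2 = w0
        rw [hg0, Z.localTriv_apply]
        have hcc : ∀ i z (v : Wd (Lt F M)), i = true → Z.coordChange i true z v = v :=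
          fun i z v hi => by simp [Z, core, hi]
        exact hcc _ _ _ (by simp [Z, core, f, h])
      rw [this]; simp [w0, h]
    · have h' := Ch_cover (hφ.1 0) h
      rw [Qf 0 h']
      have : w false 0 = w0 := by
        change (Z.localTriv false (g 0)).2 = w0
        rw [hg0, Z.localTriv_apply]
        have hcc : ∀ i z (v : Wd (Lt F M)), i = false → Z.coordChange i false z v = v :=
          fun i z v hi => by simp [Z, core, hi]
        exact hcc _ _ _ (by simp [Z, core, f, h])
      rw [this]; simp [w0, h]
  have Qall : ∀ y, Q y := fun y => by
    rw [Qloc.apply_eq_of_preconnectedSpace y 0]; exact Q0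
  refine ⟨fun i y => (w i y).1, ?_, wadj', ?_, ?_, ?_⟩
  · intro i y hy
    filter_upwards [wloc i y hy] with y' h
    rw [h]
  · intro y hy; exact (Qt y hy).mp (Qall y)
  · intro y hy; exact (Qf y hy).mp (Qall y)
  · intro i y hy y' hy'
    simp only [w, hgb y hy y' hy']

end OrbAsph

namespace OrbAsph

theorem mul_cont {X : Type*} [TopologicalSpace X] {g u : X → ℝ} {x₀ : X} (hg : ContinuousAt g x₀)
    (h0 : g x₀ = 0 → ∃ C, ∀ᶠ x in 𝓝 x₀, g x ≠ 0 → |u x| ≤ C)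
    (h1 : g x₀ ≠ 0 → ∀ᶠ x in 𝓝 x₀, u x = u x₀) : ContinuousAt (fun x => g x * u x) x₀ := by
  by_cases h : g x₀ = 0
  · obtain ⟨C, hC⟩ := h0 h
    have h2 : Tendsto (fun x => |g x| * C) (𝓝 x₀) (𝓝 0) := by
      have h3 : ContinuousAt (fun x => |g x| * C) x₀ := hg.abs.mul continuousAt_const
      have h4 := h3.tendsto
      simpa only [h, abs_zero, zero_mul] using h4
    change Tendsto (fun x => g x * u x) (𝓝 x₀) (𝓝 (g x₀ * u x₀))
    rw [h, zero_mul]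
    refine squeeze_zero_norm' ?_ h2
    filter_upwards [hC] with x hx
    rw [Real.norm_eq_abs, abs_mul]
    by_cases hgx : g x = 0
    · simp [hgx]
    · exact mul_le_mul_of_nonneg_left (hx hgx) (abs_nonneg _)
  · have h2 : ContinuousAt (fun x => g x * u x₀) x₀ := hg.mul continuousAt_const
    refine h2.congr ?_
    filter_upwards [h1 h] with x hx
    rw [hx]

/-- The weights. -/
noncomputable def hh (F : Finset ℝ) (z : ℝ × ℝ) : ℝ := z.2 / (|z.2| + ∏ a ∈ F, |z.1 - a|)

noncomputable def om (F : Finset ℝ) (i : Bool) (z : ℝ × ℝ) : ℝ :=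
  if i then (1 + hh F z) / 2 else (1 - hh F z) / 2

theorem prod_zero_iff (F : Finset ℝ) (x : ℝ) : (∏ a ∈ F, |x - a|) = 0 ↔ x ∈ F := by
  rw [Finset.prod_eq_zero_iff]
  constructor
  · rintro ⟨a, ha, h⟩
    rw [abs_eq_zero, sub_eq_zero] at h
    rwa [h]
  · intro h; exact ⟨x, h, by simp⟩

theorem prod_nonneg' (F : Finset ℝ) (x : ℝ) : 0 ≤ (∏ a ∈ F, |x - a|) :=
  Finset.prod_nonneg fun _ _ => abs_nonneg _

theorem den_pos {F : Finset ℝ} {z : ℝ × ℝ} (hz : z ∈ Pl F) :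
    0 < |z.2| + ∏ a ∈ F, |z.1 - a| := by
  have h1 := prod_nonneg' F z.1
  rcases (abs_nonneg z.2).lt_or_eq with h | h
  · linarith
  · rw [← h]
    have h2 : z.2 = 0 := abs_eq_zero.mp h.symm
    have h3 : z.1 ∉ F := fun h3 => hz ⟨h3, h2⟩
    have h4 : (∏ a ∈ F, |z.1 - a|) ≠ 0 := fun h4 => h3 ((prod_zero_iff F _).mp h4)
    have := lt_of_le_of_ne h1 h4.symm
    linarith

theorem hh_cont {F : Finset ℝ} {z : ℝ × ℝ} (hz : z ∈ Pl F) : ContinuousAt (hh F) z := by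
  unfold hh
  refine ContinuousAt.div (by fun_prop) ?_ (den_pos hz).ne'
  fun_prop

theorem hh_abs {F : Finset ℝ} {z : ℝ × ℝ} (hz : z ∈ Pl F) : |hh F z| ≤ 1 := by
  unfold hh
  rw [abs_div, abs_of_pos (den_pos hz), div_le_one (den_pos hz)]
  linarith [prod_nonneg' F z.1]

theorem om_cont {F : Finset ℝ} (i : Bool) {z : ℝ × ℝ} (hz : z ∈ Pl F) :
    ContinuousAt (om F i) z := by
  have := hh_cont hz
  cases i
  · change ContinuousAt (fun z => if false then (1 + hh F z) / 2 else (1 - hh F z) / 2) z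
    simp only [Bool.false_eq_true, if_false]; fun_prop
  · change ContinuousAt (fun z => if true then (1 + hh F z) / 2 else (1 - hh F z) / 2) z
    simp only [if_true]; fun_prop

theorem om_nonneg {F : Finset ℝ} (i : Bool) {z : ℝ × ℝ} (hz : z ∈ Pl F) : 0 ≤ om F i z := by
  have := abs_le.mp (hh_abs hz)
  cases i
  · simp only [om, Bool.false_eq_true, if_false]; linarith
  · simp only [om, if_true]; linarith

theorem om_sum (F : Finset ℝ) (z : ℝ × ℝ) : om F true z + om F false z = 1 := by
  simp [om]; ring

theorem om_ne {F : Finset ℝ} (i : Bool) {z : ℝ × ℝ} (hz : z ∈ Pl F) (h : om F i z ≠ 0) :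
    z ∈ Ch F i := by
  by_contra hc
  apply h
  simp only [Ch, mem_ofPred_eq, not_or, not_not, not_lt] at hc
  have hd := den_pos hz
  have hp := (prod_zero_iff F z.1).mpr hc.1
  have h2 : z.2 ≠ 0 := fun h2 => hz ⟨hc.1, h2⟩
  cases i
  · simp only [om, hh, Bool.false_eq_true, if_false] at hc ⊢
    rw [hp, abs_of_pos (lt_of_le_of_ne (by linarith) h2.symm), add_zero, div_self h2]; simp
  · simp only [om, hh, if_true] at hc ⊢
    rw [hp, abs_of_neg (lt_of_le_of_ne (by linarith) h2), add_zero, div_neg, div_self h2]; simp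

theorem om_ne' {F : Finset ℝ} (i : Bool) {z : ℝ × ℝ} (hz : z ∈ Pl F) (h : z ∈ Ch F i) :
    om F i z ≠ 0 := by
  intro h0
  have hd := den_pos hz
  have hp := prod_nonneg' F z.1
  have hp2 := (prod_zero_iff F z.1).mp
  cases i
  · simp only [om, hh, Bool.false_eq_true, if_false, Ch, mem_ofPred_eq] at h h0
    have : z.2 / (|z.2| + ∏ a ∈ F, |z.1 - a|) = 1 := by linarith
    rw [div_eq_one_iff_eq hd.ne'] at this
    have h3 := le_abs_self z.2
    have h4 := abs_nonneg z.2
    rcases h with h | h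
    · exact h (hp2 (by linarith))
    · linarith
  · simp only [om, hh, if_true, Ch, mem_ofPred_eq] at h h0
    have : z.2 / (|z.2| + ∏ a ∈ F, |z.1 - a|) = -1 := by linarith
    rw [div_eq_iff hd.ne'] at this
    have h3 := neg_abs_le z.2
    have h4 := abs_nonneg z.2
    rcases h with h | h
    · exact h (hp2 (by linarith))
    · linarith

theorem cos_om {F : Finset ℝ} (z : ℝ × ℝ) :
    Real.cos (Real.pi * om F false z) = Real.sin (Real.pi / 2 * hh F z) := by
  rw [← Real.cos_pi_div_two_sub]
  simp only [om, Bool.false_eq_true, if_false]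
  congr 1; ring

theorem cos_om_pos {F : Finset ℝ} {z : ℝ × ℝ} (hz : z ∈ Pl F) (h : 0 < z.2) :
    0 < Real.cos (Real.pi * om F false z) := by
  rw [cos_om]
  have h1 : 0 < hh F z := div_pos h (den_pos hz)
  have h2 := (abs_le.mp (hh_abs hz)).2
  have := Real.pi_pos
  apply Real.sin_pos_of_pos_of_lt_pi
  · positivity
  · nlinarith

theorem cos_om_neg {F : Finset ℝ} {z : ℝ × ℝ} (hz : z ∈ Pl F) (h : z.2 < 0) :
    Real.cos (Real.pi * om F false z) < 0 := by
  rw [cos_om]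
  have h1 : hh F z < 0 := div_neg_of_neg_of_pos h (den_pos hz)
  have h2 := (abs_le.mp (hh_abs hz)).1
  have := Real.pi_pos
  apply Real.sin_neg_of_neg_of_neg_pi_lt
  · nlinarith
  · nlinarith

theorem om_half {F : Finset ℝ} (i : Bool) {z : ℝ × ℝ} (h : z.2 = 0) : om F i z = 1 / 2 := by
  cases i <;> simp [om, hh, h]

/-- `j`-th letter from the end. -/
def ltr {A : Type*} (d : A) (l : List A) (j : ℕ) : A := l.reverse.getD j d

theorem ltr_cons {A : Type*} (d a : A) (l : List A) (j : ℕ) (h : j < l.length) :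
    ltr d (a :: l) j = ltr d l j := by
  unfold ltr
  rw [List.reverse_cons, List.getD_append _ _ _ _ (by simpa using h)]

theorem ltr_last {A : Type*} (d a : A) (l : List A) : ltr d (a :: l) l.length = a := by
  unfold ltr
  simp [List.getD]

end OrbAsph

namespace OrbAsph

theorem null_Pl {k : ℕ} (hk : 2 ≤ k) (F : Finset ℝ) : Null k (Pl F) := by
  intro φ hφ
  classical
  obtain ⟨M, n, hn, hnF⟩ := exists_label F
  obtain ⟨w, wloc, wadj, wt, wf, wb⟩ := exists_words hk F n hn φ hφ
  have hP := hφ.1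
  -- lengths
  let ℓ : Cub k → ℝ := fun y =>
    om F true (φ y) * (w true y).length + om F false (φ y) * (w false y).length
  have hadj : ∀ i j, i ≠ j → ∀ y, (φ y).1 ∉ F → (w i y).length ≤ (w j y).length + 1 := by
    intro i j hij y hy
    rcases wadj y hy with h | h <;> cases i <;> cases j <;> simp at hij <;> rw [h] <;> simp
    all_goals omega
  have hterm : ∀ i, Continuous (fun y => om F i (φ y) * ((w i y).length : ℝ)) := by
    intro i
    rw [continuous_iff_continuousAt]
    intro y
    refine mul_cont ((om_cont i (hP y)).comp φ.continuous.continuousAt) ?_ ?_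
    · intro h0
      have hj : φ y ∈ Ch F (!i) := by
        apply om_ne _ (hP y)
        have := om_sum F (φ y)
        cases i
        · simp only [Bool.not_false]; rw [h0] at this; intro h; rw [h] at this; simp at this
        · simp only [Bool.not_true]; rw [h0] at this; intro h; rw [h] at this; simp at this
      refine ⟨(w (!i) y).length + 1, ?_⟩
      filter_upwards [wloc _ _ hj, φ.continuous.continuousAt.eventually
        ((Ch_open F (!i)).mem_nhds hj)] with y' h1 h2 h3
      have h4 := om_ne i (hP y') h3
      have h5 := hadj i (!i) (by simp) y' (Ch_both (by simp) h4 h2)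
      rw [h1] at h5
      rw [abs_of_nonneg (by positivity)]
      exact_mod_cast h5
    · intro h0
      filter_upwards [wloc i y (om_ne i (hP y) h0)] with y' h1
      rw [h1]
  have hℓ : Continuous ℓ := (hterm true).add (hterm false)
  have hℓ0 : ∀ y, 0 ≤ ℓ y := fun y =>
    add_nonneg (mul_nonneg (om_nonneg _ (hP y)) (by positivity))
      (mul_nonneg (om_nonneg _ (hP y)) (by positivity))
  -- labels
  let lab : Cub k → ℕ → Lt F M := fun y j =>
    if φ y ∈ Ch F true ∧ j < (w true y).length then ltr (n 0) (w true y) j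
    else ltr (n 0) (w false y) j
  have clA : ∀ i y j, φ y ∈ Ch F i → j < (w i y).length → lab y j = ltr (n 0) (w i y) j := by
    intro i y j hi hj
    cases i
    · by_cases h : φ y ∈ Ch F true ∧ j < (w true y).length
      · simp only [lab, if_pos h]
        rcases wadj y (Ch_both (by simp) h.1 hi) with h1 | h1
        · rw [h1, ltr_cons _ _ _ _ h.2]
        · rw [h1, ltr_cons _ _ _ _ hj]
      · simp only [lab, if_neg h]
    · simp only [lab, if_pos (And.intro hi hj)]
  have clB : ∀ y (j : ℕ), (j : ℝ) < ℓ y → ∃ i, φ y ∈ Ch F i ∧ j < (w i y).length := by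
    intro y j hj
    by_contra hc
    push Not at hc
    have h1 : ∀ i, om F i (φ y) * ((w i y).length : ℝ) ≤ om F i (φ y) * j := by
      intro i
      by_cases h : om F i (φ y) = 0
      · simp [h]
      · exact mul_le_mul_of_nonneg_left (by exact_mod_cast hc i (om_ne i (hP y) h))
          (om_nonneg i (hP y))
    have h2 : ℓ y ≤ (om F true (φ y) + om F false (φ y)) * j := by
      rw [add_mul]; exact add_le_add (h1 true) (h1 false)
    rw [om_sum, one_mul] at h2
    linarith
  have labloc : ∀ y (j : ℕ), (j : ℝ) < ℓ y → ∀ᶠ y' in 𝓝 y, lab y' j = lab y j := by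
    intro y j hj
    obtain ⟨i, hi, hij⟩ := clB y j hj
    filter_upwards [wloc i y hi, φ.continuous.continuousAt.eventually
        ((Ch_open F i).mem_nhds hi)] with y' h1 h2
    rw [clA i y j hi hij, clA i y' j h2 (by rw [h1]; exact hij), h1]
  -- the cosine
  have hcos : ∀ y, Real.cos (Real.pi * ℓ y) = Real.cos (Real.pi * om F false (φ y)) := by
    intro y
    have hs := om_sum F (φ y)
    have hev : ∀ m : ℕ, Even m → ∀ x : ℝ, Real.cos (Real.pi * (m + x)) = Real.cos (Real.pi * x) := by
      rintro m ⟨r, rfl⟩ x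
      rw [show Real.pi * (((r + r : ℕ) : ℝ) + x) = Real.pi * x + r * (2 * Real.pi) by
        push_cast; ring, Real.cos_add_nat_mul_two_pi]
    have hsym : ∀ x : ℝ, Real.cos (Real.pi * (-x)) = Real.cos (Real.pi * x) := by
      intro x; rw [mul_neg, Real.cos_neg]
    by_cases ht : φ y ∈ Ch F true
    · by_cases hf : φ y ∈ Ch F false
      · rcases wadj y (Ch_both (by simp) ht hf) with h | h
        · have : ℓ y = (w true y).length + om F false (φ y) := by
            simp only [ℓ, h, List.length_cons, Nat.cast_add, Nat.cast_one]
            linear_combination ((w true y).length : ℝ) * hs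
          rw [this, hev _ (wt y ht)]
        · have : ℓ y = (w true y).length + -om F false (φ y) := by
            simp only [ℓ, h, List.length_cons, Nat.cast_add, Nat.cast_one]
            linear_combination ((w false y).length + 1 : ℝ) * hs
          rw [this, hev _ (wt y ht), hsym]
      · have h0 : om F false (φ y) = 0 := by
          by_contra h; exact hf (om_ne _ (hP y) h)
        have : ℓ y = (w true y).length + 0 := by
          simp only [ℓ, h0]; rw [h0, add_zero] at hs; rw [hs]; ring
        rw [this, hev _ (wt y ht), h0]
    · have hf := Ch_cover (hP y) ht
      have h0 : om F true (φ y) = 0 := by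
        by_contra h; exact ht (om_ne _ (hP y) h)
      rw [h0, zero_add] at hs
      obtain ⟨r, hr⟩ := Nat.not_even_iff_odd.mp (wf y hf)
      have : ℓ y = (2 * r : ℕ) + 1 := by
        simp only [ℓ, h0, hs, hr]; push_cast; ring
      rw [this, hev _ (by simp), hs]
  -- the map
  let g : Cub k → ℝ → ℝ × ℝ := fun y m =>
    (|Real.sin (Real.pi * m)| * (lab y (⌈m⌉₊ - 1) : ℝ), Real.cos (Real.pi * m))
  have gPl : ∀ y m, g y m ∈ Pl F := by
    rintro y m ⟨h1, h2⟩
    have h3 : |Real.sin (Real.pi * m)| = 1 := by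
      have := Real.sin_sq_add_cos_sq (Real.pi * m)
      simp only [g] at h2
      rw [h2] at this
      have h4 : Real.sin (Real.pi * m) ^ 2 = 1 := by linarith
      exact (sq_eq_sq₀ (abs_nonneg _) zero_le_one).mp (by rw [sq_abs, h4, one_pow])
    simp only [g, h3, one_mul] at h1
    exact (lab y _).2.1 h1
  have gcont : ∀ {X : Type} [TopologicalSpace X] (Y : X → Cub k) (m : X → ℝ), Continuous Y →
      Continuous m → (∀ x, 0 ≤ m x) → (∀ x, m x ≤ ℓ (Y x)) → Continuous (fun x => g (Y x) (m x)) := by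
    intro X _ Y m hY hm hm0 hmℓ
    have hfst : Continuous (fun x => |Real.sin (Real.pi * m x)| *
        (lab (Y x) (⌈m x⌉₊ - 1) : ℝ)) := by
      rw [continuous_iff_continuousAt]
      intro x
      refine mul_cont (by fun_prop) ?_ ?_
      · intro _
        exact ⟨M, Eventually.of_forall fun x _ => (lab (Y x) _).2.2⟩
      · intro hne
        have hni : ∀ j : ℕ, m x ≠ j := by
          rintro j hj
          apply hne
          rw [hj, mul_comm, Real.sin_nat_mul_pi, abs_zero]
        have hpos : 0 < m x := lt_of_le_of_ne (hm0 x) (by simpa using (hni 0).symm)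
        obtain ⟨j, hj⟩ : ∃ j : ℕ, ⌈m x⌉₊ = j + 1 :=
          Nat.exists_eq_succ_of_ne_zero (Nat.ceil_pos.mpr hpos).ne'
        have hj' := (Nat.ceil_eq_iff (by omega)).mp hj
        simp only [Nat.add_sub_cancel] at hj'
        have hlt : m x < ((j + 1 : ℕ) : ℝ) := lt_of_le_of_ne hj'.2 (hni _)
        have e1 : ∀ᶠ x' in 𝓝 x, (j : ℝ) < m x' := hm.continuousAt.eventually (lt_mem_nhds hj'.1)
        have e2 : ∀ᶠ x' in 𝓝 x, m x' < ((j + 1 : ℕ) : ℝ) :=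
          hm.continuousAt.eventually (gt_mem_nhds hlt)
        have e3 := hY.continuousAt.eventually (labloc (Y x) j (hj'.1.trans_le (hmℓ x)))
        filter_upwards [e1, e2, e3] with x' h1 h2 h3
        have h4 : ⌈m x'⌉₊ = j + 1 := (Nat.ceil_eq_iff (by omega)).mpr ⟨by simpa using h1, h2.le⟩
        rw [h4, hj, Nat.add_sub_cancel, h3]
    exact hfst.prodMk (by fun_prop)
  have hb : ∀ y ∈ Cube.boundary (Fin k), ∀ y' ∈ Cube.boundary (Fin k),
      ℓ y = ℓ y' ∧ lab y = lab y' := by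
    intro y hy y' hy'
    have h1 := hφ.2 y hy y' hy'
    have h2 := fun i => wb i y hy y' hy'
    constructor
    · simp only [ℓ, h1, h2]
    · funext j; simp only [lab, h1, h2]
  have hbg : ∀ y ∈ Cube.boundary (Fin k), ∀ y' ∈ Cube.boundary (Fin k), g y = g y' := by
    intro y hy y' hy'
    funext m
    simp only [g, (hb y hy y' hy').2]
  let ψ : C(Cub k, ℝ × ℝ) := ⟨fun y => g y (ℓ y), gcont id ℓ continuous_id hℓ hℓ0 fun _ => le_rfl⟩
  -- bound
  obtain ⟨N, hN⟩ : ∃ N : ℝ, ∀ y, ℓ y ≤ N := by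
    obtain ⟨N, hN⟩ := (isCompact_range hℓ).bddAbove
    exact ⟨N, fun y => hN ⟨y, rfl⟩⟩
  have hN0 : 0 ≤ N := (hℓ0 0).trans (hN 0)
  have H2 : ψ.HomotopicWith (ContinuousMap.const _ (0, 1)) (Adm (Pl F)) := by
    refine hw_mk _ _ (fun q => g q.2 (min (ℓ q.2) (N * (1 - q.1)))) ?_ ?_ ?_ ?_ ?_
    · refine gcont Prod.snd _ continuous_snd (by fun_prop) ?_ ?_
      · intro q
        exact le_min (hℓ0 _) (mul_nonneg hN0 (by linarith [q.1.2.2]))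
      · intro q; exact min_le_left _ _
    · intro y
      simp only [Set.Icc.coe_zero, sub_zero, mul_one, min_eq_left (hN y)]; rfl
    · intro y
      simp [min_eq_right (hℓ0 y), g]
    · intro t y; exact gPl _ _
    · intro t y hy y' hy'
      simp only [hbg y hy y' hy', (hb y hy y' hy').1]
  have H1 : φ.HomotopicWith ψ (Adm (Pl F)) := by
    refine hw_mk _ _ (fun q => (1 - (q.1 : ℝ)) • φ q.2 + (q.1 : ℝ) • ψ q.2) (by fun_prop) ?_ ?_ ?_ ?_
    · intro y; simp
    · intro y; simp
    · rintro t y ⟨h1, h2⟩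
      have ht0 : (0 : ℝ) ≤ t := t.2.1
      have ht1 : (t : ℝ) ≤ 1 := t.2.2
      have hc : (ψ y).2 = Real.cos (Real.pi * om F false (φ y)) := hcos y
      simp only [Prod.fst_add, Prod.smul_fst, Prod.snd_add, Prod.smul_snd, smul_eq_mul] at h1 h2
      rcases lt_trichotomy (φ y).2 0 with h | h | h
      · have h3 := cos_om_neg (hP y) h
        rw [← hc] at h3
        rcases ht0.lt_or_eq with h4 | h4
        · nlinarith
        · rw [← h4] at h2; linarith
      · have hyF : (φ y).1 ∉ F := fun h' => hP y ⟨h', h⟩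
        have hl : (ψ y).1 = n (φ y).1 := by
          have hceil : ∀ j : ℕ, ⌈(j : ℝ) + 1 / 2⌉₊ - 1 = j := by
            intro j
            have : ⌈(j : ℝ) + 1 / 2⌉₊ = j + 1 := by
              rw [Nat.ceil_eq_iff (by omega)]; simp; norm_num
            omega
          have hs : |Real.sin (Real.pi * ℓ y)| = 1 := by
            have h5 := Real.sin_sq_add_cos_sq (Real.pi * ℓ y)
            rw [hcos y, om_half _ h, show Real.pi * (1 / 2) = Real.pi / 2 by ring,
              Real.cos_pi_div_two] at h5
            have h4 : Real.sin (Real.pi * ℓ y) ^ 2 = 1 := by linarith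
            exact (sq_eq_sq₀ (abs_nonneg _) zero_le_one).mp (by rw [sq_abs, h4, one_pow])
          change |Real.sin (Real.pi * ℓ y)| * (lab y (⌈ℓ y⌉₊ - 1) : ℝ) = _
          rw [hs, one_mul]
          rcases wadj y hyF with h6 | h6
          · have : ℓ y = (w true y).length + 1 / 2 := by
              simp only [ℓ, om_half _ h, h6, List.length_cons]; push_cast; ring
            rw [this, hceil, clA false y _ (Or.inl hyF) (by rw [h6]; simp), h6, ltr_last]
          · have : ℓ y = (w false y).length + 1 / 2 := by
              simp only [ℓ, om_half _ h, h6, List.length_cons]; push_cast; ring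
            rw [this, hceil, clA true y _ (Or.inl hyF) (by rw [h6]; simp), h6, ltr_last]
        rw [hl] at h1
        refine hnF _ hyF _ ?_ h1
        rw [← segment_eq_uIcc]
        exact ⟨1 - t, t, by linarith, ht0, by ring, by simp⟩
      · have h3 := cos_om_pos (hP y) h
        rw [← hc] at h3
        rcases ht0.lt_or_eq with h4 | h4
        · nlinarith
        · rw [← h4] at h2; linarith
    · intro t y hy y' hy'
      have : ψ y = ψ y' := by
        change g y (ℓ y) = g y' (ℓ y')
        rw [hbg y hy y' hy', (hb y hy y' hy').1]
      simp only [this, hφ.2 y hy y' hy']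
  exact ⟨_, H1.trans H2⟩

end OrbAsph

namespace OrbAsph

theorem null_fin {k : ℕ} (hk : 2 ≤ k) (D : Finset (ℝ × ℝ)) : Null k ((D : Set (ℝ × ℝ))ᶜ) := by
  classical
  obtain ⟨c, hc⟩ := Infinite.exists_notMem_finset
    ((D ×ˢ D).image fun p => (p.2.1 - p.1.1) / (p.1.2 - p.2.2))
  have hinj : Set.InjOn (fun a : ℝ × ℝ => a.1 + c * a.2) D := by
    intro a ha b hb hab
    simp only at hab
    by_cases h : a.2 = b.2
    · rw [h] at hab
      exact Prod.ext (by linarith) h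
    · exfalso
      apply hc
      refine Finset.mem_image.mpr ⟨(a, b), Finset.mem_product.mpr ⟨ha, hb⟩, ?_⟩
      have : a.2 - b.2 ≠ 0 := sub_ne_zero.mpr h
      simp only
      rw [div_eq_iff this]; linarith
  let P := Lagrange.interpolate D (fun a : ℝ × ℝ => a.1 + c * a.2) (fun a => a.2)
  have hP : ∀ a ∈ D, P.eval (a.1 + c * a.2) = a.2 := fun a ha =>
    Lagrange.eval_interpolate_at_node _ hinj ha
  let F : Finset ℝ := D.image fun a => a.1 + c * a.2
  let Ψ : C(ℝ × ℝ, ℝ × ℝ) :=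
    ⟨fun z => (z.1 - c * (z.2 + P.eval z.1), z.2 + P.eval z.1), by fun_prop⟩
  let Φ : C(ℝ × ℝ, ℝ × ℝ) :=
    ⟨fun z => (z.1 + c * z.2, z.2 - P.eval (z.1 + c * z.2)), by fun_prop⟩
  intro φ hφ
  refine (null_Pl hk F).transfer Ψ ?_ ⟨Φ.comp φ, ⟨?_, ?_⟩, ?_⟩
  · intro z hz hD
    have h2 : z.1 - c * (z.2 + P.eval z.1) + c * (z.2 + P.eval z.1) = z.1 := by ring
    have h1 := hP _ hD
    simp only [Ψ, ContinuousMap.coe_mk, h2] at h1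
    refine hz ⟨Finset.mem_image.mpr ⟨_, hD, ?_⟩, by linarith⟩
    simp [Ψ]
  · rintro y ⟨h1, h2⟩
    obtain ⟨a, ha, hay⟩ := Finset.mem_image.mp h1
    simp only [Φ, ContinuousMap.comp_apply, ContinuousMap.coe_mk] at hay h2
    rw [← hay, hP a ha] at h2
    have h3 : (φ y).2 = a.2 := by linarith
    rw [h3] at hay
    have : φ y = a := Prod.ext (by linarith) h3
    exact hφ.1 y (by rw [this]; exact ha)
  · intro y hy y' hy'
    simp only [ContinuousMap.comp_apply, hφ.2 y hy y' hy']
  · ext y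
    · simp [Ψ, Φ]
    · simp [Ψ, Φ]

theorem null_lf {k : ℕ} (hk : 2 ≤ k) (D : Set (ℝ × ℝ))
    (hD : ∀ R, (D ∩ Metric.closedBall 0 R).Finite) : Null k Dᶜ := by
  intro φ hφ
  obtain ⟨R0, hR0p, hR0⟩ : ∃ R0 : ℝ, 0 ≤ R0 ∧ ∀ y, ‖φ y‖ ≤ R0 := by
    obtain ⟨N, hN⟩ := (isCompact_range φ.continuous.norm).bddAbove
    exact ⟨N, (norm_nonneg _).trans (hN ⟨0, rfl⟩), fun y => hN ⟨y, rfl⟩⟩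
  obtain ⟨R, hR, hRn⟩ : ∃ R ∈ Ioo R0 (R0 + 1), R ∉ (fun z => ‖z‖) '' (D ∩ Metric.closedBall 0 (R0 + 1)) :=
    (Ioo_infinite (by linarith)).exists_notMem_finite ((hD (R0 + 1)).image _)
  have hRp : 0 < R := hR0p.trans_lt hR.1
  have hRD : ∀ z ∈ D, ‖z‖ ≠ R := by
    intro z hz h
    exact hRn ⟨z, ⟨hz, by rw [mem_closedBall_zero_iff, h]; exact hR.2.le⟩, h⟩
  have hmax : ∀ z : ℝ × ℝ, max R ‖z‖ ≠ 0 := fun z => (hRp.trans_le (le_max_left _ _)).ne'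
  let ρ : C(ℝ × ℝ, ℝ × ℝ) := ⟨fun z => (R / max R ‖z‖) • z, by
    refine Continuous.smul (Continuous.div continuous_const (by fun_prop) hmax) continuous_id⟩
  have hρ : ∀ z, ‖z‖ ≤ R → ρ z = z := by
    intro z hz
    simp only [ρ, ContinuousMap.coe_mk, max_eq_left hz, div_self hRp.ne', one_smul]
  have hfin := null_fin hk (hD R).toFinset
  rw [Set.Finite.coe_toFinset] at hfin
  refine hfin.transfer ρ ?_ ⟨φ, ⟨?_, hφ.2⟩, ?_⟩
  · intro z hz hzD
    rcases le_or_gt ‖z‖ R with h | h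
    · rw [hρ z h] at hzD
      exact hz ⟨hzD, by rwa [mem_closedBall_zero_iff]⟩
    · apply hRD _ hzD
      simp only [ρ, ContinuousMap.coe_mk, max_eq_right h.le, norm_smul, norm_div, abs_norm,
        Real.norm_eq_abs, abs_of_pos hRp]
      exact div_mul_cancel₀ _ (hRp.trans h).ne'
  · intro y h; exact hφ.1 y h.1
  · ext1 y; exact hρ _ ((hR0 y).trans hR.1.le)

end OrbAsph

namespace OrbAsph

abbrev VV : Type := ℝ × ℝ

theorem nm_of_lt {Λ : AddSubgroup VV} {u v : VV} (h : ‖v‖ < Metric.infDist u (Λ : Set VV)) :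
    u + v ∉ Λ := by
  intro hm
  have h1 := Metric.infDist_le_dist_of_mem (x := u) (show u + v ∈ (Λ : Set VV) from hm)
  rw [dist_self_add_right] at h1
  linarith

theorem inf_tri {Λ : AddSubgroup VV} (hcl : IsClosed (Λ : Set VV)) (x a b : VV) :
    Metric.infDist (a - b) (Λ : Set VV) ≤
      Metric.infDist (x - b) (Λ : Set VV) + Metric.infDist (x - a) (Λ : Set VV) := by
  have hne : (Λ : Set VV).Nonempty := ⟨0, Λ.zero_mem⟩
  obtain ⟨p, hp, hp'⟩ := hcl.exists_infDist_eq_dist hne (x - b)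
  obtain ⟨q, hq, hq'⟩ := hcl.exists_infDist_eq_dist hne (x - a)
  rw [hp', hq']
  refine (Metric.infDist_le_dist_of_mem (show p - q ∈ (Λ : Set VV) from Λ.sub_mem hp hq)).trans ?_
  have : a - b = (x - b) - (x - a) := by abel
  rw [this]
  exact dist_sub_sub_le _ _ _ _

/-- Bump weights. -/
noncomputable def chi (Λ : AddSubgroup VV) (ε : ℝ) (u : VV) : ℝ :=
  max 0 (1 - Metric.infDist u (Λ : Set VV) / ε)

theorem chi_cont (Λ : AddSubgroup VV) (ε : ℝ) : Continuous (chi Λ ε) := by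
  unfold chi
  have := Metric.continuous_infDist_pt (Λ : Set VV)
  fun_prop

theorem avoid {n : ℕ} {Λ : AddSubgroup VV} (hcl : IsClosed (Λ : Set VV)) {ε : ℝ} (hε : 0 < ε)
    (x : VV) (a δ : Fin n → VV)
    (ha : ∀ i j, i ≠ j → 4 * ε ≤ Metric.infDist (a i - a j) (Λ : Set VV))
    (hδ : ∀ i, ‖δ i‖ < ε) (hx : ∀ i, x - a i ∉ Λ) (i : Fin n) :
    (x + ∑ j, chi Λ ε (x - a j) • δ j) - (a i + δ i) ∉ Λ := by
  have hne : (Λ : Set VV).Nonempty := ⟨0, Λ.zero_mem⟩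
  set r : Fin n → ℝ := fun j => Metric.infDist (x - a j) (Λ : Set VV) with hr
  have hchi0 : ∀ j, ε ≤ r j → chi Λ ε (x - a j) = 0 := by
    intro j hj
    apply max_eq_left
    have : 1 ≤ r j / ε := (one_le_div hε).mpr hj
    simp only [hr] at this
    linarith
  have hchi1 : ∀ j, r j < ε → chi Λ ε (x - a j) = 1 - r j / ε := by
    intro j hj
    apply max_eq_right
    have : r j / ε < 1 := (div_lt_one hε).mpr hj
    simp only [hr] at this
    linarith
  have hsep : ∀ j l, j ≠ l → r j < ε → 3 * ε < r l := by
    intro j l hjl hj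
    have h1 := ha j l hjl
    have h2 := inf_tri hcl x (a j) (a l)
    simp only [hr] at hj ⊢
    linarith
  have hone : ∀ j, r j < ε → ∑ l, chi Λ ε (x - a l) • δ l = (1 - r j / ε) • δ j := by
    intro j hj
    rw [Finset.sum_eq_single j, hchi1 j hj]
    · intro l _ hl
      rw [hchi0 l (by have := hsep j l hl.symm hj; linarith), zero_smul]
    · simp
  by_cases hact : ∃ j, r j < ε
  · obtain ⟨j, hj⟩ := hact
    rw [hone j hj]
    have hrj : 0 < r j := (hcl.notMem_iff_infDist_pos hne).mp (hx j)
    by_cases hij : i = j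
    · subst hij
      have : x + (1 - r i / ε) • δ i - (a i + δ i) = (x - a i) + (-(r i / ε)) • δ i := by
        module
      rw [this]
      apply nm_of_lt
      rw [norm_smul, norm_neg, Real.norm_of_nonneg (by positivity)]
      calc r i / ε * ‖δ i‖ < r i / ε * ε := mul_lt_mul_of_pos_left (hδ i) (by positivity)
        _ = r i := div_mul_cancel₀ _ hε.ne'
    · have : x + (1 - r j / ε) • δ j - (a i + δ i) = (x - a i) + ((1 - r j / ε) • δ j - δ i) := by
        module
      rw [this]
      apply nm_of_lt
      have h1 := hsep j i (Ne.symm hij) hj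
      have h2 : r j / ε < 1 := (div_lt_one hε).mpr hj
      have h3 : 0 < r j / ε := by positivity
      calc ‖(1 - r j / ε) • δ j - δ i‖ ≤ ‖(1 - r j / ε) • δ j‖ + ‖δ i‖ := norm_sub_le _ _
        _ ≤ 1 * ‖δ j‖ + ‖δ i‖ := by
          rw [norm_smul, Real.norm_of_nonneg (by linarith)]
          gcongr
          linarith
        _ < r i := by linarith [hδ i, hδ j]
  · push Not at hact
    have : ∑ l, chi Λ ε (x - a l) • δ l = 0 :=
      Finset.sum_eq_zero fun l _ => by rw [hchi0 l (hact l), zero_smul]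
    rw [this, show x + 0 - (a i + δ i) = (x - a i) + (-δ i) by abel]
    apply nm_of_lt
    rw [norm_neg]
    exact (hδ i).trans_le (hact i)

/-- Configurations in the plane modulo `Λ`. -/
def Cf (Λ : AddSubgroup VV) (n : ℕ) : Set (Fin n → VV) := {p | ∀ i j, i ≠ j → p i - p j ∉ Λ}

theorem cons_mem {Λ : AddSubgroup VV} {n : ℕ} {x : VV} {a : Fin n → VV} (ha : a ∈ Cf Λ n)
    (hx : ∀ i, x - a i ∉ Λ) : (Fin.cons x a : Fin (n + 1) → VV) ∈ Cf Λ (n + 1) := by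
  intro i j hij
  induction i using Fin.cases with
  | zero =>
    induction j using Fin.cases with
    | zero => exact absurd rfl hij
    | succ j => simpa using hx j
  | succ i =>
    induction j using Fin.cases with
    | zero =>
      intro h
      apply hx i
      rw [← neg_sub]
      exact Λ.neg_mem (by simpa using h)
    | succ j => simpa using ha i j (fun h => hij (by rw [h]))

theorem cons_cont {X : Type*} [TopologicalSpace X] {n : ℕ} {x : X → VV} {a : X → Fin n → VV}
    (hx : Continuous x) (ha : Continuous a) :
    Continuous (fun q => (Fin.cons (x q) (a q) : Fin (n + 1) → VV)) := by
  refine continuous_pi fun i => ?_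
  induction i using Fin.cases with
  | zero => simpa using hx
  | succ i => simp only [Fin.cons_succ]; fun_prop

theorem step {k n : ℕ} {Λ : AddSubgroup VV} (hcl : IsClosed (Λ : Set VV)) {ε : ℝ} (hε : 0 < ε)
    (K : I × Cub k → Fin n → VV) (hK : Continuous K) (hKS : ∀ t y, K (t, y) ∈ Cf Λ n)
    (hKb : ∀ t, ∀ y ∈ Cube.boundary (Fin k), ∀ y' ∈ Cube.boundary (Fin k), K (t, y) = K (t, y'))
    (hKε : ∀ q i j, i ≠ j → 4 * ε ≤ Metric.infDist (K q i - K q j) (Λ : Set VV))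
    (γ : I → I) (hγ : Continuous γ) (hγε : ∀ s y i, ‖K (γ s, y) i - K (γ 0, y) i‖ < ε)
    (φ : C(Cub k, Fin (n + 1) → VV)) (hφ : Adm (Cf Λ (n + 1)) φ)
    (hφK : ∀ y i, φ y i.succ = K (γ 0, y) i) :
    ∃ φ' : C(Cub k, Fin (n + 1) → VV), φ.HomotopicWith φ' (Adm (Cf Λ (n + 1))) ∧
      Adm (Cf Λ (n + 1)) φ' ∧ ∀ y i, φ' y i.succ = K (γ 1, y) i := by
  let X : I × Cub k → VV := fun q => φ q.2 0 +
    ∑ j, chi Λ ε (φ q.2 0 - K (γ 0, q.2) j) • (K (γ q.1, q.2) j - K (γ 0, q.2) j)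
  have hX : Continuous X := by
    have := chi_cont Λ ε
    fun_prop
  let H : I × Cub k → Fin (n + 1) → VV := fun q => Fin.cons (X q) (K (γ q.1, q.2))
  have hH : Continuous H := cons_cont hX (by fun_prop)
  have hHS : ∀ t y, H (t, y) ∈ Cf Λ (n + 1) := by
    intro t y
    apply cons_mem (hKS _ _)
    intro i
    have h1 := avoid hcl hε (φ y 0) (fun i => K (γ 0, y) i)
      (fun i => K (γ t, y) i - K (γ 0, y) i) (hKε _) (fun i => hγε t y i)
      (fun i => by
        have := hφ.1 y 0 i.succ (Fin.succ_ne_zero i).symm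
        rwa [hφK] at this) i
    simpa [X] using h1
  have hHb : ∀ t, ∀ y ∈ Cube.boundary (Fin k), ∀ y' ∈ Cube.boundary (Fin k),
      H (t, y) = H (t, y') := by
    intro t y hy y' hy'
    simp only [H, X, hφ.2 y hy y' hy', hKb _ y hy y' hy']
  refine ⟨⟨fun y => H (1, y), by fun_prop⟩, hw_mk _ _ H hH ?_ (fun y => rfl) hHS hHb,
    ⟨fun y => hHS 1 y, hHb 1⟩, ?_⟩
  · intro y
    funext i
    induction i using Fin.cases with
    | zero => simp [H, X]
    | succ i => simp [H, hφK]
  · intro y i; simp [H]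

theorem null_Cf {k : ℕ} (hk : 2 ≤ k) {Λ : AddSubgroup VV} (hcl : IsClosed (Λ : Set VV))
    (hlf : ∀ R, ((Λ : Set VV) ∩ Metric.closedBall 0 R).Finite) (n : ℕ) : Null k (Cf Λ n) := by
  have hne : (Λ : Set VV).Nonempty := ⟨0, Λ.zero_mem⟩
  induction n with
  | zero =>
    intro φ hφ
    refine ⟨φ 0, ?_⟩
    have : φ = ContinuousMap.const _ (φ 0) := by ext1 y; exact Subsingleton.elim _ _
    rw [← this]
    exact hw_mk _ _ (fun q => φ q.2) (by fun_prop) (fun _ => rfl) (fun _ => rfl)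
      (fun _ y => hφ.1 y) (fun _ => hφ.2)
  | succ n ih =>
    intro φ hφ
    let α : C(Cub k, Fin n → VV) := ⟨fun y i => φ y i.succ, by fun_prop⟩
    have hα : Adm (Cf Λ n) α := by
      refine ⟨fun y i j hij => hφ.1 y _ _ (fun h => hij (Fin.succ_injective _ h)), ?_⟩
      intro y hy y' hy'
      funext i
      exact congrFun (hφ.2 y hy y' hy') _
    obtain ⟨c, hc⟩ := ih α hα
    obtain ⟨K, hK, hK0, hK1, hKS, hKb⟩ := hw_elim hc
    obtain ⟨ε, hε, hKε⟩ : ∃ ε > 0, ∀ q i j, i ≠ j →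
        4 * ε ≤ Metric.infDist (K q i - K q j) (Λ : Set VV) := by
      have h1 : ∀ i j, i ≠ j → ∀ᶠ ε in 𝓝[>] (0 : ℝ), ∀ q,
          4 * ε ≤ Metric.infDist (K q i - K q j) (Λ : Set VV) := by
        intro i j hij
        have hcont : Continuous (fun q => Metric.infDist (K q i - K q j) (Λ : Set VV)) :=
          (Metric.continuous_infDist_pt _).comp (by fun_prop)
        obtain ⟨q0, -, hq0⟩ := isCompact_univ.exists_isMinOn (univ_nonempty) hcont.continuousOn
        have hpos := (hcl.notMem_iff_infDist_pos hne).mp (hKS q0.1 q0.2 i j hij)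
        have h2 : ∀ᶠ ε in 𝓝[>] (0 : ℝ), ε < Metric.infDist (K q0 i - K q0 j) (Λ : Set VV) / 4 :=
          nhdsWithin_le_nhds (gt_mem_nhds (by positivity))
        filter_upwards [h2] with ε h3 q
        have h4 : Metric.infDist (K q0 i - K q0 j) (Λ : Set VV) ≤
          Metric.infDist (K q i - K q j) (Λ : Set VV) := hq0 (mem_univ q)
        linarith
      have h2 : ∀ᶠ ε in 𝓝[>] (0 : ℝ), ∀ i j, i ≠ j → ∀ q,
          4 * ε ≤ Metric.infDist (K q i - K q j) (Λ : Set VV) := by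
        rw [eventually_all]; intro i
        rw [eventually_all]; intro j
        by_cases hij : i = j
        · exact Eventually.of_forall fun _ h => absurd hij h
        · filter_upwards [h1 i j hij] with ε h _ using h
      obtain ⟨ε, h3, h4⟩ := (h2.and self_mem_nhdsWithin).exists
      exact ⟨ε, h4, fun q i j hij => h3 i j hij q⟩
    obtain ⟨δ, hδ, hKδ⟩ := Metric.uniformContinuous_iff.mp
      (CompactSpace.uniformContinuous_of_continuous hK) ε hε
    obtain ⟨N, hN⟩ := exists_nat_one_div_lt hδ
    let pr : ℝ → I := projIcc 0 1 zero_le_one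
    have hpr : Continuous pr := continuous_projIcc
    have chain : ∀ m : ℕ, ∃ φ' : C(Cub k, Fin (n + 1) → VV),
        φ.HomotopicWith φ' (Adm (Cf Λ (n + 1))) ∧ Adm (Cf Λ (n + 1)) φ' ∧
        ∀ y i, φ' y i.succ = K (pr (m * (1 / (N + 1))), y) i := by
      intro m
      induction m with
      | zero =>
        refine ⟨φ, hw_mk _ _ (fun q => φ q.2) (by fun_prop) (fun _ => rfl) (fun _ => rfl)
          (fun _ y => hφ.1 y) (fun _ => hφ.2), hφ, ?_⟩
        intro y i
        have : pr ((0 : ℕ) * (1 / (N + 1))) = 0 := by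
          simp only [Nat.cast_zero, zero_mul]; exact projIcc_left _
        rw [this, hK0]; rfl
      | succ m ihm =>
        obtain ⟨φ₁, h1, h2, h3⟩ := ihm
        obtain ⟨φ₂, h4, h5, h6⟩ := step hcl hε K hK hKS hKb hKε
          (fun s => pr ((m + s) * (1 / (N + 1)))) (by fun_prop) (by
            intro s y i
            rw [← dist_eq_norm]
            refine (dist_le_pi_dist _ _ i).trans_lt (hKδ ?_)
            rw [Prod.dist_eq, dist_self, max_eq_left dist_nonneg, Subtype.dist_eq, Real.dist_eq]
            refine (abs_projIcc_sub_projIcc zero_le_one).trans_lt (lt_of_le_of_lt ?_ hN)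
            have e : (m + (s : ℝ)) * (1 / (N + 1)) - (m + ((0 : I) : ℝ)) * (1 / (N + 1))
              = s * (1 / (N + 1)) := by simp; ring
            rw [e, abs_of_nonneg (mul_nonneg s.2.1 (by positivity))]
            exact mul_le_of_le_one_left (by positivity) s.2.2) φ₁ h2 (by
            intro y i; rw [h3]; simp)
        refine ⟨φ₂, h1.trans h4, h5, ?_⟩
        intro y i; rw [h6]; simp
    obtain ⟨φ', h1, h2, h3⟩ := chain (N + 1)
    have hc' : ∀ y i, φ' y i.succ = c i := by
      intro y i
      have : pr ((N + 1 : ℕ) * (1 / (N + 1))) = 1 := by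
        have : ((N + 1 : ℕ) : ℝ) * (1 / (N + 1)) = 1 := by push_cast; field_simp
        rw [this]; exact projIcc_right _
      rw [h3, this, hK1]; rfl
    have hcS : c ∈ Cf Λ n := by
      have := hKS 1 0
      rwa [hK1] at this
    let D : Set VV := {v | ∃ i, v - c i ∈ Λ}
    have hD : ∀ R, (D ∩ Metric.closedBall 0 R).Finite := by
      intro R
      refine (Set.finite_iUnion fun i : Fin n =>
        (hlf (R + ‖c i‖)).image (fun v => v + c i)).subset ?_
      rintro v ⟨⟨i, hi⟩, hv⟩
      rw [mem_iUnion]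
      refine ⟨i, v - c i, ⟨hi, ?_⟩, by simp⟩
      rw [mem_closedBall_zero_iff] at hv ⊢
      exact (norm_sub_le _ _).trans (by linarith)
    let Φ : C(VV, Fin (n + 1) → VV) :=
      ⟨fun v => Fin.cons v c, cons_cont continuous_id continuous_const⟩
    obtain ⟨e, he⟩ := (null_lf hk D hD).transfer (S' := Cf Λ (n + 1)) (φ := φ') Φ
      (fun z hz => cons_mem hcS fun i hi => hz ⟨i, hi⟩)
      ⟨⟨fun y => φ' y 0, by fun_prop⟩, ⟨fun y => by
        rintro ⟨i, hi⟩
        have := h2.1 y 0 i.succ (Fin.succ_ne_zero i).symm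
        rw [hc'] at this
        exact this hi, fun y hy y' hy' => congrFun (h2.2 y hy y' hy') 0⟩, by
        ext1 y
        funext i
        induction i using Fin.cases with
        | zero => simp [Φ]
        | succ i => simp [Φ, hc']⟩
    exact ⟨e, h1.trans he⟩

end OrbAsph

namespace OrbAsph

abbrev AC : Type := AddCircle (1 : ℝ)

/-- The universal covering of the torus. -/
noncomputable def pj : VV →+ AC × AC :=
  AddMonoidHom.prodMap (QuotientAddGroup.mk' _) (QuotientAddGroup.mk' _)

theorem pj_apply (v : VV) : pj v = ((v.1 : AC), (v.2 : AC)) := rfl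

theorem pj_cont : Continuous pj := by
  change Continuous fun v : VV => ((v.1 : AC), (v.2 : AC))
  exact ((AddCircle.continuous_mk' 1).comp continuous_fst).prodMk
    ((AddCircle.continuous_mk' 1).comp continuous_snd)

theorem fib_fin (t : AC) (R : ℝ) : {x : ℝ | (x : AC) = t ∧ |x| ≤ R}.Finite := by
  obtain ⟨x0, rfl⟩ := QuotientAddGroup.mk_surjective t
  refine ((Set.finite_Icc ⌊-R - |x0|⌋ ⌈R + |x0|⌉).image (fun z : ℤ => x0 + z)).subset ?_
  rintro x ⟨h1, h2⟩
  have h1' : (x : AC) = (x0 : AC) := h1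
  have h3 : ((x - x0 : ℝ) : AC) = 0 := by rw [AddCircle.coe_sub, h1', sub_self]
  obtain ⟨z, hz⟩ := (AddCircle.coe_eq_zero_iff 1).mp h3
  rw [zsmul_eq_mul, mul_one] at hz
  have h4 := abs_le.mp h2
  have h5 := abs_le.mp (le_refl |x0|)
  refine ⟨z, ⟨?_, ?_⟩, by simp only [hz]; ring⟩
  · have : ((⌊-R - |x0|⌋ : ℤ) : ℝ) ≤ z := (Int.floor_le _).trans (by linarith)
    exact_mod_cast this
  · have : (z : ℝ) ≤ ((⌈R + |x0|⌉ : ℤ) : ℝ) := le_trans (by linarith) (Int.le_ceil _)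
    exact_mod_cast this

theorem null_torus {k : ℕ} (hk : 2 ≤ k) (G : AddSubgroup (AC × AC)) (hG : Finite G) (n : ℕ) :
    Null k {f : Fin n → AC × AC | ∀ i j, i ≠ j → ∀ g : G, f i ≠ (g : AC × AC) + f j} := by
  let Λ : AddSubgroup VV := G.comap pj
  have hGf : (G : Set (AC × AC)).Finite := Set.toFinite _
  have hcl : IsClosed (Λ : Set VV) := hGf.isClosed.preimage pj_cont
  have hlf : ∀ R, ((Λ : Set VV) ∩ Metric.closedBall 0 R).Finite := by
    intro R
    refine (hGf.biUnion fun g _ => (fib_fin g.1 R).prod (fib_fin g.2 R)).subset ?_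
    rintro v ⟨h1, h2⟩
    rw [mem_iUnion₂]
    rw [mem_closedBall_zero_iff, Prod.norm_def, max_le_iff] at h2
    exact ⟨pj v, h1, ⟨rfl, h2.1⟩, ⟨rfl, h2.2⟩⟩
  have key := null_Cf hk hcl hlf n
  intro φ hφ
  let Φ : C(Fin n → VV, Fin n → AC × AC) :=
    ⟨fun f i => pj (f i), continuous_pi fun i => pj_cont.comp (continuous_apply i)⟩
  have lift : ∀ f : C(Cub k, AC), ∃ g : C(Cub k, ℝ), ∀ y, (g y : AC) = f y := by
    intro f
    obtain ⟨e, he⟩ := QuotientAddGroup.mk_surjective (f 0)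
    obtain ⟨g, hg, -⟩ := cube_lift (AddCircle.isCoveringMap_coe 1) f e he
    exact ⟨g, hg⟩
  have lift_b : ∀ (f : C(Cub k, AC)) (g : C(Cub k, ℝ)), (∀ y, (g y : AC) = f y) →
      (∀ y ∈ Cube.boundary (Fin k), ∀ y' ∈ Cube.boundary (Fin k), f y = f y') →
      ∀ y ∈ Cube.boundary (Fin k), ∀ y' ∈ Cube.boundary (Fin k), g y = g y' := fun f g hg hb =>
    lift_bdry hk (AddCircle.isCoveringMap_coe 1) f g hg hb
  choose g1 hg1 using fun i => lift ⟨fun y => (φ y i).1, by fun_prop⟩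
  choose g2 hg2 using fun i => lift ⟨fun y => (φ y i).2, by fun_prop⟩
  have hlift : ∀ y i, pj (g1 i y, g2 i y) = φ y i := fun y i =>
    Prod.ext (hg1 i y) (hg2 i y)
  refine key.transfer Φ ?_ ⟨⟨fun y i => (g1 i y, g2 i y), by fun_prop⟩, ⟨?_, ?_⟩, ?_⟩
  · intro f hf i j hij g hfg
    apply hf i j hij
    change pj (f i - f j) ∈ G
    have : pj (f i) = g + pj (f j) := hfg
    rw [map_sub, this, add_sub_cancel_right]
    exact g.2
  · intro y i j hij hm
    have hm' : pj ((g1 i y, g2 i y) - (g1 j y, g2 j y)) ∈ G := hm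
    rw [map_sub, hlift, hlift] at hm'
    exact hφ.1 y i j hij ⟨_, hm'⟩ (by simp)
  · intro y hy y' hy'
    funext i
    exact Prod.ext
      (lift_b _ _ (hg1 i) (fun a ha b hb => by
        simp only [ContinuousMap.coe_mk, hφ.2 a ha b hb]) y hy y' hy')
      (lift_b _ _ (hg2 i) (fun a ha b hb => by
        simp only [ContinuousMap.coe_mk, hφ.2 a ha b hb]) y hy y' hy')
  · ext1 y
    funext i
    exact hlift y i

end OrbAsph


end

/-- For `G` a finite subgroup of the torus `T = (ℝ/ℤ)²` acting on `T` by
translation and `n ≥ 1`, the orbit configuration space `C_n^G(T)` is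
aspherical: all homotopy groups in degree `k ≥ 2` are trivial. -/
theorem stmt_7 (G : AddSubgroup Torus2) (hG : Finite G) (n : ℕ) (hn : 1 ≤ n)
    (k : ℕ) (hk : 2 ≤ k) (p : OrbConfTorus n G) :
    Subsingleton (HomotopyGroup (Fin k) (OrbConfTorus n G) p) := by
  exact OrbAsph.subsingleton_of_null (by omega) (OrbAsph.null_torus hk G hG n) p
end
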